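/- Let (W,S) be a finite irreducible Coxeter system of rank n with Coxeter number h. Then the number MC(W) of maximal chains in the noncrossing partition lattice L_W satisfies |W| · MC(W) = n! · hⁿ. -/

import Mathlib

open scoped BigOperators

section Defs

variable {G : Type*} [Group G]

/-- `t` is a reflection with respect to the generating set `S`:
a conjugate of an element of `S`. -/
def IsReflectionOf (S : Set G) (t : G) : Prop :=
  ∃ g : G, ∃ s ∈ S, t = g * s * g⁻¹

/-- The absolute length of `w`: the minimal length of a word in the
reflections (conjugates of elements of `S`) whose product is `w`. -/
noncomputable def absLength (S : Set G) (w : G) : ℕ :=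
  sInf {k | ∃ l : List G, (∀ t ∈ l, IsReflectionOf S t) ∧ l.length = k ∧ l.prod = w}

/-- The absolute order: `u ≤ v` iff `ℓ_T(u) + ℓ_T(u⁻¹v) = ℓ_T(v)`. -/
def absLe (S : Set G) (u v : G) : Prop :=
  absLength S u + absLength S (u⁻¹ * v) = absLength S v

/-- `c` is a Coxeter element with respect to the set `S` of simple reflections:
a product of all the elements of `S`, each occurring exactly once, in some order. -/
def IsCoxeterElementOf (S : Set G) (c : G) : Prop :=
  ∃ l : List G, l.Nodup ∧ (∀ x, x ∈ l ↔ x ∈ S) ∧ l.prod = c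

/-- The rank-selected multichain count `C_{(j₁,…,j_m)}(W)`: the number of multichains
`x₁ ≤ ⋯ ≤ x_{m-1}` in the interval `[1,c]` of the absolute order whose sequence of
rank jumps (prepending `1` and appending `c`) is given by `j`. -/
noncomputable def chainCount (S : Set G) (c : G) {m : ℕ} (j : Fin m → ℕ) : ℕ :=
  Nat.card {y : Fin (m + 1) → G //
    y 0 = 1 ∧ y (Fin.last m) = c ∧
    (∀ i, absLe S (y i) c) ∧
    (∀ i : Fin m, absLe S (y i.castSucc) (y i.succ)) ∧
    (∀ i : Fin m, absLength S (y i.succ) = absLength S (y i.castSucc) + j i)}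

end Defs

section Cox

variable {B : Type*} {W : Type*} [Group W] {M : CoxeterMatrix B}

/-- The set of simple reflections of a Coxeter system. -/
def simpleSet (cs : CoxeterSystem M W) : Set W := Set.range cs.simple

/-- A Coxeter system is irreducible if its set of simple reflections is nonempty and cannot
be partitioned into two nonempty subsets such that every simple reflection in one commutes
with every simple reflection in the other. -/
def IsIrreducibleCS (cs : CoxeterSystem M W) : Prop :=
  Nonempty B ∧
    ∀ A : Set B, (∀ a ∈ A, ∀ b ∈ Aᶜ, Commute (cs.simple a) (cs.simple b)) →
      A = ∅ ∨ A = Set.univ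

/-- The standard parabolic subgroup `W_⟨s⟩` generated by the simple reflections
other than `cs.simple s`. -/
def parabolic (cs : CoxeterSystem M W) (s : B) : Subgroup W :=
  Subgroup.closure (Set.range cs.simple \ {cs.simple s})

/-- The set of simple reflections of the parabolic subgroup `W_⟨s⟩`, viewed as
elements of that subgroup. -/
def parabolicGens (cs : CoxeterSystem M W) (s : B) : Set (parabolic cs s) :=
  {x | (x : W) ∈ Set.range cs.simple \ {cs.simple s}}

end Cox

section MaxChains

variable {G : Type*} [Group G]

/-- The number of maximal chains `1 = x₀ < x₁ < ⋯ < x_n = c` (with `ℓ_T(x_i) = i` for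
all `i`) in the noncrossing partition lattice `[1,c]` in the absolute order. -/
noncomputable def maxChainCount (S : Set G) (c : G) (n : ℕ) : ℕ :=
  Nat.card {y : Fin (n + 1) → G //
    y 0 = 1 ∧ y (Fin.last n) = c ∧
    (∀ i : Fin n, absLe S (y i.castSucc) (y i.succ)) ∧
    (∀ i : Fin (n + 1), absLength S (y i) = (i : ℕ))}

end MaxChains
namespace CoxeterMatrix

variable {B : Type*} (M : CoxeterMatrix B)

/-- The entry `-cos (π / m)` of the Gram matrix of the simple roots; it is `-1` if `m = 0`. -/
noncomputable def cosEntry (i j : B) : ℝ := -Real.cos (Real.pi / M i j)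

lemma cosEntry_self (i : B) : M.cosEntry i i = 1 := by simp [cosEntry]

lemma cosEntry_comm (i j : B) : M.cosEntry i j = M.cosEntry j i := by
  simp [cosEntry, M.symmetric i j]

lemma two_le_of_ne {i j : B} (h : i ≠ j) (h0 : M i j ≠ 0) : 2 ≤ M i j := by
  have := M.off_diagonal i j h
  omega

lemma cosEntry_nonpos {i j : B} (h : i ≠ j) : M.cosEntry i j ≤ 0 := by
  rw [cosEntry, neg_nonpos]
  rcases Nat.eq_zero_or_pos (M i j) with h0 | h0
  · simp [h0]
  have h2 : (2 : ℝ) ≤ M i j := by exact_mod_cast M.two_le_of_ne h h0.ne'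
  apply Real.cos_nonneg_of_neg_pi_div_two_le_of_le
  · have : 0 ≤ Real.pi / M i j := by positivity
    linarith [Real.pi_pos]
  · exact div_le_div_of_nonneg_left Real.pi_pos.le (by norm_num) h2

lemma cosEntry_le_neg_half {i j : B} (h : i ≠ j) (h' : M i j ≠ 2) : M.cosEntry i j ≤ -1 / 2 := by
  suffices 1 / 2 ≤ Real.cos (Real.pi / M i j) by rw [cosEntry]; linarith
  rcases Nat.eq_zero_or_pos (M i j) with h0 | h0
  · simp [h0]; norm_num
  have h3 : (3 : ℝ) ≤ M i j := by
    have := M.two_le_of_ne h h0.ne'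
    exact_mod_cast (by omega : 3 ≤ M i j)
  rw [← Real.cos_pi_div_three]
  apply Real.cos_le_cos_of_nonneg_of_le_pi
  · positivity
  · linarith [Real.pi_pos]
  · exact div_le_div_of_nonneg_left Real.pi_pos.le (by norm_num) h3

lemma cosEntry_eq_zero_iff {i j : B} (h : i ≠ j) : M.cosEntry i j = 0 ↔ M i j = 2 := by
  refine ⟨fun h0 => ?_, fun h2 => by simp [cosEntry, h2]⟩
  by_contra h2
  linarith [M.cosEntry_le_neg_half h h2]

variable [Fintype B] [DecidableEq B]

/-- The canonical bilinear form of a Coxeter matrix. -/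
noncomputable def form : LinearMap.BilinForm ℝ (B → ℝ) := Matrix.toBilin' (Matrix.of M.cosEntry)

/-- The simple roots, i.e. the standard basis. -/
abbrev simpleRoot {B : Type*} [DecidableEq B] (i : B) : B → ℝ := Pi.single i 1

lemma eq_sum_simpleRoot (v : B → ℝ) : v = ∑ i, v i • simpleRoot i := by
  ext j
  simp [Finset.sum_apply, Pi.single_apply]

@[simp]
lemma form_simpleRoot (i j : B) : M.form (simpleRoot i) (simpleRoot j) = M.cosEntry i j := by
  simp [form]

lemma form_comm (u v : B → ℝ) : M.form u v = M.form v u := by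
  simp only [form, Matrix.toBilin'_apply, Matrix.of_apply]
  rw [Finset.sum_comm]
  refine Finset.sum_congr rfl fun i _ => Finset.sum_congr rfl fun j _ => ?_
  rw [M.cosEntry_comm]; ring

lemma form_eq_sum (u v : B → ℝ) : M.form u v = ∑ i, u i * M.form (simpleRoot i) v := by
  conv_lhs => rw [eq_sum_simpleRoot u]
  simp

/-- The reflection map `v ↦ v - 2⟨γ, v⟩γ`. -/
noncomputable def reflMap (γ : B → ℝ) : Module.End ℝ (B → ℝ) :=
  LinearMap.id - (2 : ℝ) • (M.form γ).smulRight γ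

lemma reflMap_apply (γ v : B → ℝ) : M.reflMap γ v = v - (2 * M.form γ v) • γ := by
  simp [reflMap, smul_smul]

lemma reflMap_reflMap {γ : B → ℝ} (h : M.form γ γ = 1) (v : B → ℝ) :
    M.reflMap γ (M.reflMap γ v) = v := by
  simp only [reflMap_apply, map_sub, map_smul, h]
  module

lemma form_reflMap {γ : B → ℝ} (h : M.form γ γ = 1) (u v : B → ℝ) :
    M.form (M.reflMap γ u) (M.reflMap γ v) = M.form u v := by
  simp only [reflMap_apply, map_sub, map_smul, LinearMap.sub_apply, LinearMap.smul_apply,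
    smul_eq_mul, h, M.form_comm u γ]
  ring

private lemma reflMap_mul_reflMap_pow_apply (i j : B) (θ : ℝ) (hθ : M.cosEntry i j = -Real.cos θ)
    (k : ℕ) (x : ℝ) :
    ((M.reflMap (simpleRoot j) * M.reflMap (simpleRoot i)) ^ k)
      (Real.sin ((x + 1) * θ) • simpleRoot i + Real.sin (x * θ) • simpleRoot j) =
      Real.sin ((x - 2 * k + 1) * θ) • simpleRoot i +
        Real.sin ((x - 2 * k) * θ) • simpleRoot j := by
  induction k generalizing x with
  | zero => simp
  | succ k ih =>
    have key : (M.reflMap (simpleRoot j) * M.reflMap (simpleRoot i))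
        (Real.sin ((x + 1) * θ) • simpleRoot i + Real.sin (x * θ) • simpleRoot j) =
        Real.sin ((x - 2 + 1) * θ) • simpleRoot i + Real.sin ((x - 2) * θ) • simpleRoot j := by
      have h1 : Real.sin ((x + 1) * θ) = 2 * Real.cos θ * Real.sin (x * θ)
          - Real.sin ((x - 1) * θ) := by
        rw [add_mul, sub_mul, one_mul, Real.sin_add, Real.sin_sub]; ring
      have h2 : Real.sin ((x - 2) * θ) = 2 * Real.cos θ * Real.sin ((x - 1) * θ)
          - Real.sin (x * θ) := by
        rw [show (x - 2) * θ = (x - 1) * θ - θ by ring, show x * θ = (x - 1) * θ + θ by ring,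
          Real.sin_add, Real.sin_sub]; ring
      rw [h2, show x - 2 + 1 = x - 1 by ring, h1]
      simp only [Module.End.mul_apply, reflMap_apply, map_sub, map_smul, map_add,
        M.cosEntry_comm j i, form_simpleRoot, cosEntry_self, hθ]
      module
    rw [pow_succ, Module.End.mul_apply, key, ih]
    push_cast
    ring_nf

lemma isLiftable_reflMap : M.IsLiftable fun i => M.reflMap (simpleRoot i) := by
  intro j i
  rcases eq_or_ne i j with rfl | hij
  · refine LinearMap.ext fun v => ?_
    simp [Module.End.mul_apply, reflMap_reflMap, cosEntry_self]
  rcases Nat.eq_zero_or_pos (M j i) with h0 | h0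
  · simp [h0]
  have h2 : (2 : ℝ) ≤ M j i := by exact_mod_cast M.two_le_of_ne hij.symm h0.ne'
  set θ := Real.pi / M j i with hθ
  have hmθ : (M j i : ℝ) * θ = Real.pi := by rw [hθ]; field_simp
  have hθpos : 0 < θ := by positivity
  have hsin : 0 < Real.sin θ := Real.sin_pos_of_pos_of_lt_pi hθpos (by nlinarith [Real.pi_pos])
  have hcos : M.cosEntry i j = -Real.cos θ := by rw [cosEntry_comm]; rfl
  set T := M.reflMap (simpleRoot j) * M.reflMap (simpleRoot i) with hT
  have hPx (x : ℝ) : (T ^ M j i) (Real.sin ((x + 1) * θ) • simpleRoot i +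
      Real.sin (x * θ) • simpleRoot j) =
      Real.sin ((x + 1) * θ) • simpleRoot i + Real.sin (x * θ) • simpleRoot j := by
    rw [hT, M.reflMap_mul_reflMap_pow_apply i j θ hcos,
      show (x - 2 * (M j i : ℝ) + 1) * θ = (x + 1) * θ - 2 * (M j i * θ) by ring,
      show (x - 2 * (M j i : ℝ)) * θ = x * θ - 2 * (M j i * θ) by ring, hmθ,
      Real.sin_sub_two_pi, Real.sin_sub_two_pi]
  have hi : (T ^ M j i) (simpleRoot i) = simpleRoot i := by
    have := hPx 0
    simp only [zero_add, one_mul, zero_mul, Real.sin_zero, zero_smul, add_zero, map_smul] at this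
    exact smul_right_injective _ hsin.ne' this
  have hj : (T ^ M j i) (simpleRoot j) = simpleRoot j := by
    have := hPx (-1)
    simp only [neg_add_cancel, zero_mul, Real.sin_zero, zero_smul, zero_add, map_smul] at this
    refine smul_right_injective _ ?_ this
    rw [neg_one_mul, Real.sin_neg]
    exact neg_ne_zero.mpr hsin.ne'
  have hz (z : B → ℝ) (hzi : M.form (simpleRoot i) z = 0) (hzj : M.form (simpleRoot j) z = 0)
      (k : ℕ) : (T ^ k) z = z := by
    induction k with
    | zero => simp
    | succ k ih =>
      have hTz : T z = z := by simp [hT, Module.End.mul_apply, reflMap_apply, hzi, hzj]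
      rw [pow_succ, Module.End.mul_apply, hTz, ih]
  apply LinearMap.ext
  intro v
  set a := (M.form (simpleRoot i) v + M.form (simpleRoot j) v * Real.cos θ) / Real.sin θ ^ 2
  set b := (M.form (simpleRoot j) v + M.form (simpleRoot i) v * Real.cos θ) / Real.sin θ ^ 2
  have hv : v = a • simpleRoot i + b • simpleRoot j +
      (v - a • simpleRoot i - b • simpleRoot j) := by abel
  have hsc := Real.sin_sq_add_cos_sq θ
  rw [hv, map_add, map_add, map_smul, map_smul, hi, hj, hz]
  · simp
  · simp only [map_sub, map_smul, form_simpleRoot, cosEntry_self, hcos, smul_eq_mul, a, b]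
    field_simp
    linear_combination M.form (simpleRoot i) v * hsc
  · simp only [map_sub, map_smul, form_simpleRoot, cosEntry_self, M.cosEntry_comm j i, hcos,
      smul_eq_mul, a, b]
    field_simp
    linear_combination M.form (simpleRoot j) v * hsc

end CoxeterMatrix

namespace CoxeterSystem

open CoxeterMatrix

variable {B W : Type*} [Group W] {M : CoxeterMatrix B} (cs : CoxeterSystem M W)
  [Fintype B] [DecidableEq B]

/-- The geometric (Tits) representation. -/
noncomputable def geomRep : W →* Module.End ℝ (B → ℝ) :=
  cs.lift ⟨fun i => M.reflMap (simpleRoot i), M.isLiftable_reflMap⟩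

lemma geomRep_simple (i : B) (v : B → ℝ) :
    cs.geomRep (cs.simple i) v = v - (2 * M.form (simpleRoot i) v) • simpleRoot i := by
  rw [geomRep, cs.lift_apply_simple, reflMap_apply]

lemma geomRep_simple_self (i : B) :
    cs.geomRep (cs.simple i) (simpleRoot i) = -simpleRoot i := by
  rw [geomRep_simple, form_simpleRoot, cosEntry_self]
  module

lemma geomRep_mul (w w' : W) (v : B → ℝ) :
    cs.geomRep (w * w') v = cs.geomRep w (cs.geomRep w' v) := by
  rw [map_mul, Module.End.mul_apply]

@[simp]
lemma geomRep_one (v : B → ℝ) : cs.geomRep 1 v = v := by simp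

@[simp]
lemma geomRep_inv_self (w : W) (v : B → ℝ) : cs.geomRep w⁻¹ (cs.geomRep w v) = v := by
  rw [← geomRep_mul, inv_mul_cancel, geomRep_one]

@[simp]
lemma geomRep_self_inv (w : W) (v : B → ℝ) : cs.geomRep w (cs.geomRep w⁻¹ v) = v := by
  rw [← geomRep_mul, mul_inv_cancel, geomRep_one]

lemma form_geomRep (w : W) (u v : B → ℝ) :
    M.form (cs.geomRep w u) (cs.geomRep w v) = M.form u v := by
  induction w using cs.simple_induction_left with
  | one => simp
  | mul_simple_left w i ih =>
    rw [geomRep_mul, geomRep_mul, ← ih, geomRep, cs.lift_apply_simple]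
    exact M.form_reflMap (by simp [cosEntry_self]) _ _

lemma form_geomRep_left (w : W) (u v : B → ℝ) :
    M.form (cs.geomRep w u) v = M.form u (cs.geomRep w⁻¹ v) := by
  rw [← cs.form_geomRep w u, geomRep_self_inv]

omit [Fintype B] [DecidableEq B] in
private lemma exists_dihedral_coeff {i j : B} (hij : i ≠ j) :
    ∃ u : ℕ → ℝ, u 0 = 0 ∧ u 1 = 1 ∧
      (∀ k, u (k + 2) = -2 * M.cosEntry i j * u (k + 1) - u k) ∧
      ∀ k, M i j = 0 ∨ k ≤ M i j → 0 ≤ u k := by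
  rcases Nat.eq_zero_or_pos (M i j) with h0 | h0
  · refine ⟨fun k => k, by simp, by simp, fun k => ?_, fun k _ => by positivity⟩
    simp only [cosEntry, h0]
    push_cast
    simp
    ring
  have h2 : (2 : ℝ) ≤ M i j := by exact_mod_cast M.two_le_of_ne hij h0.ne'
  set θ := Real.pi / M i j with hθ
  have hmθ : (M i j : ℝ) * θ = Real.pi := by rw [hθ]; field_simp
  have hθpos : 0 < θ := by positivity
  have hsin : 0 < Real.sin θ := Real.sin_pos_of_pos_of_lt_pi hθpos (by nlinarith [Real.pi_pos])
  have hcos : M.cosEntry i j = -Real.cos θ := rfl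
  refine ⟨fun k => Real.sin (k * θ) / Real.sin θ, by simp, by simp [hsin.ne'], fun k => ?_,
    fun k hk => ?_⟩
  · have : Real.sin (((k + 2 : ℕ) : ℝ) * θ) =
        2 * Real.cos θ * Real.sin (((k + 1 : ℕ) : ℝ) * θ) - Real.sin (k * θ) := by
      push_cast
      rw [show ((k : ℝ) + 2) * θ = (k + 1) * θ + θ by ring,
        show (k : ℝ) * θ = (k + 1) * θ - θ by ring, Real.sin_add, Real.sin_sub]
      ring
    simp only [this, hcos]
    field_simp
  · have hk : (k : ℝ) ≤ M i j := by exact_mod_cast hk.resolve_left h0.ne'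
    refine div_nonneg (Real.sin_nonneg_of_nonneg_of_le_pi (by positivity) ?_) hsin.le
    rw [← hmθ]
    gcongr

private lemma geomRep_alternatingWord {i j : B} {u : ℕ → ℝ} (h0 : u 0 = 0) (h1 : u 1 = 1)
    (hu : ∀ k, u (k + 2) = -2 * M.cosEntry i j * u (k + 1) - u k) (k : ℕ) :
    cs.geomRep (cs.wordProd (alternatingWord i j k)) (simpleRoot i) =
      if Even k then u (k + 1) • simpleRoot i + u k • simpleRoot j
      else u k • simpleRoot i + u (k + 1) • simpleRoot j := by
  induction k with
  | zero => simp [alternatingWord, h0, h1]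
  | succ k ih =>
    rw [alternatingWord_succ', wordProd_cons, geomRep_mul, ih, geomRep_simple]
    by_cases hk : Even k
    · rw [if_pos hk, if_pos hk, if_neg (by simpa [Nat.even_add_one] using hk), hu]
      simp only [map_add, map_smul, form_simpleRoot, cosEntry_self, smul_eq_mul,
        M.cosEntry_comm j i]
      module
    · rw [if_neg hk, if_neg hk, if_pos (by simpa [Nat.even_add_one] using hk), hu]
      simp only [map_add, map_smul, form_simpleRoot, cosEntry_self, smul_eq_mul]
      module

theorem geomRep_simpleRoot_nonneg {w : W} {i : B} (h : cs.length w < cs.length (w * cs.simple i)) :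
    0 ≤ cs.geomRep w (simpleRoot i) := by
  classical
  induction hn : cs.length w using Nat.strong_induction_on generalizing w i with
  | _ n ih =>
  subst hn
  rcases eq_or_ne w 1 with rfl | hw
  · simp
  obtain ⟨j, hj⟩ := cs.exists_rightDescent_of_ne_one hw
  have hij : i ≠ j := by
    rintro rfl
    exact lt_asymm h hj
  let P : ℕ → Prop := fun l => ∃ v k, cs.length v = l ∧
    w = v * cs.wordProd (alternatingWord i j k) ∧
    cs.length w = cs.length v + k
  have hP1 : P (cs.length (w * cs.simple j)) :=
    ⟨w * cs.simple j, 1, rfl, by simp [alternatingWord, wordProd], by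
      rw [cs.isRightDescent_iff] at hj; omega⟩
  have hex : ∃ l, P l := ⟨_, hP1⟩
  obtain ⟨v, k, hvl, hwv, hlen⟩ := Nat.find_spec hex
  have hmin : ∀ l, P l → cs.length v ≤ l := fun l hl => hvl ▸ Nat.find_min' hex hl
  have hvw : cs.length v < cs.length w := lt_of_le_of_lt (hmin _ hP1) hj
  obtain ⟨k, rfl⟩ : ∃ k', k = k' + 1 := ⟨k - 1, by omega⟩
  -- neither simple reflection is a right descent of `v`
  have hnext : cs.length v < cs.length (v * cs.simple (if Even (k + 1) then j else i)) := by
    by_contra hcon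
    set x := if Even (k + 1) then j else i with hx
    have hd : cs.IsRightDescent v x := by
      have := cs.length_mul_simple_ne v x
      unfold IsRightDescent
      omega
    have hd' := (cs.isRightDescent_iff).1 hd
    have := hmin _ ⟨v * cs.simple x, k + 2, rfl, by
      rw [alternatingWord_succ', ← hx, wordProd_cons, hwv]
      simp [mul_assoc], by omega⟩
    omega
  have hprev : cs.length v < cs.length (v * cs.simple (if Even k then j else i)) := by
    set y := if Even k then j else i with hy
    have hwy : w = (v * cs.simple y) * cs.wordProd (alternatingWord i j k) := by
      rw [hwv, alternatingWord_succ', ← hy, wordProd_cons, mul_assoc]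
    have h1 := cs.length_mul_le (v * cs.simple y) (cs.wordProd (alternatingWord i j k))
    have h2 := cs.length_wordProd_le (alternatingWord i j k)
    rw [length_alternatingWord] at h2
    rw [← hwy] at h1
    omega
  have hboth : cs.length v < cs.length (v * cs.simple i) ∧
      cs.length v < cs.length (v * cs.simple j) := by
    by_cases hk : Even k
    · rw [if_pos hk] at hprev
      rw [if_neg (by simpa [Nat.even_add_one] using hk)] at hnext
      exact ⟨hnext, hprev⟩
    · rw [if_neg hk] at hprev
      rw [if_pos (by simpa [Nat.even_add_one] using hk)] at hnext
      exact ⟨hprev, hnext⟩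
  have hvi := ih _ hvw hboth.1 rfl
  have hvj := ih _ hvw hboth.2 rfl
  have hkm : M i j = 0 ∨ k + 2 ≤ M i j := by
    by_contra! hcon
    obtain ⟨hm, hlt⟩ := hcon
    -- the alternating suffix of length `M i j` may be rewritten to end in `i`
    obtain ⟨d, hd⟩ : ∃ d, k + 1 = d + M i j := ⟨k + 1 - M i j, by omega⟩
    have hsplit : ∀ d, ∃ l : List B, l.length = d ∧
        alternatingWord i j (d + M i j) = l ++ alternatingWord i j (M i j) := by
      intro d
      induction d with
      | zero => exact ⟨[], rfl, by simp⟩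
      | succ d ihd =>
        obtain ⟨l, hl, hl'⟩ := ihd
        refine ⟨(if Even (d + M i j) then j else i) :: l, by simp [hl], ?_⟩
        rw [Nat.add_right_comm, alternatingWord_succ', hl', List.cons_append]
    obtain ⟨l, hl, hl'⟩ := hsplit d
    have hbraid := cs.wordProd_braidWord_eq i j
    unfold braidWord at hbraid
    obtain ⟨m, hm'⟩ : ∃ m, M i j = m + 1 := ⟨M i j - 1, by omega⟩
    have hwi : w * cs.simple i = v * cs.wordProd (l ++ alternatingWord i j m) := by
      rw [hwv, hd, hl', wordProd_append, hbraid, M.symmetric j i, hm', alternatingWord_succ,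
        wordProd_concat, wordProd_append]
      simp [mul_assoc]
    have h1 := cs.length_mul_le v (cs.wordProd (l ++ alternatingWord i j m))
    have h2 := cs.length_wordProd_le (l ++ alternatingWord i j m)
    rw [List.length_append, length_alternatingWord] at h2
    rw [← hwi] at h1
    omega
  obtain ⟨u, hu0, hu1, hu, hupos⟩ := exists_dihedral_coeff (M := M) hij
  have hua : 0 ≤ u (k + 1) := hupos _ (hkm.imp_right (by omega))
  have hub : 0 ≤ u (k + 1 + 1) := hupos _ (hkm.imp_right (by omega))
  rw [hwv, geomRep_mul, cs.geomRep_alternatingWord hu0 hu1 hu]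
  split_ifs
  · rw [map_add, map_smul, map_smul]
    exact add_nonneg (smul_nonneg hub hvi) (smul_nonneg hua hvj)
  · rw [map_add, map_smul, map_smul]
    exact add_nonneg (smul_nonneg hua hvi) (smul_nonneg hub hvj)

theorem geomRep_simpleRoot_nonpos {w : W} {i : B} (h : cs.length (w * cs.simple i) < cs.length w) :
    cs.geomRep w (simpleRoot i) ≤ 0 := by
  have := cs.geomRep_simpleRoot_nonneg (w := w * cs.simple i) (i := i) (by simpa using h)
  rw [geomRep_mul, geomRep_simple_self, map_neg] at this
  exact neg_nonneg.1 this

lemma geomRep_ne_zero (w : W) {v : B → ℝ} (hv : v ≠ 0) : cs.geomRep w v ≠ 0 := fun h =>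
  hv (by rw [← cs.geomRep_inv_self w v, h, map_zero])

lemma eq_one_of_nonneg {w : W} (h : ∀ i, 0 ≤ cs.geomRep w (simpleRoot i)) : w = 1 := by
  by_contra hw
  obtain ⟨i, hi⟩ := cs.exists_rightDescent_of_ne_one hw
  exact cs.geomRep_ne_zero w (by simp) (le_antisymm (cs.geomRep_simpleRoot_nonpos hi) (h i))

lemma geomRep_injective : Function.Injective cs.geomRep := by
  rw [injective_iff_map_eq_one]
  intro w hw
  exact cs.eq_one_of_nonneg fun i => by simp [hw]

section Finite

variable [Finite W]

include cs in
theorem form_self_pos {v : B → ℝ} (hv : v ≠ 0) : 0 < M.form v v := by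
  have := Fintype.ofFinite W
  -- an invariant inner product
  let q : (B → ℝ) → (B → ℝ) → ℝ := fun x y => ∑ w : W, cs.geomRep w x ⬝ᵥ cs.geomRep w y
  have qinv (g : W) (x y : B → ℝ) : q (cs.geomRep g x) (cs.geomRep g y) = q x y := by
    simp only [q, ← geomRep_mul]
    exact Fintype.sum_equiv (Equiv.mulRight g) _ _ fun w => rfl
  have qpos (x : B → ℝ) (hx : x ≠ 0) : 0 < q x x :=
    Finset.sum_pos (fun w _ => by
      have h0 := cs.geomRep_ne_zero w hx
      exact lt_of_le_of_ne (Finset.sum_nonneg fun i _ => mul_self_nonneg _)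
        (fun h => h0 (dotProduct_self_eq_zero.1 h.symm))) ⟨1, Finset.mem_univ _⟩
  have qcomm (x y : B → ℝ) : q x y = q y x := by simp only [q, dotProduct_comm]
  have qlin (x y z : B → ℝ) (a : ℝ) : q x (y - a • z) = q x y - a * q x z := by
    simp only [q, map_sub, map_smul, dotProduct_sub, dotProduct_smul, smul_eq_mul,
      Finset.sum_sub_distrib, Finset.mul_sum]
  have qneg (x y : B → ℝ) : q (-x) y = - q x y := by
    simp only [q, map_neg, neg_dotProduct, Finset.sum_neg_distrib]
  have qsum (x : B → ℝ) : q x x = ∑ i, ∑ j, x i * x j * q (simpleRoot i) (simpleRoot j) := by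
    have h1 (w : W) : cs.geomRep w x ⬝ᵥ cs.geomRep w x = ∑ i, ∑ j, x i * x j *
        (cs.geomRep w (simpleRoot i) ⬝ᵥ cs.geomRep w (simpleRoot j)) := by
      conv_lhs => rw [eq_sum_simpleRoot x]
      simp only [map_sum, map_smul, sum_dotProduct, dotProduct_sum, smul_dotProduct,
        dotProduct_smul, smul_eq_mul, mul_assoc]
      refine Finset.sum_congr rfl fun i _ => ?_
      rw [Finset.mul_sum]
      exact Finset.sum_congr rfl fun j _ => by rw [dotProduct_comm]
    simp only [q, h1, Finset.mul_sum]
    rw [Finset.sum_comm]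
    exact Finset.sum_congr rfl fun i _ => Finset.sum_comm
  have key (i j : B) : q (simpleRoot i) (simpleRoot j) =
      M.cosEntry i j * q (simpleRoot i) (simpleRoot i) := by
    have h := qinv (cs.simple i) (simpleRoot i) (simpleRoot j)
    rw [geomRep_simple_self, geomRep_simple, form_simpleRoot, qneg, qlin] at h
    linarith
  let d : B → ℝ := fun i => Real.sqrt (q (simpleRoot i) (simpleRoot i))
  have hd (i : B) : 0 < d i := Real.sqrt_pos.2 (qpos _ (by simp))
  have hdd (i : B) : q (simpleRoot i) (simpleRoot i) = d i * d i :=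
    (Real.mul_self_sqrt (qpos _ (by simp)).le).symm
  have hq (i j : B) : q (simpleRoot i) (simpleRoot j) = M.cosEntry i j * (d i * d j) := by
    rcases eq_or_ne (M.cosEntry i j) 0 with h0 | h0
    · rw [key, h0, zero_mul, zero_mul]
    have h1 := key i j
    rw [qcomm, key j i, M.cosEntry_comm j i] at h1
    have h2 := mul_left_cancel₀ h0 h1
    have h3 : d i = d j := by simp only [d, h2]
    rw [key, hdd, h3]
  let x : B → ℝ := fun i => v i / d i
  have hx : x ≠ 0 := by
    obtain ⟨i, hi⟩ := Function.ne_iff.1 hv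
    exact Function.ne_iff.2 ⟨i, div_ne_zero hi (hd i).ne'⟩
  have hfin : M.form v v = q x x := by
    rw [qsum, form, Matrix.toBilin'_apply]
    refine Finset.sum_congr rfl fun i _ => Finset.sum_congr rfl fun j _ => ?_
    rw [hq]
    have := hd i
    have := hd j
    simp only [x, Matrix.of_apply]
    field_simp
  rw [hfin]
  exact qpos x hx

include cs in
lemma eq_zero_of_form_self {v : B → ℝ} (h : M.form v v = 0) : v = 0 := by
  by_contra hv
  exact (cs.form_self_pos hv).ne' h

end Finite

end CoxeterSystem

namespace CoxeterMatrix

variable {B : Type*}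

/-- The vectors supported in `J`. -/
def coordSpace (J : Finset B) : Submodule ℝ (B → ℝ) where
  carrier := {v | ∀ i ∉ J, v i = 0}
  add_mem' hu hv i hi := by simp [hu i hi, hv i hi]
  zero_mem' i _ := rfl
  smul_mem' a v hv i hi := by simp [hv i hi]

lemma mem_coordSpace {J : Finset B} {v : B → ℝ} : v ∈ coordSpace J ↔ ∀ i ∉ J, v i = 0 := Iff.rfl

lemma coordSpace_mono {J K : Finset B} (h : K ⊆ J) : coordSpace K ≤ coordSpace J :=
  fun _ hv i hi => hv i fun hK => hi (h hK)

lemma simpleRoot_mem_coordSpace [DecidableEq B] {J : Finset B} {i : B} (h : i ∈ J) :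
    simpleRoot i ∈ coordSpace J := fun j hj =>
  Pi.single_eq_of_ne (by rintro rfl; exact hj h) 1

variable [Fintype B] [DecidableEq B] (M : CoxeterMatrix B)

lemma form_eq_sum_of_mem {J : Finset B} {u : B → ℝ} (hu : u ∈ coordSpace J) (v : B → ℝ) :
    M.form u v = ∑ i ∈ J, u i * M.form (simpleRoot i) v := by
  rw [form_eq_sum]
  refine (Finset.sum_subset (Finset.subset_univ J) fun i _ hi => ?_).symm
  rw [hu i hi, zero_mul]

lemma form_simpleRoot_eq_sum_of_mem {J : Finset B} (i : B) {v : B → ℝ} (hv : v ∈ coordSpace J) :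
    M.form (simpleRoot i) v = ∑ j ∈ J, M.cosEntry i j * v j := by
  rw [form_comm, form_eq_sum_of_mem M hv]
  exact Finset.sum_congr rfl fun j _ => by rw [form_simpleRoot, cosEntry_comm, mul_comm]

lemma eq_sum_simpleRoot_of_mem {J : Finset B} {v : B → ℝ} (hv : v ∈ coordSpace J) :
    v = ∑ i ∈ J, v i • simpleRoot i := by
  conv_lhs => rw [eq_sum_simpleRoot v]
  refine (Finset.sum_subset (Finset.subset_univ J) fun i _ hi => ?_).symm
  rw [hv i hi, zero_smul]

omit [Fintype B] [DecidableEq B] in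
/-- The simple roots indexed by `K` are orthogonal to those indexed by `L`. -/
def IsOrtho (K L : Finset B) : Prop := ∀ i ∈ K, ∀ j ∈ L, M.cosEntry i j = 0

variable {M}

omit [Fintype B] [DecidableEq B] in
lemma IsOrtho.symm {K L : Finset B} (h : M.IsOrtho K L) : M.IsOrtho L K :=
  fun i hi j hj => by rw [cosEntry_comm, h j hj i hi]

lemma IsOrtho.form_simpleRoot {K L : Finset B} (h : M.IsOrtho K L) {i : B} (hi : i ∈ K)
    {v : B → ℝ} (hv : v ∈ coordSpace L) : M.form (simpleRoot i) v = 0 := by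
  rw [form_simpleRoot_eq_sum_of_mem M i hv]
  exact Finset.sum_eq_zero fun j hj => by rw [h i hi j hj, zero_mul]

lemma IsOrtho.form_eq_zero {K L : Finset B} (h : M.IsOrtho K L) {u v : B → ℝ}
    (hu : u ∈ coordSpace K) (hv : v ∈ coordSpace L) : M.form u v = 0 := by
  rw [form_eq_sum_of_mem M hu]
  exact Finset.sum_eq_zero fun i hi => by rw [h.form_simpleRoot hi hv, mul_zero]

end CoxeterMatrix

namespace CoxeterSystem

open CoxeterMatrix

variable {B W : Type*} [Group W] {M : CoxeterMatrix B} (cs : CoxeterSystem M W)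

/-- The standard parabolic subgroup generated by the simple reflections in `J`. -/
def parabolicSubgroup (J : Finset B) : Subgroup W := Subgroup.closure (cs.simple '' J)

lemma simple_mem_parabolicSubgroup {J : Finset B} {i : B} (h : i ∈ J) :
    cs.simple i ∈ cs.parabolicSubgroup J := Subgroup.subset_closure ⟨i, h, rfl⟩

lemma parabolicSubgroup_mono {J K : Finset B} (h : K ⊆ J) :
    cs.parabolicSubgroup K ≤ cs.parabolicSubgroup J :=
  Subgroup.closure_mono (Set.image_mono h)

@[simp]
lemma parabolicSubgroup_empty : cs.parabolicSubgroup ∅ = ⊥ := by simp [parabolicSubgroup]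

lemma parabolicSubgroup_univ [Fintype B] : cs.parabolicSubgroup Finset.univ = ⊤ := by
  simp [parabolicSubgroup, cs.subgroup_closure_range_simple]

variable [Fintype B] [DecidableEq B]

lemma geomRep_simple_mem {J : Finset B} {i : B} (h : i ∈ J) {v : B → ℝ} (hv : v ∈ coordSpace J) :
    cs.geomRep (cs.simple i) v ∈ coordSpace J := by
  rw [geomRep_simple]
  exact Submodule.sub_mem _ hv (Submodule.smul_mem _ _ (simpleRoot_mem_coordSpace h))

lemma geomRep_mem {J : Finset B} {w : W} (hw : w ∈ cs.parabolicSubgroup J) {v : B → ℝ}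
    (hv : v ∈ coordSpace J) : cs.geomRep w v ∈ coordSpace J := by
  induction hw using Subgroup.closure_induction_left generalizing v with
  | one => simpa
  | mul_left x hx y hy ih =>
    obtain ⟨i, hi, rfl⟩ := hx
    rw [geomRep_mul]
    exact cs.geomRep_simple_mem hi (ih hv)
  | inv_mul_cancel x hx y hy ih =>
    obtain ⟨i, hi, rfl⟩ := hx
    rw [geomRep_mul, inv_simple]
    exact cs.geomRep_simple_mem hi (ih hv)

lemma geomRep_simple_apply_of_ne {i j : B} (h : j ≠ i) (v : B → ℝ) :
    cs.geomRep (cs.simple i) v j = v j := by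
  rw [geomRep_simple]
  simp [h]

variable [Fintype W]

/-- The finite root system: the orbit of the simple roots. -/
noncomputable def roots : Finset (B → ℝ) :=
  Finset.univ.image fun p : W × B => cs.geomRep p.1 (simpleRoot p.2)

lemma mem_roots {γ : B → ℝ} : γ ∈ cs.roots ↔ ∃ w i, cs.geomRep w (simpleRoot i) = γ := by
  simp [roots]

lemma simpleRoot_mem_roots (i : B) : simpleRoot i ∈ cs.roots := cs.mem_roots.2 ⟨1, i, by simp⟩

lemma geomRep_mem_roots {γ : B → ℝ} (h : γ ∈ cs.roots) (w : W) : cs.geomRep w γ ∈ cs.roots := by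
  obtain ⟨u, i, rfl⟩ := cs.mem_roots.1 h
  exact cs.mem_roots.2 ⟨w * u, i, by rw [geomRep_mul]⟩

lemma neg_mem_roots {γ : B → ℝ} (h : γ ∈ cs.roots) : -γ ∈ cs.roots := by
  obtain ⟨u, i, rfl⟩ := cs.mem_roots.1 h
  exact cs.mem_roots.2 ⟨u * cs.simple i, i, by rw [geomRep_mul, geomRep_simple_self, map_neg]⟩

lemma form_root_self {γ : B → ℝ} (h : γ ∈ cs.roots) : M.form γ γ = 1 := by
  obtain ⟨u, i, rfl⟩ := cs.mem_roots.1 h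
  rw [form_geomRep, form_simpleRoot, cosEntry_self]

lemma root_ne_zero {γ : B → ℝ} (h : γ ∈ cs.roots) : γ ≠ 0 := by
  rintro rfl
  simpa using cs.form_root_self h

lemma root_nonneg_or_nonpos {γ : B → ℝ} (h : γ ∈ cs.roots) : 0 ≤ γ ∨ γ ≤ 0 := by
  obtain ⟨u, i, rfl⟩ := cs.mem_roots.1 h
  rcases (cs.length_mul_simple_ne u i).lt_or_gt with h | h
  · exact Or.inr (cs.geomRep_simpleRoot_nonpos h)
  · exact Or.inl (cs.geomRep_simpleRoot_nonneg h)

lemma root_nonpos_of_not_nonneg {γ : B → ℝ} (h : γ ∈ cs.roots) (h' : ¬0 ≤ γ) : γ ≤ 0 :=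
  (cs.root_nonneg_or_nonpos h).resolve_left h'

lemma root_not_nonneg_and_nonpos {γ : B → ℝ} (h : γ ∈ cs.roots) (h0 : 0 ≤ γ) (h1 : γ ≤ 0) :
    False := cs.root_ne_zero h (le_antisymm h1 h0)

/-- A simple reflection permutes the positive roots other than its own root. -/
lemma geomRep_simple_nonneg {γ : B → ℝ} (h : γ ∈ cs.roots) (h0 : 0 ≤ γ) {i : B}
    (hi : γ ≠ simpleRoot i) : 0 ≤ cs.geomRep (cs.simple i) γ := by
  refine (cs.root_nonneg_or_nonpos (cs.geomRep_mem_roots h _)).resolve_right fun hneg => hi ?_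
  have hj : ∀ j ≠ i, γ j = 0 := fun j hj => by
    refine le_antisymm ?_ (h0 j)
    rw [← cs.geomRep_simple_apply_of_ne hj γ]
    exact hneg j
  have hγ : γ = γ i • simpleRoot i := by
    ext j
    by_cases hji : j = i
    · subst hji; simp
    · simp [hji, hj j hji]
  have h1 := cs.form_root_self h
  rw [hγ] at h1
  simp only [map_smul, LinearMap.smul_apply, form_simpleRoot, cosEntry_self, smul_eq_mul] at h1
  have : γ i = 1 := by nlinarith [h0 i, show (0 : ℝ) ≤ γ i from h0 i]
  rw [hγ, this, one_smul]

/-- The roots supported in `J`. -/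
noncomputable def rootsIn (J : Finset B) : Finset (B → ℝ) := {γ ∈ cs.roots | ∀ i ∉ J, γ i = 0}

lemma mem_rootsIn {J : Finset B} {γ : B → ℝ} :
    γ ∈ cs.rootsIn J ↔ γ ∈ cs.roots ∧ γ ∈ coordSpace J := by
  simp [rootsIn, mem_coordSpace]

lemma rootsIn_mono {J K : Finset B} (h : K ⊆ J) : cs.rootsIn K ⊆ cs.rootsIn J := fun γ hγ => by
  rw [mem_rootsIn] at *
  exact ⟨hγ.1, coordSpace_mono h hγ.2⟩

lemma rootsIn_univ : cs.rootsIn Finset.univ = cs.roots := by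
  simp [rootsIn]

lemma rootsIn_empty : cs.rootsIn ∅ = ∅ := by
  ext γ
  simp only [mem_rootsIn, Finset.notMem_empty, iff_false, not_and, mem_coordSpace]
  intro h h'
  exact cs.root_ne_zero h (funext fun i => h' i (by simp))

lemma neg_mem_rootsIn {J : Finset B} {γ : B → ℝ} (h : γ ∈ cs.rootsIn J) : -γ ∈ cs.rootsIn J := by
  rw [mem_rootsIn] at *
  exact ⟨cs.neg_mem_roots h.1, Submodule.neg_mem _ h.2⟩

lemma geomRep_mem_rootsIn {J : Finset B} {γ : B → ℝ} (h : γ ∈ cs.rootsIn J) {w : W}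
    (hw : w ∈ cs.parabolicSubgroup J) : cs.geomRep w γ ∈ cs.rootsIn J := by
  rw [mem_rootsIn] at *
  exact ⟨cs.geomRep_mem_roots h.1 _, cs.geomRep_mem hw h.2⟩

lemma sum_rootsIn_geomRep {J : Finset B} {w : W} (hw : w ∈ cs.parabolicSubgroup J)
    {A : Type*} [AddCommMonoid A] (g : (B → ℝ) → A) :
    ∑ γ ∈ cs.rootsIn J, g (cs.geomRep w γ) = ∑ γ ∈ cs.rootsIn J, g γ :=
  Finset.sum_bij' (fun γ _ => cs.geomRep w γ) (fun γ _ => cs.geomRep w⁻¹ γ)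
    (fun _ h => cs.geomRep_mem_rootsIn h hw)
    (fun _ h => cs.geomRep_mem_rootsIn h (inv_mem hw)) (fun _ _ => by simp) (fun _ _ => by simp)
    (fun _ _ => rfl)

/-- A root supported in `K ∪ L`, where `K` and `L` are orthogonal, is supported in `K` or in
`L`. -/
lemma mem_coordSpace_or_of_isOrtho {K L : Finset B} (hKL : M.IsOrtho K L) {γ : B → ℝ}
    (h : γ ∈ cs.rootsIn (K ∪ L)) : γ ∈ coordSpace K ∨ γ ∈ coordSpace L := by
  classical
  rw [mem_rootsIn] at h
  wlog h0 : 0 ≤ γ generalizing γ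
  · have h1 := cs.root_nonpos_of_not_nonneg h.1 h0
    refine (this ⟨cs.neg_mem_roots h.1, Submodule.neg_mem _ h.2⟩ (neg_nonneg.2 h1)).imp ?_ ?_ <;>
    exact fun h => by simpa using Submodule.neg_mem _ h
  by_contra hbad
  let bad : Finset (B → ℝ) := {γ ∈ cs.roots | 0 ≤ γ ∧ γ ∈ coordSpace (K ∪ L) ∧
    ¬(γ ∈ coordSpace K ∨ γ ∈ coordSpace L)}
  obtain ⟨γ, hγ, hmin⟩ := bad.exists_min_image (fun γ => ∑ i, γ i)
    ⟨γ, by simp only [bad, Finset.mem_filter]; exact ⟨h.1, h0, h.2, hbad⟩⟩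
  clear hbad h h0
  simp only [bad, Finset.mem_filter] at hγ hmin
  obtain ⟨hγ, h0, hJ, hnot⟩ := hγ
  obtain ⟨j, -, hj⟩ : ∃ j ∈ Finset.univ, 0 < γ j * M.form (simpleRoot j) γ := by
    apply Finset.exists_lt_of_sum_lt
    rw [← form_eq_sum, cs.form_root_self hγ]
    simp
  have hγj : 0 < γ j := lt_of_le_of_ne (h0 j) fun h => by simp [← h] at hj
  have hfj : 0 < M.form (simpleRoot j) γ := pos_of_mul_pos_right hj hγj.le
  have hjJ : j ∈ K ∪ L := by
    by_contra hcon
    exact hγj.ne' (hJ j hcon)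
  have hne : γ ≠ simpleRoot j := by
    rintro rfl
    exact hnot ((Finset.mem_union.1 hjJ).imp simpleRoot_mem_coordSpace simpleRoot_mem_coordSpace)
  set δ := cs.geomRep (cs.simple j) γ with hδ
  have hγδ : γ = cs.geomRep (cs.simple j) δ := by
    rw [hδ, ← geomRep_mul, simple_mul_simple_self, geomRep_one]
  have hδj : M.form (simpleRoot j) δ ≠ 0 := by
    rw [hδ, geomRep_simple, map_sub, map_smul, form_simpleRoot, cosEntry_self, smul_eq_mul]
    intro h
    linarith
  have hlt : ∑ i, δ i < ∑ i, γ i := by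
    rw [hδ, geomRep_simple]
    simp only [Pi.sub_apply, Pi.smul_apply, smul_eq_mul, Finset.sum_sub_distrib, ← Finset.mul_sum,
      Finset.sum_pi_single', Finset.mem_univ, if_true]
    linarith
  have hδKL : δ ∈ coordSpace K ∨ δ ∈ coordSpace L := by
    by_contra hcon
    exact absurd (hmin δ ⟨cs.geomRep_mem_roots hγ _, cs.geomRep_simple_nonneg hγ h0 hne,
      cs.geomRep_simple_mem hjJ hJ, hcon⟩) (not_le.2 hlt)
  apply hnot
  rcases hδKL with h | h
  · refine Or.inl ?_
    rcases Finset.mem_union.1 hjJ with hj | hj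
    · exact hγδ ▸ cs.geomRep_simple_mem hj h
    · exact absurd (hKL.symm.form_simpleRoot hj h) hδj
  · refine Or.inr ?_
    rcases Finset.mem_union.1 hjJ with hj | hj
    · exact absurd (hKL.form_simpleRoot hj h) hδj
    · exact hγδ ▸ cs.geomRep_simple_mem hj h

lemma sum_rootsIn_union {K L : Finset B} (hdisj : Disjoint K L) (hKL : M.IsOrtho K L)
    {A : Type*} [AddCommMonoid A] (g : (B → ℝ) → A) :
    ∑ γ ∈ cs.rootsIn (K ∪ L), g γ = ∑ γ ∈ cs.rootsIn K, g γ + ∑ γ ∈ cs.rootsIn L, g γ := by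
  rw [← Finset.sum_union]
  · congr 1
    ext γ
    rw [Finset.mem_union]
    refine ⟨fun h => ?_, fun h => h.elim (fun h => cs.rootsIn_mono Finset.subset_union_left h)
      fun h => cs.rootsIn_mono Finset.subset_union_right h⟩
    have h' := cs.mem_rootsIn.1 h
    exact (cs.mem_coordSpace_or_of_isOrtho hKL h).imp (fun hK => cs.mem_rootsIn.2 ⟨h'.1, hK⟩)
      fun hL => cs.mem_rootsIn.2 ⟨h'.1, hL⟩
  · rw [Finset.disjoint_left]
    intro γ hK hL
    rw [mem_rootsIn] at hK hL
    refine cs.root_ne_zero hK.1 (funext fun i => ?_)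
    by_cases hi : i ∈ K
    · exact hL.2 i (Finset.disjoint_left.1 hdisj hi)
    · exact hK.2 i hi

/-- The element of `W` acting as the reflection in the root `γ`; it is `1` if there is none. -/
noncomputable def reflOf (γ : B → ℝ) : W :=
  open Classical in if h : ∃ t, cs.geomRep t = M.reflMap γ then h.choose else 1

lemma reflOf_geomRep_simpleRoot (w : W) (i : B) :
    cs.reflOf (cs.geomRep w (simpleRoot i)) = w * cs.simple i * w⁻¹ := by
  have h : cs.geomRep (w * cs.simple i * w⁻¹) = M.reflMap (cs.geomRep w (simpleRoot i)) := by
    refine LinearMap.ext fun v => ?_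
    rw [geomRep_mul, geomRep_mul, geomRep_simple, map_sub, geomRep_self_inv, map_smul,
      reflMap_apply, ← form_geomRep_left]
  have hex : ∃ t, cs.geomRep t = M.reflMap (cs.geomRep w (simpleRoot i)) := ⟨_, h⟩
  rw [reflOf, dif_pos hex]
  exact cs.geomRep_injective (hex.choose_spec.trans h.symm)

lemma geomRep_reflOf {γ : B → ℝ} (h : γ ∈ cs.roots) (v : B → ℝ) :
    cs.geomRep (cs.reflOf γ) v = v - (2 * M.form γ v) • γ := by
  obtain ⟨u, i, rfl⟩ := cs.mem_roots.1 h
  rw [reflOf_geomRep_simpleRoot, geomRep_mul, geomRep_mul, geomRep_simple, map_sub,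
    geomRep_self_inv, map_smul, ← form_geomRep_left]

lemma reflOf_simpleRoot (i : B) : cs.reflOf (simpleRoot i) = cs.simple i := by
  simpa using cs.reflOf_geomRep_simpleRoot 1 i

lemma reflOf_geomRep {γ : B → ℝ} (h : γ ∈ cs.roots) (w : W) :
    cs.reflOf (cs.geomRep w γ) = w * cs.reflOf γ * w⁻¹ := by
  obtain ⟨u, i, rfl⟩ := cs.mem_roots.1 h
  rw [← geomRep_mul, reflOf_geomRep_simpleRoot, reflOf_geomRep_simpleRoot]
  group

lemma reflOf_neg {γ : B → ℝ} (h : γ ∈ cs.roots) : cs.reflOf (-γ) = cs.reflOf γ := by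
  apply cs.geomRep_injective
  refine LinearMap.ext fun v => ?_
  rw [geomRep_reflOf _ h, geomRep_reflOf _ (cs.neg_mem_roots h)]
  simp

lemma eq_or_eq_neg_of_reflOf_eq {γ δ : B → ℝ} (hγ : γ ∈ cs.roots) (hδ : δ ∈ cs.roots)
    (h : cs.reflOf γ = cs.reflOf δ) : δ = γ ∨ δ = -γ := by
  have h1 := cs.geomRep_reflOf hγ δ
  rw [h, geomRep_reflOf _ hδ, cs.form_root_self hδ] at h1
  have h2 : δ = M.form γ δ • γ := by
    have h3 : (2 * M.form γ δ) • γ = (2 : ℝ) • δ := by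
      have := sub_right_injective h1
      simpa using this.symm
    rw [mul_smul] at h3
    exact (smul_right_injective _ (two_ne_zero (α := ℝ)) h3).symm
  have h3 := cs.form_root_self hδ
  rw [h2] at h3
  simp only [map_smul, LinearMap.smul_apply, cs.form_root_self hγ, smul_eq_mul, mul_one] at h3
  rcases mul_self_eq_one_iff.1 h3 with h4 | h4
  · left; rw [h2, h4, one_smul]
  · right; rw [h2, h4, neg_one_smul]

lemma isReflectionOf_iff {t : W} :
    IsReflectionOf (simpleSet cs) t ↔ ∃ γ ∈ cs.roots, cs.reflOf γ = t := by
  constructor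
  · rintro ⟨g, _, ⟨i, rfl⟩, rfl⟩
    exact ⟨_, cs.mem_roots.2 ⟨g, i, rfl⟩, cs.reflOf_geomRep_simpleRoot g i⟩
  · rintro ⟨γ, h, rfl⟩
    obtain ⟨u, i, rfl⟩ := cs.mem_roots.1 h
    exact ⟨u, _, ⟨i, rfl⟩, cs.reflOf_geomRep_simpleRoot u i⟩

end CoxeterSystem

namespace CoxeterSystem

open CoxeterMatrix

variable {B W : Type*} [Group W] {M : CoxeterMatrix B} (cs : CoxeterSystem M W)

section Forest

variable [Fintype B] [DecidableEq B] [Finite W]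

include cs in
/-- The Coxeter graph of a finite Coxeter group is a forest: every nonempty set of vertices
contains a vertex with at most one neighbour in the set. -/
lemma exists_leaf {J : Finset B} (hJ : J.Nonempty) : ∃ s ∈ J, ∀ i ∈ J, ∀ j ∈ J, i ≠ s → j ≠ s →
    M.cosEntry s i ≠ 0 → M.cosEntry s j ≠ 0 → i = j := by
  by_contra! hcon
  let v : B → ℝ := fun i => if i ∈ J then 1 else 0
  have hv : v ∈ coordSpace J := fun i hi => if_neg hi
  have hv0 : v ≠ 0 := by
    obtain ⟨i, hi⟩ := hJ
    exact Function.ne_iff.2 ⟨i, by simp [v, hi]⟩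
  refine absurd (cs.form_self_pos hv0) (not_lt.2 ?_)
  rw [form_eq_sum_of_mem M hv]
  refine Finset.sum_nonpos fun i hi => ?_
  rw [form_simpleRoot_eq_sum_of_mem M i hv]
  obtain ⟨a, ha, b, hb, hai, hbi, hka, hkb, hab⟩ := hcon i hi
  have hsub : ({i, a, b} : Finset B) ⊆ J := by
    simp [Finset.insert_subset_iff, hi, ha, hb]
  have h1 : ∑ j ∈ J, M.cosEntry i j * v j = ∑ j ∈ J, M.cosEntry i j :=
    Finset.sum_congr rfl fun j hj => by simp [v, hj]
  have h2 : ∑ j ∈ J \ {i, a, b}, M.cosEntry i j ≤ 0 := by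
    refine Finset.sum_nonpos fun j hj => M.cosEntry_nonpos ?_
    rintro rfl
    simp at hj
  have h3 : ∑ j ∈ ({i, a, b} : Finset B), M.cosEntry i j =
      M.cosEntry i i + (M.cosEntry i a + M.cosEntry i b) := by
    rw [Finset.sum_insert (by simp [hai.symm, hbi.symm]), Finset.sum_pair hab]
  have h4 := M.cosEntry_le_neg_half hai.symm fun h => hka ((M.cosEntry_eq_zero_iff hai.symm).2 h)
  have h5 := M.cosEntry_le_neg_half hbi.symm fun h => hkb ((M.cosEntry_eq_zero_iff hbi.symm).2 h)
  rw [h1, ← Finset.sum_sdiff hsub, h3, cosEntry_self]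
  simp only [v, hi, if_true, one_mul]
  linarith

include cs in
/-- The Coxeter graph of a finite Coxeter group is bipartite. -/
lemma exists_coloring : ∃ ε : B → Bool, ∀ i j, i ≠ j → ε i = ε j → M.cosEntry i j = 0 := by
  suffices h : ∀ J : Finset B, ∃ ε : B → Bool, ∀ i ∈ J, ∀ j ∈ J, i ≠ j → ε i = ε j →
      M.cosEntry i j = 0 by
    obtain ⟨ε, hε⟩ := h Finset.univ
    exact ⟨ε, fun i j => hε i (Finset.mem_univ i) j (Finset.mem_univ j)⟩
  intro J
  induction hn : J.card generalizing J with
  | zero =>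
    rw [Finset.card_eq_zero] at hn
    exact ⟨fun _ => true, by simp [hn]⟩
  | succ n ih =>
    obtain ⟨s, hs, hleaf⟩ := cs.exists_leaf (Finset.card_pos.1 (by omega : 0 < J.card))
    obtain ⟨ε, hε⟩ := ih (J.erase s) (by rw [Finset.card_erase_of_mem hs]; omega)
    have key : ∃ b : Bool, ∀ i ∈ J, i ≠ s → ε i = b → M.cosEntry s i = 0 := by
      by_cases h : ∃ r ∈ J, r ≠ s ∧ M.cosEntry s r ≠ 0
      · obtain ⟨r, hr, hrs, hk⟩ := h
        refine ⟨!ε r, fun i hi his hb => ?_⟩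
        by_contra hcon
        rw [hleaf i hi r hr his hrs hcon hk] at hb
        simp at hb
      · push Not at h
        exact ⟨true, fun i hi his _ => h i hi his⟩
    obtain ⟨b, hb⟩ := key
    refine ⟨Function.update ε s b, fun i hi j hj hij hc => ?_⟩
    by_cases his : i = s
    · subst his
      rw [Function.update_self, Function.update_of_ne hij.symm] at hc
      exact hb j hj hij.symm hc.symm
    · rw [Function.update_of_ne his] at hc
      by_cases hjs : j = s
      · subst hjs
        rw [Function.update_self] at hc
        rw [cosEntry_comm]
        exact hb i hi his hc
      · rw [Function.update_of_ne hjs] at hc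
        exact hε i (Finset.mem_erase.2 ⟨his, hi⟩) j (Finset.mem_erase.2 ⟨hjs, hj⟩) hij hc

end Forest

lemma commute_simple {i j : B} (h : M.cosEntry i j = 0) :
    Commute (cs.simple i) (cs.simple j) := by
  have hij : i ≠ j := by
    rintro rfl
    simp [cosEntry_self] at h
  have h2 := cs.simple_mul_simple_pow i j
  rw [(M.cosEntry_eq_zero_iff hij).1 h, pow_two] at h2
  have h3 := mul_eq_one_iff_eq_inv.1 h2
  rw [mul_inv_rev, inv_simple, inv_simple] at h3
  exact h3

section Conjugation

variable (M) in
/-- Elementary moves between words: exchanging adjacent orthogonal letters, and rotation. -/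
inductive RotationStep : List B → List B → Prop
  | swap (a : List B) (i j : B) (b : List B) (h : M.cosEntry i j = 0) :
      RotationStep (a ++ i :: j :: b) (a ++ j :: i :: b)
  | rotate (i : B) (a : List B) : RotationStep (i :: a) (a ++ [i])

lemma RotationStep.perm {l l' : List B} (h : RotationStep M l l') : l.Perm l' := by
  cases h with
  | swap a i j b => exact List.Perm.append_left a (List.Perm.swap j i b)
  | rotate i a => exact (List.perm_append_singleton i a).symm

lemma RotationStep.isConj {l l' : List B} (h : RotationStep M l l') :
    IsConj (cs.wordProd l) (cs.wordProd l') := by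
  cases h with
  | swap a i j b h =>
    simp only [wordProd_append, wordProd_cons]
    rw [← mul_assoc (cs.simple i), (cs.commute_simple h).eq, mul_assoc]
  | rotate i a =>
    rw [wordProd_cons, wordProd_append, wordProd_singleton]
    exact isConj_iff.2 ⟨(cs.simple i)⁻¹, by group⟩

open Relation

lemma eqvGen_rotationStep_move {s : B} {a : List B} (p : List B)
    (h : ∀ j ∈ a, M.cosEntry s j = 0) :
    EqvGen (RotationStep M) (p ++ a ++ [s]) (p ++ s :: a) := by
  induction a generalizing p with
  | nil => simpa using EqvGen.refl _
  | cons x a ih =>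
    have h1 := ih (p ++ [x]) fun j hj => h j (List.mem_cons_of_mem _ hj)
    simp only [List.append_assoc, List.cons_append, List.nil_append] at h1 ⊢
    refine h1.trans _ _ _ (EqvGen.rel _ _ (RotationStep.swap p x s a ?_))
    rw [cosEntry_comm]
    exact h x List.mem_cons_self

lemma RotationStep.cons {s : B} {l l' : List B} (h : RotationStep M l l') (hl : l.Nodup)
    (hs : ∀ i ∈ l, ∀ j ∈ l, M.cosEntry s i ≠ 0 → M.cosEntry s j ≠ 0 → i = j) :
    EqvGen (RotationStep M) (s :: l) (s :: l') := by
  cases h with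
  | swap a i j b h => exact EqvGen.rel _ _ (RotationStep.swap (s :: a) i j b h)
  | rotate i a =>
    by_cases hi : M.cosEntry s i = 0
    · exact (EqvGen.rel _ _ (RotationStep.swap [] s i a hi)).trans _ _ _
        (EqvGen.rel _ _ (RotationStep.rotate i (s :: a)))
    · have ha : ∀ j ∈ a, M.cosEntry s j = 0 := fun j hj => by
        by_contra hcon
        have := hs i List.mem_cons_self j (List.mem_cons_of_mem _ hj) hi hcon
        exact (List.nodup_cons.1 hl).1 (this ▸ hj)
      refine (EqvGen.rel _ _ (RotationStep.rotate s (i :: a))).trans _ _ _ ?_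
      refine (eqvGen_rotationStep_move [i] ha).trans _ _ _ ?_
      exact EqvGen.rel _ _ (RotationStep.rotate i (s :: a))

lemma eqvGen_rotationStep_cons {s : B} {l l' : List B} (h : EqvGen (RotationStep M) l l')
    (hl : l.Nodup)
    (hs : ∀ i ∈ l, ∀ j ∈ l, M.cosEntry s i ≠ 0 → M.cosEntry s j ≠ 0 → i = j) :
    l.Perm l' ∧ EqvGen (RotationStep M) (s :: l) (s :: l') := by
  have aux : l.Perm l' ∧ (l.Nodup → (∀ i ∈ l, ∀ j ∈ l, M.cosEntry s i ≠ 0 →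
      M.cosEntry s j ≠ 0 → i = j) → EqvGen (RotationStep M) (s :: l) (s :: l')) := by
    clear hl hs
    induction h with
    | rel x y h => exact ⟨h.perm, h.cons⟩
    | refl x => exact ⟨List.Perm.refl x, fun _ _ => EqvGen.refl _⟩
    | symm x y _ ih =>
      refine ⟨ih.1.symm, fun hn hs => (ih.2 (ih.1.nodup_iff.2 hn) ?_).symm⟩
      simpa only [ih.1.mem_iff] using hs
    | trans x y z _ _ ih1 ih2 =>
      refine ⟨ih1.1.trans ih2.1, fun hn hs => (ih1.2 hn hs).trans _ _ _
        (ih2.2 (ih1.1.nodup_iff.1 hn) ?_)⟩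
      simpa only [ih1.1.mem_iff] using hs
  exact ⟨aux.1, aux.2 hl hs⟩

lemma eqvGen_rotationStep_append (a b : List B) :
    EqvGen (RotationStep M) (a ++ b) (b ++ a) := by
  induction a generalizing b with
  | nil => simpa using EqvGen.refl _
  | cons x a ih =>
    refine (EqvGen.rel _ _ (RotationStep.rotate x (a ++ b))).trans _ _ _ ?_
    simpa using ih (b ++ [x])

variable [Fintype B] [Finite W]

include cs in
lemma eqvGen_rotationStep_of_perm {l l' : List B} (hl : l.Nodup) (h : l.Perm l') :
    EqvGen (RotationStep M) l l' := by
  classical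
  induction hn : l.length generalizing l l' with
  | zero =>
    rw [List.length_eq_zero_iff] at hn
    subst hn
    rw [List.nil_perm.1 h]
    exact EqvGen.refl _
  | succ n ih =>
    obtain ⟨s, hs, hleaf⟩ := cs.exists_leaf (J := l.toFinset)
      (List.toFinset_nonempty_iff l |>.2 (by rintro rfl; simp at hn))
    rw [List.mem_toFinset] at hs
    simp only [List.mem_toFinset] at hleaf
    obtain ⟨a, b, rfl⟩ := List.append_of_mem hs
    obtain ⟨a', b', rfl⟩ := List.append_of_mem (h.mem_iff.1 hs)
    have h1 : (a ++ s :: b).Perm (s :: (b ++ a)) := List.perm_append_comm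
    have h2 : (a' ++ s :: b').Perm (s :: (b' ++ a')) := List.perm_append_comm
    have h3 : (b ++ a).Perm (b' ++ a') := (h1.symm.trans (h.trans h2)).cons_inv
    have hnd : (s :: (b ++ a)).Nodup := h1.nodup_iff.1 hl
    have hn' : (b ++ a).length = n := by
      have := h1.length_eq
      rw [List.length_cons] at this
      omega
    have hsne : ∀ i ∈ b ++ a, i ≠ s := by
      rintro i hi rfl
      exact (List.nodup_cons.1 hnd).1 hi
    have hmem : ∀ i ∈ b ++ a, i ∈ a ++ s :: b := fun i hi =>
      h1.mem_iff.2 (List.mem_cons_of_mem _ hi)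
    refine (eqvGen_rotationStep_append a (s :: b)).trans _ _ _ (EqvGen.trans _ _ _ ?_
      (eqvGen_rotationStep_append a' (s :: b')).symm)
    exact (eqvGen_rotationStep_cons (ih (List.nodup_cons.1 hnd).2 h3 hn')
      (List.nodup_cons.1 hnd).2 fun i hi j hj => hleaf i (hmem i hi) j (hmem j hj)
        (hsne i hi) (hsne j hj)).2

/-- In a finite Coxeter group, the product of a set of simple reflections is, up to conjugacy,
independent of the order of the factors. -/
theorem isConj_wordProd_of_perm {l l' : List B} (hl : l.Nodup) (h : l.Perm l') :
    IsConj (cs.wordProd l) (cs.wordProd l') := by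
  have h' := cs.eqvGen_rotationStep_of_perm hl h
  clear hl h
  induction h' with
  | rel x y h => exact h.isConj cs
  | refl x => exact IsConj.refl _
  | symm x y _ ih => exact ih.symm
  | trans x y z _ _ ih1 ih2 => exact ih1.trans ih2

end Conjugation

end CoxeterSystem

section Perron

variable {ι : Type*} [Fintype ι]

/-- Perron–Frobenius: an irreducible symmetric nonnegative matrix has a positive eigenvector. -/
theorem exists_pos_eigenvector [Nonempty ι] (A : ι → ι → ℝ) (hsymm : ∀ i j, A i j = A j i)
    (hnn : ∀ i j, 0 ≤ A i j)
    (hirr : ∀ L : Set ι, L.Nonempty → (∀ i ∈ L, ∀ j ∉ L, A i j = 0) → L = Set.univ) :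
    ∃ (x : ι → ℝ) (r : ℝ), (∀ i, 0 < x i) ∧ ∀ i, ∑ j, A i j * x j = r * x i := by
  classical
  let q : (ι → ℝ) → ℝ := fun x => ∑ i, x i * ∑ j, A i j * x j
  let S : Set (ι → ℝ) := {x | x ∈ Set.Icc 0 1 ∧ ∑ i, x i ^ 2 = 1}
  have hS : IsCompact S := by
    refine isCompact_Icc.inter_right (isClosed_eq ?_ continuous_const)
    fun_prop
  have hSne : S.Nonempty := by
    obtain ⟨i⟩ := ‹Nonempty ι›
    refine ⟨Pi.single i 1, ⟨?_, ?_⟩, ?_⟩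
    · simp
    · intro j
      by_cases h : j = i
      · subst h; simp
      · simp [h]
    · simp [Pi.single_apply]
  obtain ⟨x, ⟨⟨hx0, -⟩, hx1⟩, hmax⟩ := hS.exists_isMaxOn hSne (f := q) (by fun_prop)
  have hx0 : ∀ i, 0 ≤ x i := hx0
  have hle (u : ι → ℝ) : q u ≤ q x * ∑ i, u i ^ 2 := by
    have habs : q u ≤ q fun i => |u i| := by
      simp only [q, Finset.mul_sum]
      refine Finset.sum_le_sum fun i _ => Finset.sum_le_sum fun j _ => ?_
      calc u i * (A i j * u j) = A i j * (u i * u j) := by ring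
        _ ≤ A i j * |u i * u j| := mul_le_mul_of_nonneg_left (le_abs_self _) (hnn i j)
        _ = |u i| * (A i j * |u j|) := by rw [abs_mul]; ring
    refine habs.trans ?_
    rcases (Finset.sum_nonneg fun i _ => sq_nonneg (u i) : 0 ≤ ∑ i, u i ^ 2).eq_or_lt with h0 | h0
    · have hu : u = 0 := by
        ext i
        have := (Finset.sum_eq_zero_iff_of_nonneg fun i _ => sq_nonneg (u i)).1 h0.symm i
          (Finset.mem_univ i)
        simpa using this
      simp [hu, q]
    · set d := Real.sqrt (∑ i, u i ^ 2) with hd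
      have hd0 : 0 < d := Real.sqrt_pos.2 h0
      have hdd : d ^ 2 = ∑ i, u i ^ 2 := Real.sq_sqrt h0.le
      have hmem : (fun i => |u i| / d) ∈ S := by
        refine ⟨⟨fun i => div_nonneg (abs_nonneg _) hd0.le, fun i => ?_⟩, ?_⟩
        · simp only [Pi.one_apply]
          rw [div_le_one hd0]
          refine abs_le_of_sq_le_sq ?_ hd0.le
          rw [hdd]
          exact Finset.single_le_sum (fun i _ => sq_nonneg (u i)) (Finset.mem_univ i)
        · simp only [div_pow, sq_abs, ← Finset.sum_div]
          rw [hdd, div_self h0.ne']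
      have : q (fun i => |u i| / d) ≤ q x := hmax hmem
      have hq : q (fun i => |u i| / d) = q (fun i => |u i|) / d ^ 2 := by
        simp only [q, Finset.mul_sum, Finset.sum_div]
        refine Finset.sum_congr rfl fun i _ => Finset.sum_congr rfl fun j _ => ?_
        field_simp
      rw [hq, div_le_iff₀ (by positivity), hdd] at this
      exact this
  have heig (i : ι) : ∑ j, A i j * x j = q x * x i := by
    -- the first-order condition in the `i`-th coordinate direction
    have hquad (t : ℝ) : 0 ≤ t * (2 * (q x * x i - ∑ j, A i j * x j)) + t ^ 2 * (q x - A i i) := by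
      have h1 := hle (x + Pi.single i t)
      have h2 : ∑ j, (x + Pi.single i t : ι → ℝ) j ^ 2 = 1 + 2 * t * x i + t ^ 2 := by
        simp only [Pi.add_apply, add_sq, Finset.sum_add_distrib, hx1]
        simp [Pi.single_apply]
        ring
      have h3 : q (x + Pi.single i t) = q x + 2 * t * ∑ j, A i j * x j + t ^ 2 * A i i := by
        have h4 : ∑ k, x k * (A k i * t) = t * ∑ j, A i j * x j := by
          rw [Finset.mul_sum]
          exact Finset.sum_congr rfl fun j _ => by rw [hsymm j i]; ring
        simp only [q, Pi.add_apply, mul_add, add_mul, Finset.sum_add_distrib]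
        simp only [Pi.single_apply, mul_ite, ite_mul, mul_zero, zero_mul, Finset.sum_ite_eq',
          Finset.mem_univ, if_true, h4]
        ring
      rw [h2, h3] at h1
      nlinarith
    by_contra hne
    set b := 2 * (q x * x i - ∑ j, A i j * x j) with hb
    set c := q x - A i i
    have hb0 : b ≠ 0 := fun h => hne (by linarith)
    have h1 := hquad (-b / (|c| + 1))
    have hc : 0 < |c| + 1 := by positivity
    have h2 : -b / (|c| + 1) * b + (-b / (|c| + 1)) ^ 2 * c =
        b ^ 2 / (|c| + 1) ^ 2 * (c - (|c| + 1)) := by field_simp; ring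
    rw [h2] at h1
    have h3 : 0 < b ^ 2 / (|c| + 1) ^ 2 := by positivity
    nlinarith [le_abs_self c]
  have hpos : {i | 0 < x i} = Set.univ := by
    refine hirr _ ?_ fun i hi j hj => ?_
    · by_contra hcon
      rw [Set.not_nonempty_iff_eq_empty, Set.eq_empty_iff_forall_notMem] at hcon
      have : ∀ i, x i = 0 := fun i => le_antisymm (not_lt.1 (hcon i)) (hx0 i)
      simp [this] at hx1
    · have hxj : x j = 0 := le_antisymm (not_lt.1 hj) (hx0 j)
      have h1 := heig j
      rw [hxj, mul_zero, Finset.sum_eq_zero_iff_of_nonneg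
        fun k _ => mul_nonneg (hnn j k) (hx0 k)] at h1
      have h2 := h1 i (Finset.mem_univ i)
      rw [hsymm i j]
      exact (mul_eq_zero.1 h2).resolve_right (ne_of_gt hi)
  exact ⟨x, q x, fun i => (hpos.symm ▸ Set.mem_univ i : i ∈ {i | 0 < x i}), heig⟩

end Perron

namespace CoxeterMatrix

variable {B : Type*} (M : CoxeterMatrix B)

/-- A proper colouring of the Coxeter graph with two colours. -/
def IsColoring (ε : B → Bool) : Prop := ∀ i j, i ≠ j → ε i = ε j → M.cosEntry i j = 0

/-- The vertices of `J` having the colour given by the parity of `m`. -/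
def colorClass (ε : B → Bool) (J : Finset B) (m : ℕ) : Finset B := {i ∈ J | ε i = m.bodd}

variable {ε : B → Bool} {J : Finset B}

lemma mem_colorClass {m : ℕ} {i : B} : i ∈ colorClass ε J m ↔ i ∈ J ∧ ε i = m.bodd := by
  simp [colorClass]

lemma colorClass_add_two (m : ℕ) : colorClass ε J (m + 2) = colorClass ε J m := by
  simp [colorClass]

lemma disjoint_colorClass (m : ℕ) : Disjoint (colorClass ε J m) (colorClass ε J (m + 1)) := by
  rw [Finset.disjoint_left]
  intro i hi hi'
  rw [mem_colorClass] at hi hi'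
  simp [hi.2] at hi'

lemma colorClass_union [DecidableEq B] (m : ℕ) :
    colorClass ε J m ∪ colorClass ε J (m + 1) = J := by
  ext i
  rw [Finset.mem_union, mem_colorClass, mem_colorClass, Nat.bodd_succ]
  cases ε i <;> cases m.bodd <;> simp

lemma sum_colorClass_add [DecidableEq B] {A : Type*} [AddCommMonoid A] (m : ℕ) (g : B → A) :
    ∑ i ∈ colorClass ε J m, g i + ∑ i ∈ colorClass ε J (m + 1), g i = ∑ i ∈ J, g i := by
  rw [← Finset.sum_union (disjoint_colorClass m), colorClass_union]

variable {M} in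
lemma IsColoring.cosEntry_eq_zero (hε : M.IsColoring ε) {m : ℕ} {i j : B}
    (hi : i ∈ colorClass ε J m) (hj : j ∈ colorClass ε J m) (h : i ≠ j) : M.cosEntry i j = 0 :=
  hε i j h ((mem_colorClass.1 hi).2.trans (mem_colorClass.1 hj).2.symm)

/-- `K` is nonempty and connected in the Coxeter graph. -/
def IsConn [DecidableEq B] (K : Finset B) : Prop :=
  K.Nonempty ∧ ∀ L ⊆ K, L.Nonempty → M.IsOrtho L (K \ L) → L = K

variable [Fintype B] [DecidableEq B]

variable {M} in
/-- The Perron–Frobenius eigenvector of a connected component. -/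
lemma IsConn.exists_pos_eigenvector {K : Finset B} (hK : M.IsConn K) :
    ∃ (x : B → ℝ) (r : ℝ), x ∈ coordSpace K ∧ (∀ i ∈ K, 0 < x i) ∧
      ∀ i ∈ K, 2 * M.form (simpleRoot i) x = (2 - r) * x i := by
  have : Nonempty K := hK.1.to_subtype
  obtain ⟨x, r, hx, hr⟩ := _root_.exists_pos_eigenvector (ι := K)
    (fun i j => if i = j then 0 else -2 * M.cosEntry i j)
    (fun i j => by simp only [eq_comm, M.cosEntry_comm i j])
    (fun i j => by
      split_ifs with h
      · exact le_rfl
      · have := M.cosEntry_nonpos (fun hh => h (Subtype.ext hh))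
        linarith)
    (fun L hL h => by
      classical
      have h1 := hK.2 {i ∈ K | ∃ h : i ∈ K, (⟨i, h⟩ : K) ∈ L} (Finset.filter_subset _ _)
        (by
          obtain ⟨i, hi⟩ := hL
          exact ⟨i, by simp [hi]⟩)
        (fun i hi j hj => by
          simp only [Finset.mem_filter, Finset.mem_sdiff, not_and, not_exists] at hi hj
          obtain ⟨hiK, _, hi⟩ := hi
          have hj' := hj.2 hj.1 hj.1
          have h2 := h _ hi _ hj'
          have hne : (⟨i, hiK⟩ : K) ≠ ⟨j, hj.1⟩ := fun hh => hj' (hh ▸ hi)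
          rw [if_neg hne] at h2
          simpa using h2)
      ext i
      have h2 : (i : B) ∈ ({i ∈ K | ∃ h : i ∈ K, (⟨i, h⟩ : K) ∈ L} : Finset B) := h1.symm ▸ i.2
      simpa using h2)
  let x' : B → ℝ := fun i => if h : i ∈ K then x ⟨i, h⟩ else 0
  have hx'K : x' ∈ coordSpace K := fun i hi => dif_neg hi
  refine ⟨x', r, hx'K, fun i hi => by simp only [x', hi, dif_pos]; exact hx _, fun i hi => ?_⟩
  have h1 := hr ⟨i, hi⟩
  have hx'i : ∀ j : K, x j = x' j := fun j => by simp [x']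
  simp only [hx'i] at h1
  have h2 : ∑ j : K, (if (⟨i, hi⟩ : K) = j then 0 else -2 * M.cosEntry i j) * x' j =
      ∑ j ∈ K, (if i = j then 0 else -2 * M.cosEntry i j) * x' j := by
    rw [← Finset.sum_coe_sort K]
    exact Finset.sum_congr rfl fun j _ => by simp only [Subtype.ext_iff]
  rw [h2] at h1
  rw [form_simpleRoot_eq_sum_of_mem M i hx'K, Finset.mul_sum]
  have h3 : ∀ j ∈ K, 2 * (M.cosEntry i j * x' j) = (if i = j then 2 * x' j else 0) -
      (if i = j then 0 else -2 * M.cosEntry i j) * x' j := fun j _ => by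
    split_ifs with h
    · subst h; rw [cosEntry_self]; ring
    · ring
  rw [Finset.sum_congr rfl h3, Finset.sum_sub_distrib, h1]
  simp only [Finset.sum_ite_eq, hi, if_true]
  ring

end CoxeterMatrix

namespace CoxeterSystem

open CoxeterMatrix

variable {B W : Type*} [Group W] {M : CoxeterMatrix B} (cs : CoxeterSystem M W)
  [Fintype B] [DecidableEq B]

lemma geomRep_wordProd_of_pairwise {l : List B} (hl : l.Nodup)
    (h : ∀ i ∈ l, ∀ j ∈ l, i ≠ j → M.cosEntry i j = 0) (v : B → ℝ) :
    cs.geomRep (cs.wordProd l) v =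
      v - ∑ i ∈ l.toFinset, (2 * M.form (simpleRoot i) v) • simpleRoot i := by
  induction l with
  | nil => simp
  | cons i l ih =>
    rw [List.nodup_cons] at hl
    have hz : M.form (simpleRoot i)
        (∑ j ∈ l.toFinset, (2 * M.form (simpleRoot j) v) • simpleRoot j) = 0 := by
      rw [map_sum]
      refine Finset.sum_eq_zero fun j hj => ?_
      rw [List.mem_toFinset] at hj
      rw [map_smul, form_simpleRoot, h i (by simp) j (by simp [hj])
        (fun e => hl.1 (e ▸ hj)), smul_zero]
    rw [wordProd_cons, geomRep_mul, ih hl.2 fun a ha b hb => h a (by simp [ha]) b (by simp [hb]),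
      geomRep_simple, map_sub, hz, List.toFinset_cons,
      Finset.sum_insert (by simpa using hl.1), sub_zero]
    abel

variable (ε : B → Bool)

/-- The product of the simple reflections in `J` of one colour. -/
noncomputable def layer (J : Finset B) (m : ℕ) : W := cs.wordProd (colorClass ε J m).toList

omit [Fintype B] [DecidableEq B] in
lemma layer_add_two (J : Finset B) (m : ℕ) : cs.layer ε J (m + 2) = cs.layer ε J m := by
  rw [layer, layer, colorClass_add_two]

variable {ε} (hε : M.IsColoring ε)
include hε

lemma geomRep_layer (J : Finset B) (m : ℕ) (v : B → ℝ) : cs.geomRep (cs.layer ε J m) v =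
    v - ∑ i ∈ colorClass ε J m, (2 * M.form (simpleRoot i) v) • simpleRoot i := by
  rw [layer, geomRep_wordProd_of_pairwise _ (Finset.nodup_toList _), Finset.toList_toFinset]
  intro i hi j hj hij
  rw [Finset.mem_toList] at hi hj
  exact hε.cosEntry_eq_zero hi hj hij

lemma geomRep_layer_of_mem {J K : Finset B} (hKJ : K ⊆ J) (hK : M.IsOrtho K (J \ K)) (m : ℕ)
    {v : B → ℝ} (hv : v ∈ coordSpace K) : cs.geomRep (cs.layer ε J m) v =
    v - ∑ i ∈ colorClass ε K m, (2 * M.form (simpleRoot i) v) • simpleRoot i := by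
  rw [cs.geomRep_layer hε]
  congr 1
  refine (Finset.sum_subset (fun i hi => ?_) fun i hi hi' => ?_).symm
  · rw [mem_colorClass] at *
    exact ⟨hKJ hi.1, hi.2⟩
  · rw [mem_colorClass] at hi hi'
    rw [hK.symm.form_simpleRoot (Finset.mem_sdiff.2 ⟨hi.1, fun h => hi' ⟨h, hi.2⟩⟩) hv]
    simp

lemma geomRep_layer_mem {J K : Finset B} (hKJ : K ⊆ J) (hK : M.IsOrtho K (J \ K)) (m : ℕ)
    {v : B → ℝ} (hv : v ∈ coordSpace K) : cs.geomRep (cs.layer ε J m) v ∈ coordSpace K := by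
  rw [cs.geomRep_layer_of_mem hε hKJ hK m hv]
  refine Submodule.sub_mem _ hv (Submodule.sum_mem _ fun i hi => Submodule.smul_mem _ _ ?_)
  exact simpleRoot_mem_coordSpace (mem_colorClass.1 hi).1

lemma geomRep_layer_apply_of_notMem {J : Finset B} {m : ℕ} {i : B} (h : i ∉ colorClass ε J m)
    (v : B → ℝ) : cs.geomRep (cs.layer ε J m) v i = v i := by
  rw [cs.geomRep_layer hε]
  simp only [Pi.sub_apply, Finset.sum_apply, Pi.smul_apply, smul_eq_mul, sub_eq_self]
  refine Finset.sum_eq_zero fun j hj => ?_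
  have hij : i ≠ j := by
    rintro rfl
    exact h hj
  simp [hij]

lemma geomRep_layer_apply_of_mem {J : Finset B} {m : ℕ} {i : B} (h : i ∈ colorClass ε J m)
    (v : B → ℝ) :
    cs.geomRep (cs.layer ε J m) v i = v i - 2 * M.form (simpleRoot i) v := by
  rw [cs.geomRep_layer hε]
  simp [Finset.sum_apply, Pi.single_apply, h]

omit cs in
lemma form_simpleRoot_eq_of_mem_colorClass {J : Finset B} {m : ℕ} {i : B}
    (h : i ∈ colorClass ε J m) (u : B → ℝ) :
    M.form (simpleRoot i) (∑ j ∈ colorClass ε J m, u j • simpleRoot j) = u i := by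
  rw [map_sum, Finset.sum_eq_single_of_mem i h]
  · simp [cosEntry_self]
  · intro j hj hji
    rw [map_smul, form_simpleRoot, hε.cosEntry_eq_zero h hj hji.symm, smul_zero]

lemma geomRep_layer_simpleRoot {J : Finset B} {m : ℕ} {i : B} (h : i ∈ colorClass ε J m) :
    cs.geomRep (cs.layer ε J m) (simpleRoot i) = -simpleRoot i := by
  rw [cs.geomRep_layer hε, Finset.sum_eq_single_of_mem i h]
  · rw [form_simpleRoot, cosEntry_self]; module
  · intro j hj hji
    rw [form_simpleRoot, hε.cosEntry_eq_zero hj h hji]; simp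

lemma layer_mul_self (J : Finset B) (m : ℕ) : cs.layer ε J m * cs.layer ε J m = 1 := by
  apply cs.geomRep_injective
  refine LinearMap.ext fun v => ?_
  ext i
  rw [geomRep_mul, geomRep_one]
  by_cases h : i ∈ colorClass ε J m
  · rw [cs.geomRep_layer_apply_of_mem hε h, cs.geomRep_layer_apply_of_mem hε h,
      cs.geomRep_layer hε J m v, map_sub,
      form_simpleRoot_eq_of_mem_colorClass hε h fun i => 2 * M.form (simpleRoot i) v]
    ring
  · rw [cs.geomRep_layer_apply_of_notMem hε h, cs.geomRep_layer_apply_of_notMem hε h]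

lemma layer_inv (J : Finset B) (m : ℕ) : (cs.layer ε J m)⁻¹ = cs.layer ε J m :=
  inv_eq_of_mul_eq_one_left (cs.layer_mul_self hε J m)

lemma layer_eq_simple_mul_layer_erase {J : Finset B} {m : ℕ} {s : B} (h : s ∈ colorClass ε J m) :
    cs.layer ε J m = cs.simple s * cs.layer ε (J.erase s) m := by
  apply cs.geomRep_injective
  refine LinearMap.ext fun v => ?_
  have he : colorClass ε (J.erase s) m = (colorClass ε J m).erase s := by
    ext i; simp [mem_colorClass, and_assoc]
  rw [geomRep_mul, geomRep_simple, cs.geomRep_layer hε, cs.geomRep_layer hε, he,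
    ← Finset.add_sum_erase _ _ h, map_sub]
  have hz : M.form (simpleRoot s) (∑ j ∈ (colorClass ε J m).erase s,
      (2 * M.form (simpleRoot j) v) • simpleRoot j) = 0 := by
    rw [map_sum]
    refine Finset.sum_eq_zero fun j hj => ?_
    rw [Finset.mem_erase] at hj
    rw [map_smul, form_simpleRoot, hε.cosEntry_eq_zero h hj.2 hj.1.symm, smul_zero]
  rw [hz, sub_zero]
  abel

omit [Fintype B] hε in
lemma layer_erase_of_notMem {J : Finset B} {m : ℕ} {s : B} (h : s ∉ colorClass ε J m) :
    cs.layer ε (J.erase s) m = cs.layer ε J m := by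
  have he : colorClass ε (J.erase s) m = colorClass ε J m := by
    ext i
    simp only [mem_colorClass, Finset.mem_erase] at *
    refine ⟨fun hi => ⟨hi.1.2, hi.2⟩, fun hi => ⟨⟨?_, hi.1⟩, hi.2⟩⟩
    rintro rfl
    exact h hi
  rw [layer, layer, he]

omit hε
variable [Fintype W]

lemma eq_simpleRoot_of_mem_singleton {γ : B → ℝ} (h : γ ∈ cs.roots) (h0 : 0 ≤ γ) {i : B}
    (hi : γ ∈ coordSpace {i}) : γ = simpleRoot i := by
  by_contra hne
  have h1 := eq_sum_simpleRoot_of_mem hi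
  rw [Finset.sum_singleton] at h1
  have h2 := cs.geomRep_simple_nonneg h h0 hne i
  rw [h1, map_smul, geomRep_simple_self] at h2
  have h3 : γ i = 0 := le_antisymm (by simpa using h2) (h0 i)
  rw [h3, zero_smul] at h1
  exact cs.root_ne_zero h h1

include hε

lemma geomRep_layer_nonneg {γ : B → ℝ} (h : γ ∈ cs.roots) (h0 : 0 ≤ γ) {J : Finset B} {m : ℕ}
    (hne : ∀ i ∈ colorClass ε J m, γ ≠ simpleRoot i) : 0 ≤ cs.geomRep (cs.layer ε J m) γ := by
  refine (cs.root_nonneg_or_nonpos (cs.geomRep_mem_roots h _)).resolve_right fun hneg => ?_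
  have hγ : γ ∈ coordSpace (colorClass ε J m) := fun i hi => by
    refine le_antisymm ?_ (h0 i)
    rw [← cs.geomRep_layer_apply_of_notMem hε hi γ]
    exact hneg i
  obtain ⟨i, hi⟩ := Function.ne_iff.1 (cs.root_ne_zero h)
  have hiJ : i ∈ colorClass ε J m := by
    by_contra hcon
    exact hi (hγ i hcon)
  have hort : M.IsOrtho {i} ((colorClass ε J m).erase i) := fun a ha b hb => by
    rw [Finset.mem_singleton] at ha
    rw [Finset.mem_erase] at hb
    subst ha
    exact hε.cosEntry_eq_zero hiJ hb.2 hb.1.symm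
  have hmem : γ ∈ cs.rootsIn ({i} ∪ (colorClass ε J m).erase i) := by
    rw [← Finset.insert_eq, Finset.insert_erase hiJ]
    exact cs.mem_rootsIn.2 ⟨h, hγ⟩
  rcases cs.mem_coordSpace_or_of_isOrtho hort hmem with h' | h'
  · exact hne i hiJ (cs.eq_simpleRoot_of_mem_singleton h h0 h')
  · exact hi (h' i (Finset.notMem_erase i _))

end CoxeterSystem

namespace CoxeterSystem

open CoxeterMatrix

variable {B W : Type*} [Group W] {M : CoxeterMatrix B} (cs : CoxeterSystem M W)

/-- The alternating product of `k` layers, the first one having the colour of `e`. -/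
noncomputable def zigzag (ε : B → Bool) (J : Finset B) (e : ℕ) : ℕ → W
  | 0 => 1
  | k + 1 => zigzag ε J e k * cs.layer ε J (e + k)

/-- The bipartite Coxeter element of the parabolic subgroup generated by `J`. -/
noncomputable def bipartiteCoxeter (ε : B → Bool) (J : Finset B) : W :=
  cs.layer ε J 0 * cs.layer ε J 1

variable (ε : B → Bool) (J : Finset B)

@[simp]
lemma zigzag_zero (e : ℕ) : cs.zigzag ε J e 0 = 1 := rfl

lemma zigzag_succ (e k : ℕ) :
    cs.zigzag ε J e (k + 1) = cs.zigzag ε J e k * cs.layer ε J (e + k) := rfl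

lemma zigzag_add (e k l : ℕ) :
    cs.zigzag ε J e (k + l) = cs.zigzag ε J e k * cs.zigzag ε J (e + k) l := by
  induction l with
  | zero => simp
  | succ l ih => rw [← add_assoc, zigzag_succ, zigzag_succ, ih, mul_assoc, add_assoc]

lemma layer_add_two_mul (m k : ℕ) : cs.layer ε J (m + 2 * k) = cs.layer ε J m := by
  induction k with
  | zero => rfl
  | succ k ih => rw [show m + 2 * (k + 1) = m + 2 * k + 2 by ring, layer_add_two, ih]

lemma zigzag_two_mul (e m : ℕ) :
    cs.zigzag ε J e (2 * m) = (cs.layer ε J e * cs.layer ε J (e + 1)) ^ m := by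
  induction m with
  | zero => simp
  | succ m ih =>
    rw [mul_add, mul_one, zigzag_succ, zigzag_succ, ih, pow_succ, layer_add_two_mul,
      show e + (2 * m + 1) = e + 1 + 2 * m by ring, layer_add_two_mul, mul_assoc]

lemma zigzag_zero_two_mul (m : ℕ) : cs.zigzag ε J 0 (2 * m) = cs.bipartiteCoxeter ε J ^ m :=
  cs.zigzag_two_mul ε J 0 m

lemma zigzag_zero_two_mul_add_one (m : ℕ) :
    cs.zigzag ε J 0 (2 * m + 1) = cs.bipartiteCoxeter ε J ^ m * cs.layer ε J 0 := by
  rw [zigzag_succ, zigzag_zero_two_mul, layer_add_two_mul]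

private noncomputable def cheb (r : ℝ) : ℕ → ℝ
  | 0 => -1
  | 1 => 1
  | k + 2 => r * cheb r (k + 1) - cheb r k

private noncomputable def weight (ε : B → Bool) (K : Finset B) (x : B → ℝ) (m : ℕ)
    (v : B → ℝ) : ℝ :=
  ∑ i ∈ colorClass ε K m, x i * v i

variable {ε J} {K : Finset B} [Fintype B] [DecidableEq B]

section Component

variable (hε : M.IsColoring ε) (hKJ : K ⊆ J) (hKo : M.IsOrtho K (J \ K))
include hε hKJ hKo

lemma geomRep_zigzag_mem (e k : ℕ) {v : B → ℝ} (hv : v ∈ coordSpace K) :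
    cs.geomRep (cs.zigzag ε J e k) v ∈ coordSpace K := by
  induction k generalizing v with
  | zero => simpa
  | succ k ih =>
    rw [zigzag_succ, geomRep_mul]
    exact ih (cs.geomRep_layer_mem hε hKJ hKo _ hv)

section Weight

variable {x : B → ℝ} {r : ℝ} (hxK : x ∈ coordSpace K)
  (hx : ∀ i ∈ K, 2 * M.form (simpleRoot i) x = (2 - r) * x i)
include hxK hx

omit hKo in
private lemma weight_layer (m : ℕ) {v : B → ℝ} (hv : v ∈ coordSpace K) :
    weight ε K x m (cs.geomRep (cs.layer ε J m) v) =
      -weight ε K x m v + r * weight ε K x (m + 1) v := by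
  set u := ∑ j ∈ colorClass ε K m, x j • simpleRoot j with hu
  set u' := ∑ j ∈ colorClass ε K (m + 1), x j • simpleRoot j with hu'
  have hxu : x = u + u' := by
    rw [hu, hu', sum_colorClass_add]
    exact eq_sum_simpleRoot_of_mem hxK
  have h1 : ∑ i ∈ colorClass ε K m, x i * M.form (simpleRoot i) v = M.form u v := by
    rw [hu, map_sum, LinearMap.sum_apply]
    exact Finset.sum_congr rfl fun i _ => by rw [map_smul, LinearMap.smul_apply, smul_eq_mul]
  have h2 : M.form u v = weight ε K x m v - r / 2 * weight ε K x (m + 1) v := by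
    rw [form_comm, form_eq_sum_of_mem M hv, ← sum_colorClass_add m, weight, weight,
      Finset.mul_sum, sub_eq_add_neg, ← Finset.sum_neg_distrib]
    congr 1
    · refine Finset.sum_congr rfl fun i hi => ?_
      rw [hu, form_simpleRoot_eq_of_mem_colorClass hε hi, mul_comm]
    · refine Finset.sum_congr rfl fun i hi => ?_
      have h3 := hx i (mem_colorClass.1 hi).1
      rw [hxu, map_add, ← hxu, hu', form_simpleRoot_eq_of_mem_colorClass hε hi] at h3
      linear_combination v i / 2 * h3
  have h3 : weight ε K x m (cs.geomRep (cs.layer ε J m) v) =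
      weight ε K x m v - 2 * ∑ i ∈ colorClass ε K m, x i * M.form (simpleRoot i) v := by
    rw [weight, weight, Finset.mul_sum, ← Finset.sum_sub_distrib]
    refine Finset.sum_congr rfl fun i hi => ?_
    rw [mem_colorClass] at hi
    rw [cs.geomRep_layer_apply_of_mem hε (mem_colorClass.2 ⟨hKJ hi.1, hi.2⟩)]
    ring
  rw [h3, h1, h2]
  ring

omit hKJ hKo hxK hx in
private lemma weight_layer_succ (m : ℕ) (v : B → ℝ) :
    weight ε K x (m + 1) (cs.geomRep (cs.layer ε J m) v) = weight ε K x (m + 1) v := by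
  refine Finset.sum_congr rfl fun i hi => ?_
  rw [cs.geomRep_layer_apply_of_notMem hε]
  intro h
  rw [mem_colorClass] at h hi
  simp [hi.2] at h

private lemma weight_zigzag (e k : ℕ) {v : B → ℝ} (hv : v ∈ coordSpace K) :
    ∑ i ∈ K, x i * cs.geomRep (cs.zigzag ε J e k) v i =
      cheb r (k + 1) * weight ε K x (e + k) v - cheb r k * weight ε K x (e + k + 1) v := by
  induction k generalizing v with
  | zero =>
    rw [← sum_colorClass_add (ε := ε) e]
    simp [cheb, weight]
  | succ k ih =>
    rw [zigzag_succ, geomRep_mul, ih (cs.geomRep_layer_mem hε hKJ hKo _ hv),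
      cs.weight_layer hε hKJ hxK hx _ hv, cs.weight_layer_succ hε, cheb]
    have : weight ε K x (e + k + 2) v = weight ε K x (e + k) v := by
      rw [weight, colorClass_add_two, weight]
    rw [← add_assoc, this]
    ring

omit [Fintype B] hε hKJ hKo hxK hx in
private lemma weight_simpleRoot {i : B} {m : ℕ} (hi : i ∈ colorClass ε K m) :
    weight ε K x m (simpleRoot i) = x i ∧ weight ε K x (m + 1) (simpleRoot i) = 0 := by
  constructor
  · rw [weight, Finset.sum_eq_single_of_mem i hi]
    · simp
    · intro j _ hji; simp [hji]
  · refine Finset.sum_eq_zero fun j hj => ?_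
    have hji : j ≠ i := by
      rintro rfl
      exact Finset.disjoint_left.1 (disjoint_colorClass m) hi hj
    simp [hji]

end Weight

variable [Fintype W] (hK : M.IsConn K)

include hK in
/-- Half of the alternating product: the signs of the images of the simple roots. -/
lemma exists_zigzag_sign : ∃ N : ℕ, 0 < N ∧
    (∀ e k, k < N → ∀ i ∈ colorClass ε K (e + k),
      0 ≤ cs.geomRep (cs.zigzag ε J e k) (simpleRoot i)) ∧
    ∀ e, ∀ i ∈ K, cs.geomRep (cs.zigzag ε J e N) (simpleRoot i) ≤ 0 := by
  classical
  obtain ⟨x, r, hxK, hxpos, hx⟩ := hK.exists_pos_eigenvector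
  have hpos {γ : B → ℝ} (hγ : γ ∈ cs.roots) (hγK : γ ∈ coordSpace K)
      (h : 0 < ∑ i ∈ K, x i * γ i) : 0 ≤ γ := by
    refine (cs.root_nonneg_or_nonpos hγ).resolve_right fun hneg => absurd h (not_lt.2 ?_)
    exact Finset.sum_nonpos fun i hi => mul_nonpos_of_nonneg_of_nonpos (hxpos i hi).le (hneg i)
  have hneg {γ : B → ℝ} (hγ : γ ∈ cs.roots) (hγK : γ ∈ coordSpace K)
      (h : ∑ i ∈ K, x i * γ i ≤ 0) : γ ≤ 0 := by
    refine (cs.root_nonneg_or_nonpos hγ).resolve_left fun h0 => cs.root_ne_zero hγ ?_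
    have h1 : ∀ i ∈ K, 0 ≤ x i * γ i := fun i hi => mul_nonneg (hxpos i hi).le (h0 i)
    have h2 := (Finset.sum_eq_zero_iff_of_nonneg h1).1 (le_antisymm h (Finset.sum_nonneg h1))
    ext i
    by_cases hi : i ∈ K
    · exact (mul_eq_zero.1 (h2 i hi)).resolve_left (hxpos i hi).ne'
    · exact hγK i hi
  have hα {i : B} (hi : i ∈ K) : simpleRoot i ∈ coordSpace K := simpleRoot_mem_coordSpace hi
  have hsame (e k : ℕ) {i : B} (hi : i ∈ colorClass ε K (e + k)) :
      ∑ j ∈ K, x j * cs.geomRep (cs.zigzag ε J e k) (simpleRoot i) j = cheb r (k + 1) * x i := by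
    have h := weight_simpleRoot (x := x) hi
    rw [cs.weight_zigzag hε hKJ hKo hxK hx e k (hα (mem_colorClass.1 hi).1), h.1, h.2]
    ring
  have hother (e k : ℕ) {i : B} (hi : i ∈ colorClass ε K (e + k + 1)) :
      ∑ j ∈ K, x j * cs.geomRep (cs.zigzag ε J e k) (simpleRoot i) j = -cheb r k * x i := by
    have h := weight_simpleRoot (x := x) hi
    have h2 : weight ε K x (e + k + 1 + 1) (simpleRoot i) =
        weight ε K x (e + k) (simpleRoot i) := by
      rw [weight, weight, show e + k + 1 + 1 = e + k + 2 from rfl, colorClass_add_two]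
    rw [cs.weight_zigzag hε hKJ hKo hxK hx e k (hα (mem_colorClass.1 hi).1), h.1, ← h2, h.2]
    ring
  have hmemK (e k : ℕ) {i : B} (hi : i ∈ K) :
      cs.geomRep (cs.zigzag ε J e k) (simpleRoot i) ∈ coordSpace K :=
    cs.geomRep_zigzag_mem hε hKJ hKo e k (hα hi)
  have hroot (w : W) (i : B) : cs.geomRep w (simpleRoot i) ∈ cs.roots :=
    cs.mem_roots.2 ⟨w, i, rfl⟩
  have hex : ∃ k, 0 < k ∧ cheb r (k + 1) ≤ 0 := by
    obtain ⟨i, hi⟩ := hK.1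
    obtain ⟨e, he⟩ : ∃ e, i ∈ colorClass ε K (e + 1) := by
      rw [← colorClass_union (ε := ε) (J := K) 1, Finset.mem_union] at hi
      exact hi.elim (fun h => ⟨0, h⟩) fun h => ⟨1, h⟩
    set m := orderOf (cs.layer ε J e * cs.layer ε J (e + 1)) with hm
    have hm0 : 0 < m := orderOf_pos _
    have he' : i ∈ colorClass ε K (e + 2 * m + 1) := by
      rw [mem_colorClass] at he ⊢
      refine ⟨he.1, he.2.trans ?_⟩
      simp
    have h1 := hother e (2 * m) he'
    have h2 := hother e 0 he
    rw [zigzag_two_mul, hm, pow_orderOf_eq_one, ← hm] at h1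
    rw [zigzag_zero, h1] at h2
    have h3 := mul_right_cancel₀ (hxpos i hi).ne' h2
    refine ⟨2 * m - 1, by omega, ?_⟩
    rw [show 2 * m - 1 + 1 = 2 * m by omega]
    simp only [cheb] at h3
    linarith
  obtain ⟨hN0, hN⟩ := Nat.find_spec hex
  have hlt : ∀ k < Nat.find hex, 0 < cheb r (k + 1) := fun k hk => by
    rcases Nat.eq_zero_or_pos k with rfl | hk0
    · simp [cheb]
    · by_contra hcon
      exact Nat.find_min hex hk ⟨hk0, not_lt.1 hcon⟩
  refine ⟨Nat.find hex, hN0, fun e k hk i hi => ?_, fun e i hi => ?_⟩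
  · have hiK := (mem_colorClass.1 hi).1
    refine hpos (hroot _ _) (hmemK e k hiK) ?_
    rw [hsame e k hi]
    exact mul_pos (hlt k hk) (hxpos i hiK)
  · refine hneg (hroot _ _) (hmemK e _ hi) ?_
    have hi' := hi
    rw [← colorClass_union (ε := ε) (J := K) (e + Nat.find hex), Finset.mem_union] at hi'
    rcases hi' with h | h
    · rw [hsame e _ h]
      exact mul_nonpos_of_nonpos_of_nonneg hN (hxpos i hi).le
    · rw [hother e _ h]
      have := hlt (Nat.find hex - 1) (by omega)
      rw [show Nat.find hex - 1 + 1 = Nat.find hex by omega] at this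
      exact mul_nonpos_of_nonpos_of_nonneg (by linarith) (hxpos i hi).le

section Enumeration

variable {N : ℕ} (hN1 : ∀ e k, k < N → ∀ i ∈ colorClass ε K (e + k),
      0 ≤ cs.geomRep (cs.zigzag ε J e k) (simpleRoot i))
    (hN2 : ∀ e, ∀ i ∈ K, cs.geomRep (cs.zigzag ε J e N) (simpleRoot i) ≤ 0)

omit hε hKJ hKo [Fintype W] in
include hN2 in
private lemma geomRep_zigzag_nonpos (e : ℕ) {v : B → ℝ} (hv : v ∈ coordSpace K) (h0 : 0 ≤ v) :
    cs.geomRep (cs.zigzag ε J e N) v ≤ 0 := by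
  rw [eq_sum_simpleRoot_of_mem hv, map_sum]
  refine Finset.sum_nonpos fun i hi => ?_
  rw [map_smul]
  exact smul_nonpos_of_nonneg_of_nonpos (h0 i) (hN2 e i hi)

include hN2 in
private lemma exists_zigzag_eq (e : ℕ) {γ : B → ℝ} (hγ : γ ∈ cs.rootsIn K) (h0 : 0 ≤ γ) :
    ∃ k < N, ∃ i ∈ colorClass ε K (e + k),
      cs.geomRep (cs.zigzag ε J e k) (simpleRoot i) = γ := by
  classical
  have hmem (k : ℕ) : cs.geomRep (cs.zigzag ε J e k)⁻¹ γ ∈ cs.rootsIn K := by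
    rw [mem_rootsIn] at *
    refine ⟨cs.geomRep_mem_roots hγ.1 _, ?_⟩
    induction k with
    | zero => simpa using hγ.2
    | succ k ih =>
      rw [zigzag_succ, mul_inv_rev, cs.layer_inv hε, geomRep_mul]
      exact cs.geomRep_layer_mem hε hKJ hKo _ ih
  have hex : ∃ k, ¬0 ≤ cs.geomRep (cs.zigzag ε J e k)⁻¹ γ := by
    refine ⟨N, fun h => ?_⟩
    have h1 := cs.geomRep_zigzag_nonpos hN2 e (cs.mem_rootsIn.1 (hmem N)).2 h
    rw [geomRep_self_inv] at h1
    exact cs.root_not_nonneg_and_nonpos (cs.mem_rootsIn.1 hγ).1 h0 h1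
  have hne : Nat.find hex ≠ 0 := fun h => by
    have := Nat.find_spec hex
    rw [h] at this
    simp [h0] at this
  obtain ⟨k, hk⟩ := Nat.exists_eq_succ_of_ne_zero hne
  have hkpos : 0 ≤ cs.geomRep (cs.zigzag ε J e k)⁻¹ γ := by
    by_contra hcon
    have := Nat.find_min' hex hcon
    omega
  have hkneg := Nat.find_spec hex
  rw [hk, Nat.succ_eq_add_one, zigzag_succ, mul_inv_rev, cs.layer_inv hε, geomRep_mul] at hkneg
  have hkN : k < N := by
    have : Nat.find hex ≤ N := Nat.find_min' hex fun h => by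
      have h1 := cs.geomRep_zigzag_nonpos hN2 e (cs.mem_rootsIn.1 (hmem N)).2 h
      rw [geomRep_self_inv] at h1
      exact cs.root_not_nonneg_and_nonpos (cs.mem_rootsIn.1 hγ).1 h0 h1
    omega
  have hi : ∃ i ∈ colorClass ε J (e + k),
      cs.geomRep (cs.zigzag ε J e k)⁻¹ γ = simpleRoot i := by
    by_contra! hcon
    exact hkneg (cs.geomRep_layer_nonneg hε (cs.mem_rootsIn.1 (hmem k)).1 hkpos hcon)
  obtain ⟨i, hi, hγi⟩ := hi
  have hiK : i ∈ K := by
    by_contra hcon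
    have := (cs.mem_rootsIn.1 (hmem k)).2 i hcon
    rw [hγi] at this
    simp at this
  refine ⟨k, hkN, i, mem_colorClass.2 ⟨hiK, (mem_colorClass.1 hi).2⟩, ?_⟩
  rw [← hγi, geomRep_self_inv]

omit [Fintype W] hKo in
include hN1 in
private lemma zigzag_injective (e : ℕ) {k l : ℕ} (hkl : k ≤ l) (hl : l < N) {i j : B}
    (hi : i ∈ colorClass ε K (e + k)) (hj : j ∈ colorClass ε K (e + l))
    (h : cs.geomRep (cs.zigzag ε J e k) (simpleRoot i) =
      cs.geomRep (cs.zigzag ε J e l) (simpleRoot j)) : k = l ∧ i = j := by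
  obtain ⟨d, rfl⟩ := Nat.exists_eq_add_of_le hkl
  rw [zigzag_add, geomRep_mul] at h
  have h1 : simpleRoot i = cs.geomRep (cs.zigzag ε J (e + k) d) (simpleRoot j) := by
    rw [← cs.geomRep_inv_self (cs.zigzag ε J e k) (simpleRoot i), h, geomRep_inv_self]
  cases d with
  | zero =>
    refine ⟨rfl, ?_⟩
    rw [zigzag_zero, geomRep_one] at h1
    by_contra hij
    have := congrFun h1 i
    simp [hij] at this
  | succ d =>
    exfalso
    rw [add_comm d 1, zigzag_add, geomRep_mul, zigzag_succ, zigzag_zero, one_mul, add_zero] at h1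
    have hiJ : i ∈ colorClass ε J (e + k) :=
      mem_colorClass.2 ⟨hKJ (mem_colorClass.1 hi).1, (mem_colorClass.1 hi).2⟩
    have h2 := congrArg (cs.geomRep (cs.layer ε J (e + k))) h1
    rw [← geomRep_mul _ (cs.layer ε J (e + k)) (cs.layer ε J (e + k)), cs.layer_mul_self hε,
      geomRep_one, cs.geomRep_layer_simpleRoot hε hiJ] at h2
    have h3 := hN1 (e + k + 1) d (by omega) j (by
      rwa [show e + k + 1 + d = e + (k + (d + 1)) by ring])
    rw [← h2] at h3
    have := h3 i
    simp at this
    linarith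

include hN1 hN2

open Classical in
private lemma sum_pos_roots (e : ℕ) (g : (B → ℝ) → ℝ) :
    ∑ γ ∈ cs.rootsIn K with 0 ≤ γ, g γ =
      ∑ k ∈ Finset.range N, ∑ i ∈ colorClass ε K (e + k),
        g (cs.geomRep (cs.zigzag ε J e k) (simpleRoot i)) := by
  rw [Finset.sum_sigma']
  refine (Finset.sum_bij (fun p _ => cs.geomRep (cs.zigzag ε J e p.1) (simpleRoot p.2))
    ?_ ?_ ?_ fun _ _ => rfl).symm
  · rintro ⟨k, i⟩ h
    rw [Finset.mem_sigma, Finset.mem_range] at h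
    rw [Finset.mem_filter, mem_rootsIn]
    exact ⟨⟨cs.mem_roots.2 ⟨_, _, rfl⟩, cs.geomRep_zigzag_mem hε hKJ hKo _ _
      (simpleRoot_mem_coordSpace (mem_colorClass.1 h.2).1)⟩, hN1 e k h.1 i h.2⟩
  · rintro ⟨k, i⟩ h ⟨l, j⟩ h' heq
    rw [Finset.mem_sigma, Finset.mem_range] at h h'
    rcases le_total k l with hkl | hkl
    · obtain ⟨rfl, rfl⟩ := cs.zigzag_injective hε hKJ hN1 e hkl h'.1 h.2 h'.2 heq
      rfl
    · obtain ⟨rfl, rfl⟩ := cs.zigzag_injective hε hKJ hN1 e hkl h.1 h'.2 h.2 heq.symm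
      rfl
  · intro γ hγ
    rw [Finset.mem_filter] at hγ
    obtain ⟨k, hk, i, hi, rfl⟩ := cs.exists_zigzag_eq hε hKJ hKo hN2 e hγ.1 hγ.2
    exact ⟨⟨k, i⟩, Finset.mem_sigma.2 ⟨Finset.mem_range.2 hk, hi⟩, rfl⟩

private lemma sum_roots_zigzag (g : (B → ℝ) → ℝ) :
    ∑ γ ∈ cs.rootsIn K, g γ = ∑ k ∈ Finset.range (2 * N), ∑ i ∈ colorClass ε K k,
        g (cs.geomRep (cs.zigzag ε J 0 k) (simpleRoot i)) := by
  classical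
  have hzmem (k : ℕ) {γ : B → ℝ} (hγ : γ ∈ cs.rootsIn K) :
      cs.geomRep (cs.zigzag ε J 0 k) γ ∈ cs.rootsIn K := by
    rw [mem_rootsIn] at *
    exact ⟨cs.geomRep_mem_roots hγ.1 _, cs.geomRep_zigzag_mem hε hKJ hKo _ _ hγ.2⟩
  have hneg : ∑ γ ∈ cs.rootsIn K with ¬0 ≤ γ, g γ =
      ∑ γ ∈ cs.rootsIn K with 0 ≤ γ, g (cs.geomRep (cs.zigzag ε J 0 N) γ) := by
    symm
    refine Finset.sum_bij (fun γ _ => cs.geomRep (cs.zigzag ε J 0 N) γ) ?_ ?_ ?_ fun _ _ => rfl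
    · intro γ hγ
      rw [Finset.mem_filter] at *
      refine ⟨hzmem N hγ.1, fun h => ?_⟩
      exact cs.root_not_nonneg_and_nonpos (cs.mem_rootsIn.1 (hzmem N hγ.1)).1 h
        (cs.geomRep_zigzag_nonpos hN2 0 (cs.mem_rootsIn.1 hγ.1).2 hγ.2)
    · intro γ _ δ _ h
      rw [← cs.geomRep_inv_self (cs.zigzag ε J 0 N) γ, h, geomRep_inv_self]
    · intro γ hγ
      rw [Finset.mem_filter] at hγ
      have hfin : ∀ w : W, (∀ δ ∈ cs.rootsIn K, cs.geomRep w δ ∈ cs.rootsIn K) →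
          ∃ δ ∈ cs.rootsIn K, cs.geomRep w δ = γ := fun w hw => by
        have := Finset.surjOn_of_injOn_of_card_le (s := cs.rootsIn K) (t := cs.rootsIn K)
          (cs.geomRep w) hw (fun δ _ δ' _ h => by
            rw [← cs.geomRep_inv_self w δ, h, geomRep_inv_self]) le_rfl
        exact this hγ.1
      obtain ⟨δ, hδ, rfl⟩ := hfin _ fun δ hδ => hzmem N hδ
      refine ⟨δ, Finset.mem_filter.2 ⟨hδ, ?_⟩, rfl⟩
      by_contra hcon
      refine hγ.2 ?_
      have h1 := cs.root_nonpos_of_not_nonneg (cs.mem_rootsIn.1 hδ).1 hcon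
      have h2 := cs.geomRep_zigzag_nonpos hN2 0
        (Submodule.neg_mem _ (cs.mem_rootsIn.1 hδ).2) (neg_nonneg.2 h1)
      rw [map_neg] at h2
      exact neg_nonpos.1 h2
  rw [← Finset.sum_filter_add_sum_filter_not _ (fun γ => 0 ≤ γ), hneg,
    cs.sum_pos_roots hε hKJ hKo hN1 hN2 0,
    cs.sum_pos_roots hε hKJ hKo hN1 hN2 N (fun γ => g (cs.geomRep (cs.zigzag ε J 0 N) γ)),
    two_mul, Finset.sum_range_add]
  congr 1
  · simp only [zero_add]
  · refine Finset.sum_congr rfl fun k _ => Finset.sum_congr rfl fun i _ => ?_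
    rw [← geomRep_mul, zigzag_add, zero_add]

end Enumeration

omit hε hKJ hKo in
private lemma sum_range_two_mul (f : ℕ → ℝ) (n : ℕ) :
    ∑ k ∈ Finset.range (2 * n), f k =
      ∑ m ∈ Finset.range n, (f (2 * m) + f (2 * m + 1)) := by
  induction n with
  | zero => simp
  | succ n ih =>
    rw [mul_add, mul_one, Finset.sum_range_succ, Finset.sum_range_succ, ih,
      Finset.sum_range_succ]
    ring

include hK in
/-- The roots of a connected component are enumerated by the powers of the bipartite Coxeter
element applied to one root for each vertex. -/
theorem exists_coxeter_number : ∃ N : ℕ, 0 < N ∧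
    (∀ g : (B → ℝ) → ℝ, ∑ γ ∈ cs.rootsIn K, g γ = ∑ m ∈ Finset.range N,
      (∑ i ∈ colorClass ε K 0, g (cs.geomRep (cs.bipartiteCoxeter ε J ^ m) (simpleRoot i)) +
        ∑ i ∈ colorClass ε K 1, g (cs.geomRep (cs.bipartiteCoxeter ε J ^ m)
          (cs.geomRep (cs.layer ε J 0) (simpleRoot i))))) ∧
    (K = Finset.univ → cs.bipartiteCoxeter ε J ^ N = 1) := by
  obtain ⟨N, hN, hN1, hN2⟩ := cs.exists_zigzag_sign hε hKJ hKo hK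
  refine ⟨N, hN, fun g => ?_, fun hKu => ?_⟩
  · rw [cs.sum_roots_zigzag hε hKJ hKo hN1 hN2 g, sum_range_two_mul]
    refine Finset.sum_congr rfl fun m _ => ?_
    have h0 : colorClass ε K (2 * m) = colorClass ε K 0 := by
      ext i; simp [mem_colorClass]
    have h1 : colorClass ε K (2 * m + 1) = colorClass ε K 1 := by
      ext i; simp [mem_colorClass]
    rw [h0, h1]
    simp only [zigzag_zero_two_mul, zigzag_zero_two_mul_add_one, geomRep_mul]
  · rw [← zigzag_zero_two_mul, two_mul, zigzag_add]
    refine cs.eq_one_of_nonneg fun i => ?_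
    rw [geomRep_mul]
    have hi : i ∈ K := hKu ▸ Finset.mem_univ i
    have h2 := cs.geomRep_zigzag_nonpos hN2 0 (Submodule.neg_mem _
      (cs.geomRep_zigzag_mem hε hKJ hKo (0 + N) N (simpleRoot_mem_coordSpace hi)))
      (neg_nonneg.2 (hN2 (0 + N) i hi))
    rw [map_neg] at h2
    exact neg_nonpos.1 h2

end Component

end CoxeterSystem

namespace CoxeterSystem

open CoxeterMatrix

variable {B W : Type*} [Group W] {M : CoxeterMatrix B} (cs : CoxeterSystem M W)
  [Fintype B] [DecidableEq B] [Fintype W]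

section Schur

variable {K : Finset B}

/-- Weighted sums of roots over a connected component are multiples of the simple roots. -/
private lemma exists_sum_rootsIn_simpleRoot (hK : M.IsConn K) : ∃ H : ℝ, ∀ i ∈ K,
    ∑ γ ∈ cs.rootsIn K, M.form γ (simpleRoot i) • γ = H • simpleRoot i := by
  classical
  set h : B → ℝ := fun i =>
    M.form (simpleRoot i) (∑ γ ∈ cs.rootsIn K, M.form γ (simpleRoot i) • γ) with hh
  have h1 : ∀ i ∈ K, ∑ γ ∈ cs.rootsIn K, M.form γ (simpleRoot i) • γ = h i • simpleRoot i := by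
    intro i hi
    set a := ∑ γ ∈ cs.rootsIn K, M.form γ (simpleRoot i) • γ with ha
    have h2 : cs.geomRep (cs.simple i) a = -a := by
      rw [ha, map_sum, ← Finset.sum_neg_distrib,
        ← cs.sum_rootsIn_geomRep (cs.simple_mem_parabolicSubgroup hi)
          (fun γ => -(M.form γ (simpleRoot i) • γ))]
      refine Finset.sum_congr rfl fun γ _ => ?_
      rw [form_geomRep_left, inv_simple, geomRep_simple_self, map_smul, map_neg, neg_smul, neg_neg]
    rw [geomRep_simple] at h2
    have h3 : (2 : ℝ) • a = (2 : ℝ) • (h i • simpleRoot i) := by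
      rw [smul_smul, two_smul]
      exact (sub_eq_zero.1 (by rw [sub_eq_iff_eq_add] at h2; nth_rw 1 [h2]; abel))
    exact smul_right_injective _ two_ne_zero h3
  have hsymm : ∀ i ∈ K, ∀ j ∈ K, h i * M.cosEntry i j = h j * M.cosEntry i j := by
    intro i hi j hj
    have e (i j : B) (hi : i ∈ K) : h i * M.cosEntry i j =
        ∑ γ ∈ cs.rootsIn K, M.form γ (simpleRoot i) * M.form γ (simpleRoot j) := by
      rw [← form_simpleRoot, ← smul_eq_mul, ← LinearMap.smul_apply, ← map_smul, ← h1 i hi, map_sum,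
        LinearMap.sum_apply]
      exact Finset.sum_congr rfl fun γ _ => by rw [map_smul, LinearMap.smul_apply, smul_eq_mul]
    rw [e i j hi, M.cosEntry_comm i j, e j i hj]
    exact Finset.sum_congr rfl fun γ _ => mul_comm _ _
  obtain ⟨i₀, hi₀⟩ := hK.1
  have hL : K.filter (fun j => h j = h i₀) = K := by
    refine hK.2 _ (Finset.filter_subset _ _) ⟨i₀, Finset.mem_filter.2 ⟨hi₀, rfl⟩⟩ ?_
    intro i hi j hj
    rw [Finset.mem_filter] at hi
    rw [Finset.mem_sdiff, Finset.mem_filter, not_and] at hj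
    by_contra hne
    exact hj.2 hj.1 ((mul_right_cancel₀ hne (hsymm i hi.1 j hj.1)).symm.trans hi.2)
  refine ⟨h i₀, fun i hi => ?_⟩
  rw [← hL] at hi
  rw [h1 i (Finset.mem_filter.1 hi).1, (Finset.mem_filter.1 hi).2]

private lemma sum_rootsIn_simpleRoot (hK : M.IsConn K) {N : ℕ}
    (hN : (cs.rootsIn K).card = N * K.card) {i : B} (hi : i ∈ K) :
    ∑ γ ∈ cs.rootsIn K, M.form γ (simpleRoot i) • γ = (N : ℝ) • simpleRoot i := by
  obtain ⟨H, hH⟩ := cs.exists_sum_rootsIn_simpleRoot hK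
  suffices H = N by rw [← this, hH i hi]
  have h1 : ∑ j ∈ K, ∑ γ ∈ cs.rootsIn K, M.form γ (simpleRoot j) * γ j = ∑ j ∈ K, H := by
    refine Finset.sum_congr rfl fun j hj => ?_
    have := congrFun (hH j hj) j
    simpa using this
  rw [Finset.sum_comm, Finset.sum_const, nsmul_eq_mul] at h1
  have h2 : ∀ γ ∈ cs.rootsIn K, ∑ j ∈ K, M.form γ (simpleRoot j) * γ j = 1 := by
    intro γ hγ
    rw [mem_rootsIn] at hγ
    rw [← cs.form_root_self hγ.1, form_eq_sum_of_mem M hγ.2]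
    exact Finset.sum_congr rfl fun j _ => by rw [form_comm, mul_comm]
  rw [Finset.sum_congr rfl h2, Finset.sum_const, nsmul_eq_mul, mul_one, hN] at h1
  have h3 : (K.card : ℝ) ≠ 0 := by
    exact_mod_cast (Finset.card_pos.2 hK.1).ne'
  push_cast at h1
  exact mul_left_cancel₀ h3 (by linarith)

end Schur

variable {ε : B → Bool} (hε : M.IsColoring ε)
include hε

omit [Fintype W] in
private lemma simple_mul_bipartiteCoxeter {J : Finset B} {i : B} (hi : i ∈ colorClass ε J 0) :
    cs.simple i * cs.bipartiteCoxeter ε J = cs.bipartiteCoxeter ε (J.erase i) := by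
  have hi1 : i ∉ colorClass ε J 1 := Finset.disjoint_left.1 (disjoint_colorClass 0) hi
  rw [bipartiteCoxeter, bipartiteCoxeter, cs.layer_eq_simple_mul_layer_erase hε hi,
    cs.layer_erase_of_notMem hi1, mul_assoc, simple_mul_simple_cancel_left]

private lemma reflOf_layer_mul_bipartiteCoxeter {J : Finset B} {i : B}
    (hi : i ∈ colorClass ε J 1) :
    cs.reflOf (cs.geomRep (cs.layer ε J 0) (simpleRoot i)) * cs.bipartiteCoxeter ε J =
      cs.bipartiteCoxeter ε (J.erase i) := by
  have hi0 : i ∉ colorClass ε J 0 := fun h => Finset.disjoint_left.1 (disjoint_colorClass 0) h hi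
  rw [reflOf_geomRep_simpleRoot, bipartiteCoxeter, bipartiteCoxeter,
    cs.layer_eq_simple_mul_layer_erase hε hi, cs.layer_erase_of_notMem hi0, mul_assoc,
    inv_mul_cancel_left, mul_assoc, simple_mul_simple_cancel_left]

omit hε in
private lemma reflOf_pow_mul_bipartiteCoxeter {f : W → ℝ} (hf : ∀ g w, f (g * w * g⁻¹) = f w)
    {J : Finset B} (m : ℕ) {γ : B → ℝ} (hγ : γ ∈ cs.roots) :
    f (cs.reflOf (cs.geomRep (cs.bipartiteCoxeter ε J ^ m) γ) * cs.bipartiteCoxeter ε J) =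
      f (cs.reflOf γ * cs.bipartiteCoxeter ε J) := by
  rw [cs.reflOf_geomRep hγ, ← hf (cs.bipartiteCoxeter ε J ^ m) (cs.reflOf γ * _)]
  congr 1
  have := (Commute.refl (cs.bipartiteCoxeter ε J)).pow_left m
  rw [mul_assoc, mul_assoc, mul_assoc, mul_assoc, this.inv_left.eq]

private lemma sum_class_component {J K : Finset B} (hKJ : K ⊆ J) {N : ℕ}
    (hN : ∀ g : (B → ℝ) → ℝ, ∑ γ ∈ cs.rootsIn K, g γ = ∑ m ∈ Finset.range N,
      (∑ i ∈ colorClass ε K 0, g (cs.geomRep (cs.bipartiteCoxeter ε J ^ m) (simpleRoot i)) +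
        ∑ i ∈ colorClass ε K 1, g (cs.geomRep (cs.bipartiteCoxeter ε J ^ m)
          (cs.geomRep (cs.layer ε J 0) (simpleRoot i)))))
    {f : W → ℝ} (hf : ∀ g w, f (g * w * g⁻¹) = f w) :
    ∑ γ ∈ cs.rootsIn K, f (cs.reflOf γ * cs.bipartiteCoxeter ε J) =
      N * ∑ s ∈ K, f (cs.bipartiteCoxeter ε (J.erase s)) := by
  have hcol {m : ℕ} {i : B} (hi : i ∈ colorClass ε K m) : i ∈ colorClass ε J m :=
    mem_colorClass.2 ⟨hKJ (mem_colorClass.1 hi).1, (mem_colorClass.1 hi).2⟩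
  rw [hN, ← sum_colorClass_add (ε := ε) 0 fun s => f (cs.bipartiteCoxeter ε (J.erase s)),
    ← nsmul_eq_mul, ← Finset.card_range N, ← Finset.sum_const, Finset.card_range]
  refine Finset.sum_congr rfl fun m _ => ?_
  congr 1
  · refine Finset.sum_congr rfl fun i hi => ?_
    rw [cs.reflOf_pow_mul_bipartiteCoxeter hf m (cs.simpleRoot_mem_roots i),
      reflOf_simpleRoot, cs.simple_mul_bipartiteCoxeter hε (hcol hi)]
  · refine Finset.sum_congr rfl fun i hi => ?_
    rw [cs.reflOf_pow_mul_bipartiteCoxeter hf m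
      (cs.geomRep_mem_roots (cs.simpleRoot_mem_roots i) _),
      cs.reflOf_layer_mul_bipartiteCoxeter hε (hcol hi)]

omit hε in
private lemma orderOf_eq_coxeter_number {N : ℕ} (hN0 : 0 < N) (hB : Nonempty B)
    (hN : ∀ g : (B → ℝ) → ℝ, ∑ γ ∈ cs.rootsIn Finset.univ, g γ = ∑ m ∈ Finset.range N,
      (∑ i ∈ colorClass ε Finset.univ 0,
          g (cs.geomRep (cs.bipartiteCoxeter ε Finset.univ ^ m) (simpleRoot i)) +
        ∑ i ∈ colorClass ε Finset.univ 1, g (cs.geomRep (cs.bipartiteCoxeter ε Finset.univ ^ m)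
          (cs.geomRep (cs.layer ε Finset.univ 0) (simpleRoot i)))))
    (hpow : cs.bipartiteCoxeter ε Finset.univ ^ N = 1) :
    orderOf (cs.bipartiteCoxeter ε Finset.univ) = N := by
  classical
  set c := cs.bipartiteCoxeter ε Finset.univ with hc
  refine le_antisymm (orderOf_le_of_pow_eq_one hN0 hpow) (not_lt.1 fun hlt => ?_)
  obtain ⟨i⟩ := hB
  obtain ⟨β, hβ, hβ'⟩ : ∃ β ∈ cs.roots, (i ∈ colorClass ε Finset.univ 0 ∧ β = simpleRoot i) ∨
      (i ∈ colorClass ε Finset.univ 1 ∧ β = cs.geomRep (cs.layer ε Finset.univ 0)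
        (simpleRoot i)) := by
    have hi := Finset.mem_univ i
    rw [← colorClass_union (ε := ε) (J := Finset.univ) 0, Finset.mem_union] at hi
    rcases hi with h | h
    · exact ⟨_, cs.simpleRoot_mem_roots i, Or.inl ⟨h, rfl⟩⟩
    · exact ⟨_, cs.geomRep_mem_roots (cs.simpleRoot_mem_roots i) _, Or.inr ⟨h, rfl⟩⟩
  set g : (B → ℝ) → ℝ := fun γ => if γ = β then 1 else 0 with hg
  have hg0 : ∀ γ, 0 ≤ g γ := fun γ => by rw [hg]; dsimp only; split_ifs <;> norm_num
  set G : ℕ → ℝ := fun m =>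
    (∑ i ∈ colorClass ε Finset.univ 0, g (cs.geomRep (c ^ m) (simpleRoot i)) +
        ∑ i ∈ colorClass ε Finset.univ 1, g (cs.geomRep (c ^ m)
          (cs.geomRep (cs.layer ε Finset.univ 0) (simpleRoot i)))) with hG
  have hGnn : ∀ m, 0 ≤ G m := fun m =>
    add_nonneg (Finset.sum_nonneg fun _ _ => hg0 _) (Finset.sum_nonneg fun _ _ => hg0 _)
  have hG0 : 1 ≤ G 0 := by
    have hgβ : g β = 1 := if_pos rfl
    rw [← hgβ, hG]
    simp only [pow_zero, geomRep_one]
    rcases hβ' with ⟨hi, h⟩ | ⟨hi, h⟩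
    · refine le_add_of_le_of_nonneg ?_ (Finset.sum_nonneg fun _ _ => hg0 _)
      conv_lhs => rw [h]
      exact Finset.single_le_sum (f := fun j => g (simpleRoot j)) (fun _ _ => hg0 _) hi
    · refine le_add_of_nonneg_of_le (Finset.sum_nonneg fun _ _ => hg0 _) ?_
      conv_lhs => rw [h]
      exact Finset.single_le_sum
        (f := fun j => g (cs.geomRep (cs.layer ε Finset.univ 0) (simpleRoot j)))
        (fun _ _ => hg0 _) hi
  have hGd : G (orderOf c) = G 0 := by
    rw [hG]
    simp only [pow_orderOf_eq_one, pow_zero]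
  have hsum : ∑ γ ∈ cs.rootsIn Finset.univ, g γ = 1 := by
    rw [rootsIn_univ, hg, Finset.sum_ite_eq' cs.roots β fun _ => (1 : ℝ), if_pos hβ]
  have hle : G 0 + G (orderOf c) ≤ ∑ m ∈ Finset.range N, G m :=
    Finset.add_le_sum (fun m _ => hGnn m) (Finset.mem_range.2 hN0) (Finset.mem_range.2 hlt)
      (orderOf_pos c).ne
  rw [hN g] at hsum
  linarith

/-- The two consequences of the enumeration of roots, for a connected component `K` of `J`. -/
private lemma exists_component_number {J K : Finset B} (hKJ : K ⊆ J) (hKo : M.IsOrtho K (J \ K))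
    (hK : M.IsConn K) : ∃ N : ℕ,
    (∀ f : W → ℝ, (∀ g w, f (g * w * g⁻¹) = f w) →
      ∑ γ ∈ cs.rootsIn K, f (cs.reflOf γ * cs.bipartiteCoxeter ε J) =
        N * ∑ s ∈ K, f (cs.bipartiteCoxeter ε (J.erase s))) ∧
    (∀ s ∈ K, ∀ j ∈ J,
      ∑ γ ∈ cs.rootsIn K, M.form γ (simpleRoot j) * γ s = if j = s then (N : ℝ) else 0) ∧
    (K = Finset.univ → orderOf (cs.bipartiteCoxeter ε J) = N) := by
  obtain ⟨N, hN0, hN, hpow⟩ := cs.exists_coxeter_number hε hKJ hKo hK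
  refine ⟨N, fun f hf => cs.sum_class_component hε hKJ hN hf, fun s hs j hj => ?_, fun hu => ?_⟩
  · have hcard : (cs.rootsIn K).card = N * K.card := by
      have := hN fun _ => 1
      rw [Finset.sum_const, Finset.sum_const, Finset.card_range,
        sum_colorClass_add (ε := ε) 0 fun _ => (1 : ℝ), Finset.sum_const] at this
      simp only [nsmul_eq_mul, mul_one] at this
      exact_mod_cast this
    by_cases hjK : j ∈ K
    · have := congrFun (cs.sum_rootsIn_simpleRoot hK hcard hjK) s
      simp only [Finset.sum_apply, Pi.smul_apply, smul_eq_mul, Pi.single_apply] at this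
      rw [this]
      simp [eq_comm]
    · rw [if_neg fun h : j = s => hjK (h ▸ hs)]
      refine Finset.sum_eq_zero fun γ hγ => ?_
      rw [hKo.form_eq_zero (cs.mem_rootsIn.1 hγ).2
        (simpleRoot_mem_coordSpace (Finset.mem_sdiff.2 ⟨hj, hjK⟩)), zero_mul]
  · subst hu
    obtain rfl := Finset.univ_subset_iff.1 hKJ
    exact cs.orderOf_eq_coxeter_number hN0 hK.1.to_type hN (hpow rfl)

private lemma exists_coxeter_numbers_of_isOrtho {J : Finset B} (n : ℕ) {L : Finset B}
    (hn : L.card = n) (hLJ : L ⊆ J) (hLo : M.IsOrtho L (J \ L)) : ∃ h : B → ℝ,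
    (∀ f : W → ℝ, (∀ g w, f (g * w * g⁻¹) = f w) →
      ∑ γ ∈ cs.rootsIn L, f (cs.reflOf γ * cs.bipartiteCoxeter ε J) =
        ∑ s ∈ L, h s * f (cs.bipartiteCoxeter ε (J.erase s))) ∧
    ∀ s ∈ L, ∀ j ∈ J,
      ∑ γ ∈ cs.rootsIn L, M.form γ (simpleRoot j) * γ s = if j = s then h s else 0 := by
  induction n using Nat.strong_induction_on generalizing L with
  | _ n ih =>
  rcases L.eq_empty_or_nonempty with rfl | hne
  · exact ⟨0, by simp [rootsIn_empty]⟩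
  by_cases hconn : M.IsConn L
  · obtain ⟨N, h1, h2, -⟩ := cs.exists_component_number hε hLJ hLo hconn
    exact ⟨fun _ => N, fun f hf => by rw [h1 f hf, Finset.mul_sum], h2⟩
  · obtain ⟨K, hKL, hKne, hKo, hKL'⟩ : ∃ K ⊆ L, K.Nonempty ∧ M.IsOrtho K (L \ K) ∧ K ≠ L := by
      by_contra! hcon
      exact hconn ⟨hne, fun K h1 h2 h3 => hcon K h1 h2 h3⟩
    have hKL2 : L \ K ⊆ L := Finset.sdiff_subset
    have hcard := Finset.card_sdiff_add_card_eq_card hKL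
    have hKpos := Finset.card_pos.2 hKne
    have hKlt := Finset.card_lt_card (hKL.ssubset_of_ne hKL')
    have hKJo : M.IsOrtho K (J \ K) := fun i hi j hj => by
      rw [Finset.mem_sdiff] at hj
      by_cases hjL : j ∈ L
      · exact hKo i hi j (Finset.mem_sdiff.2 ⟨hjL, hj.2⟩)
      · exact hLo i (hKL hi) j (Finset.mem_sdiff.2 ⟨hj.1, hjL⟩)
    have hKJo' : M.IsOrtho (L \ K) (J \ (L \ K)) := fun i hi j hj => by
      rw [Finset.mem_sdiff, Finset.mem_sdiff] at hj
      by_cases hjK : j ∈ K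
      · exact hKo.symm i hi j hjK
      · exact hLo i (hKL2 hi) j (Finset.mem_sdiff.2 ⟨hj.1, fun hjL => hj.2 ⟨hjL, hjK⟩⟩)
    obtain ⟨h, hF, hS⟩ := ih _ (by omega) rfl (hKL.trans hLJ) hKJo
    obtain ⟨h', hF', hS'⟩ := ih _ (by omega) rfl (hKL2.trans hLJ) hKJo'
    have hsplit := fun g : (B → ℝ) → ℝ => cs.sum_rootsIn_union Finset.disjoint_sdiff hKo g
    rw [Finset.union_sdiff_of_subset hKL] at hsplit
    refine ⟨fun s => if s ∈ K then h s else h' s, fun f hf => ?_, fun s hs j hj => ?_⟩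
    · rw [hsplit fun γ => f (cs.reflOf γ * cs.bipartiteCoxeter ε J), hF f hf, hF' f hf,
        ← Finset.sum_sdiff hKL, add_comm]
      congr 1
      · exact Finset.sum_congr rfl fun s hs => by dsimp only; rw [if_neg (Finset.mem_sdiff.1 hs).2]
      · exact Finset.sum_congr rfl fun s hs => by dsimp only; rw [if_pos hs]
    · rw [hsplit fun γ => M.form γ (simpleRoot j) * γ s]
      by_cases hsK : s ∈ K
      · simp only [hS s hsK j hj, if_pos hsK, add_eq_left]
        refine Finset.sum_eq_zero fun γ hγ => ?_
        rw [(cs.mem_rootsIn.1 hγ).2 s fun h => (Finset.mem_sdiff.1 h).2 hsK, mul_zero]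
      · simp only [hS' s (Finset.mem_sdiff.2 ⟨hs, hsK⟩) j hj, if_neg hsK, add_eq_right]
        refine Finset.sum_eq_zero fun γ hγ => ?_
        rw [(cs.mem_rootsIn.1 hγ).2 s hsK, mul_zero]

/-- Each vertex `s` of `J` has a number `h s`, the Coxeter number of its component, for which sums
of a class function over the Coxeter element times reflections reduce to smaller parabolics, and
which is the scalar by which the quadratic form of the roots acts. -/
theorem exists_coxeter_numbers (J : Finset B) : ∃ h : B → ℝ,
    (∀ f : W → ℝ, (∀ g w, f (g * w * g⁻¹) = f w) →
      ∑ γ ∈ cs.rootsIn J, f (cs.reflOf γ * cs.bipartiteCoxeter ε J) =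
        ∑ s ∈ J, h s * f (cs.bipartiteCoxeter ε (J.erase s))) ∧
    ∀ s ∈ J, ∀ v ∈ coordSpace J, ∑ γ ∈ cs.rootsIn J, M.form γ v * γ s = h s * v s := by
  obtain ⟨h, hF, hS⟩ := cs.exists_coxeter_numbers_of_isOrtho hε (J := J) _ rfl subset_rfl
    fun _ _ j hj => by simp at hj
  refine ⟨h, hF, fun s hs v hv => ?_⟩
  have h1 : ∀ γ : B → ℝ, M.form γ v * γ s = ∑ j ∈ J, v j * (M.form γ (simpleRoot j) * γ s) := by
    intro γ
    rw [form_comm, form_eq_sum_of_mem M hv, Finset.sum_mul]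
    exact Finset.sum_congr rfl fun j _ => by rw [form_comm, mul_assoc]
  simp_rw [h1]
  rw [Finset.sum_comm]
  simp_rw [← Finset.mul_sum]
  rw [Finset.sum_eq_single_of_mem s hs, hS s hs s hs, if_pos rfl, mul_comm]
  intro j hj hjs
  rw [hS s hs j hj, if_neg hjs, mul_zero]

/-- The scalar by which the quadratic form of the roots of an irreducible group acts is the order
of the Coxeter element. -/
theorem sum_roots_form_mul (hB : M.IsConn Finset.univ) (v : B → ℝ) (s : B) :
    ∑ γ ∈ cs.roots, M.form γ v * γ s =
      orderOf (cs.bipartiteCoxeter ε Finset.univ) * v s := by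
  obtain ⟨N, -, hS, hN⟩ := cs.exists_component_number hε subset_rfl
    (fun _ _ j hj => by simp at hj) hB
  rw [hN rfl, ← rootsIn_univ]
  have h1 : ∀ γ : B → ℝ, M.form γ v * γ s = ∑ j, v j * (M.form γ (simpleRoot j) * γ s) := by
    intro γ
    rw [form_comm, form_eq_sum, Finset.sum_mul]
    exact Finset.sum_congr rfl fun j _ => by rw [form_comm, mul_assoc]
  simp_rw [h1]
  rw [Finset.sum_comm]
  simp_rw [← Finset.mul_sum, hS s (Finset.mem_univ s) _ (Finset.mem_univ _)]
  simp [mul_comm]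

end CoxeterSystem

namespace CoxeterMatrix

variable {B : Type*} [Fintype B] [DecidableEq B] (M : CoxeterMatrix B)

/-- The determinant of the matrix of mutual products of two families of vectors. -/
noncomputable def crossGram {n : ℕ} (a b : Fin n → B → ℝ) : ℝ :=
  (Matrix.of fun i j => M.form (a i) (b j)).det

/-- The Gram determinant. -/
noncomputable def gram {n : ℕ} (a : Fin n → B → ℝ) : ℝ := M.crossGram a a

variable {M} {n : ℕ}

lemma crossGram_eq_mul {J : Finset B} (e : Fin n ≃ J) {a : Fin n → B → ℝ}
    (ha : ∀ i, a i ∈ coordSpace J) (b : Fin n → B → ℝ) :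
    M.crossGram a b = (Matrix.of fun i k => a i (e k)).det *
      (Matrix.of fun j k => M.form (b j) (simpleRoot (e k))).det := by
  rw [← Matrix.det_transpose (Matrix.of fun j k => M.form (b j) (simpleRoot (e k))),
    ← Matrix.det_mul, crossGram]
  congr 1
  ext i j
  simp only [Matrix.of_apply, Matrix.mul_apply, Matrix.transpose_apply]
  rw [form_eq_sum_of_mem M (ha i), ← Finset.sum_coe_sort J, ← e.sum_comp]
  exact Finset.sum_congr rfl fun k _ => by rw [M.form_comm (b j)]

lemma crossGram_sq {J : Finset B} (hJ : J.card = n) {a b : Fin n → B → ℝ}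
    (ha : ∀ i, a i ∈ coordSpace J) (hb : ∀ i, b i ∈ coordSpace J) :
    M.crossGram a b ^ 2 = M.gram a * M.gram b := by
  have e : Fin n ≃ J := (Fintype.equivFinOfCardEq (by rw [Fintype.card_coe, hJ])).symm
  have h (b : Fin n → B → ℝ) (hb : ∀ i, b i ∈ coordSpace J) :
      (Matrix.of fun j k => M.form (b j) (simpleRoot (e k))).det =
        (Matrix.of fun i k => b i (e k)).det *
          (Matrix.of fun j k => M.form (simpleRoot (e j)) (simpleRoot (e k))).det := by
    change M.crossGram b (fun k => simpleRoot (e k)) = _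
    rw [crossGram_eq_mul e hb]
  rw [gram, gram, crossGram_eq_mul e ha, crossGram_eq_mul e hb, crossGram_eq_mul e ha, h a ha,
    h b hb]
  ring

lemma crossGram_cons_cons {τ : Fin n → B → ℝ} {u : B → ℝ} (hu : ∀ i, M.form (τ i) u = 0)
    (γ : B → ℝ) :
    M.crossGram (Fin.cons γ τ) (Fin.cons u τ) = M.form γ u * M.gram τ := by
  rw [crossGram, Matrix.det_succ_column_zero, Fin.sum_univ_succ]
  simp [hu, gram, crossGram, Matrix.submatrix]

lemma gram_cons_mul {J : Finset B} (hJ : J.card = n + 1) {τ : Fin n → B → ℝ} {u γ : B → ℝ}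
    (hτJ : ∀ i, τ i ∈ coordSpace J) (huJ : u ∈ coordSpace J) (hγJ : γ ∈ coordSpace J)
    (hu : ∀ i, M.form (τ i) u = 0) (hτ : M.gram τ ≠ 0) :
    M.gram (Fin.cons γ τ) * M.form u u = M.form γ u ^ 2 * M.gram τ := by
  have h1 := crossGram_sq (M := M) hJ (a := Fin.cons γ τ) (b := Fin.cons u τ)
    (Fin.cases hγJ hτJ) (Fin.cases huJ hτJ)
  rw [crossGram_cons_cons hu, gram.eq_1 M (Fin.cons u τ), crossGram_cons_cons hu] at h1
  exact mul_right_cancel₀ hτ (by linear_combination -h1)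

lemma gram_eq_zero_of_sum_eq_zero {τ : Fin n → B → ℝ} {g : Fin n → ℝ} (hg : g ≠ 0)
    (h : ∑ i, g i • τ i = 0) : M.gram τ = 0 := by
  refine Matrix.exists_mulVec_eq_zero_iff.1 ⟨g, hg, ?_⟩
  ext i
  have : M.form (τ i) (∑ j, g j • τ j) = 0 := by rw [h, map_zero]
  rw [map_sum] at this
  simpa [Matrix.mulVec, dotProduct, mul_comm] using this

lemma linearIndependent_of_gram_ne_zero {τ : Fin n → B → ℝ} (h : M.gram τ ≠ 0) :
    LinearIndependent ℝ τ := by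
  rw [Fintype.linearIndependent_iff]
  intro g hg i
  by_contra hi
  exact h (gram_eq_zero_of_sum_eq_zero (fun h0 => hi (congrFun h0 i)) hg)

omit [Fintype B] [DecidableEq B] in
lemma finrank_coordSpace (J : Finset B) : Module.finrank ℝ (coordSpace J) = J.card := by
  classical
  let φ : coordSpace J ≃ₗ[ℝ] (J → ℝ) :=
    { toFun := fun v j => v.1 j
      map_add' := fun _ _ => rfl
      map_smul' := fun _ _ => rfl
      invFun := fun f => ⟨fun i => if h : i ∈ J then f ⟨i, h⟩ else 0, fun i hi => dif_neg hi⟩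
      left_inv := fun v => by
        ext i
        by_cases h : i ∈ J
        · simp [h]
        · simp [h, v.2 i h]
      right_inv := fun f => by ext ⟨i, hi⟩; simp [hi] }
  rw [φ.finrank_eq, Module.finrank_fintype_fun_eq_card, Fintype.card_coe]

omit [DecidableEq B] in
lemma span_eq_coordSpace {J : Finset B} (hJ : J.card = n) {τ : Fin n → B → ℝ}
    (hτJ : ∀ i, τ i ∈ coordSpace J) (h : LinearIndependent ℝ τ) :
    Submodule.span ℝ (Set.range τ) = coordSpace J := by
  refine Submodule.eq_of_le_of_finrank_eq (Submodule.span_le.2 ?_) ?_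
  · rintro _ ⟨i, rfl⟩
    exact hτJ i
  · rw [finrank_span_eq_card h, finrank_coordSpace, hJ, Fintype.card_fin]

omit [DecidableEq B] in
lemma card_le_of_linearIndependent {J : Finset B} {τ : Fin n → B → ℝ}
    (hτJ : ∀ i, τ i ∈ coordSpace J) (h : LinearIndependent ℝ τ) : n ≤ J.card := by
  rw [← finrank_coordSpace, ← Fintype.card_fin n, ← finrank_span_eq_card h]
  refine Submodule.finrank_mono (Submodule.span_le.2 ?_)
  rintro _ ⟨i, rfl⟩
  exact hτJ i

variable (M) in
lemma exists_form_eq_zero {J : Finset B} (hJ : n < J.card) (τ : Fin n → B → ℝ) :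
    ∃ u ∈ coordSpace J, u ≠ 0 ∧ ∀ i, M.form (τ i) u = 0 := by
  let φ : coordSpace J →ₗ[ℝ] (Fin n → ℝ) :=
    (LinearMap.pi fun i => M.form (τ i)).comp (coordSpace J).subtype
  have h : LinearMap.ker φ ≠ ⊥ := LinearMap.ker_ne_bot_of_finrank_lt (by
    rwa [finrank_coordSpace, Module.finrank_fin_fun])
  obtain ⟨u, hu, hu0⟩ := Submodule.exists_mem_ne_zero_of_ne_bot h
  refine ⟨u.1, u.2, fun h => hu0 (Subtype.ext h), fun i => ?_⟩
  exact congrFun (LinearMap.mem_ker.1 hu) i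

end CoxeterMatrix

namespace CoxeterSystem

open CoxeterMatrix

variable {B W : Type*} [Group W] {M : CoxeterMatrix B} (cs : CoxeterSystem M W)
  [Fintype B] [DecidableEq B] {n : ℕ}

lemma gram_geomRep (w : W) (τ : Fin n → B → ℝ) :
    M.gram (fun i => cs.geomRep w (τ i)) = M.gram τ := by
  simp only [gram, crossGram, form_geomRep]

include cs in
lemma gram_cons_eq_zero [Finite W] {τ : Fin n → B → ℝ} (h : M.gram τ = 0) (γ : B → ℝ) :
    M.gram (Fin.cons γ τ) = 0 := by
  obtain ⟨g, hg, hg'⟩ := Matrix.exists_mulVec_eq_zero_iff.2 h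
  have h0 : ∑ i, g i • τ i = 0 := by
    refine cs.eq_zero_of_form_self ?_
    have h1 (i : Fin n) : M.form (τ i) (∑ j, g j • τ j) = 0 := by
      have := congrFun hg' i
      rw [map_sum]
      simpa [Matrix.mulVec, dotProduct, mul_comm] using this
    rw [map_sum]
    refine Finset.sum_eq_zero fun i _ => ?_
    rw [map_smul, form_comm, h1, smul_zero]
  refine gram_eq_zero_of_sum_eq_zero (g := Fin.cons 0 g) (fun h => hg ?_) ?_
  · ext i
    simpa using congrFun h i.succ
  · simpa [Fin.sum_univ_succ] using h0

section Dominance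

lemma geomRep_apply_of_notMem {J : Finset B} {w : W} (hw : w ∈ cs.parabolicSubgroup J) {i : B}
    (hi : i ∉ J) (v : B → ℝ) : cs.geomRep w v i = v i := by
  induction hw using Subgroup.closure_induction generalizing v with
  | mem x hx =>
    obtain ⟨j, hj, rfl⟩ := hx
    exact cs.geomRep_simple_apply_of_ne (fun h : i = j => hi (h ▸ hj)) v
  | one => rw [geomRep_one]
  | mul x y _ _ hx hy => rw [geomRep_mul, hx, hy]
  | inv x _ hx => rw [← hx (cs.geomRep x⁻¹ v), geomRep_self_inv]

/-- A vector with nonnegative products with the simple roots of `J` is the only such vector in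
its orbit, and its stabiliser is a standard parabolic subgroup. -/
lemma eq_and_mem_of_dominant {J : Finset B} {u : B → ℝ}
    (hu : ∀ j ∈ J, 0 ≤ M.form (simpleRoot j) u) {w : W} (hw : w ∈ cs.parabolicSubgroup J)
    (hwu : ∀ j ∈ J, 0 ≤ M.form (simpleRoot j) (cs.geomRep w u)) {Z : Finset B}
    (hZ : ∀ j ∈ J, M.form (simpleRoot j) u = 0 → j ∈ Z) :
    cs.geomRep w u = u ∧ w ∈ cs.parabolicSubgroup Z := by
  induction hn : cs.length w using Nat.strong_induction_on generalizing w with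
  | _ n ih =>
  by_cases h1 : w = 1
  · subst h1
    exact ⟨cs.geomRep_one u, one_mem _⟩
  obtain ⟨i, hi⟩ : ∃ i, ¬0 ≤ cs.geomRep w (simpleRoot i) := by
    by_contra! h
    exact h1 (cs.eq_one_of_nonneg h)
  have hlt : cs.length (w * cs.simple i) < cs.length w := by
    by_contra hge
    refine hi (cs.geomRep_simpleRoot_nonneg (lt_of_le_of_ne (not_lt.1 hge) ?_))
    exact (cs.length_mul_simple_ne w i).symm
  have hneg := cs.geomRep_simpleRoot_nonpos hlt
  have hiJ : i ∈ J := by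
    by_contra hiJ
    have := hneg i
    rw [cs.geomRep_apply_of_notMem hw hiJ] at this
    simp at this
    linarith
  have hform : M.form (simpleRoot i) u = 0 := by
    refine le_antisymm ?_ (hu i hiJ)
    rw [← cs.form_geomRep w, form_eq_sum_of_mem M
      (cs.geomRep_mem hw (simpleRoot_mem_coordSpace hiJ))]
    exact Finset.sum_nonpos fun j hj => mul_nonpos_of_nonpos_of_nonneg (hneg j) (hwu j hj)
  have hsu : cs.geomRep (cs.simple i) u = u := by simp [geomRep_simple, hform]
  have hws : cs.geomRep (w * cs.simple i) u = cs.geomRep w u := by rw [geomRep_mul, hsu]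
  obtain ⟨h2, h3⟩ := ih _ (hn ▸ hlt) (mul_mem hw (cs.simple_mem_parabolicSubgroup hiJ))
    (by rwa [hws]) rfl
  refine ⟨hws ▸ h2, ?_⟩
  have := mul_mem h3 (cs.simple_mem_parabolicSubgroup (hZ i hiJ hform))
  rwa [simple_mul_simple_cancel_right] at this

lemma exists_dominant [Finite W] (J : Finset B) (u : B → ℝ) :
    ∃ w ∈ cs.parabolicSubgroup J, ∀ j ∈ J, 0 ≤ M.form (simpleRoot j) (cs.geomRep w u) := by
  obtain ⟨w, hw⟩ := Finite.exists_max fun w : cs.parabolicSubgroup J =>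
    ∑ i, cs.geomRep w.1 u i
  refine ⟨w.1, w.2, fun j hj => not_lt.1 fun hlt => ?_⟩
  have h := hw ⟨cs.simple j * w.1, mul_mem (cs.simple_mem_parabolicSubgroup hj) w.2⟩
  dsimp only at h
  rw [geomRep_mul, geomRep_simple] at h
  simp only [Pi.sub_apply, Pi.smul_apply, smul_eq_mul, Finset.sum_sub_distrib, ← Finset.mul_sum,
    Finset.sum_pi_single', Finset.mem_univ, if_true] at h
  linarith

lemma mem_coordSpace_of_form_dominant_eq_zero [Fintype W] {J Z : Finset B} {u : B → ℝ}
    (hu : ∀ j ∈ J, 0 ≤ M.form (simpleRoot j) u)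
    (hZ : ∀ j ∈ J, M.form (simpleRoot j) u = 0 → j ∈ Z) {γ : B → ℝ} (hγ : γ ∈ cs.rootsIn J)
    (h : M.form γ u = 0) : γ ∈ coordSpace Z := by
  wlog h0 : 0 ≤ γ generalizing γ
  · rw [← neg_neg γ]
    refine Submodule.neg_mem _ (this (cs.neg_mem_rootsIn hγ) (by simp [h]) ?_)
    exact neg_nonneg.2 (cs.root_nonpos_of_not_nonneg (cs.mem_rootsIn.1 hγ).1 h0)
  rw [mem_rootsIn] at hγ
  rw [form_eq_sum_of_mem M hγ.2] at h
  have h1 := (Finset.sum_eq_zero_iff_of_nonneg fun j hj => mul_nonneg (h0 j) (hu j hj)).1 h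
  intro j hj
  by_cases hjJ : j ∈ J
  · exact (mul_eq_zero.1 (h1 j hjJ)).resolve_right fun h2 => hj (hZ j hjJ h2)
  · exact hγ.2 j hjJ

end Dominance

end CoxeterSystem

namespace CoxeterSystem

open CoxeterMatrix

variable {B W : Type*} [Group W] {M : CoxeterMatrix B} (cs : CoxeterSystem M W)
  [Fintype B] [DecidableEq B] {n : ℕ}

lemma geomRep_eq_self {Z : Finset B} {w : W} (hw : w ∈ cs.parabolicSubgroup Z) {u : B → ℝ}
    (hu : ∀ j ∈ Z, M.form (simpleRoot j) u = 0) : cs.geomRep w u = u := by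
  induction hw using Subgroup.closure_induction with
  | mem x hx =>
    obtain ⟨j, hj, rfl⟩ := hx
    simp [geomRep_simple, hu j hj]
  | one => rw [geomRep_one]
  | mul x y _ _ hx hy => rw [geomRep_mul, hy, hx]
  | inv x _ hx =>
    conv_lhs => rw [← hx]
    rw [geomRep_inv_self]

variable (M) in
/-- `u` lies on the ray of the fundamental weight of the vertex `s` of `J`. -/
def IsOnRay (J : Finset B) (s : B) (u : B → ℝ) : Prop :=
  (∀ j ∈ J, j ≠ s → M.form (simpleRoot j) u = 0) ∧ 0 < M.form (simpleRoot s) u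

variable {cs} in
lemma IsOnRay.nonneg {J : Finset B} {s : B} {u : B → ℝ} (h : IsOnRay M J s u) {j : B}
    (hj : j ∈ J) : 0 ≤ M.form (simpleRoot j) u := by
  by_cases hjs : j = s
  · exact hjs ▸ h.2.le
  · exact (h.1 j hj hjs).ge

include cs in
lemma forall_apply_eq_zero_iff [Finite W] {J : Finset B} {s : B} (hs : s ∈ J)
    (hJ : J.card = n + 1) {τ : Fin n → B → ℝ} (hτ : LinearIndependent ℝ τ)
    (hτJ : ∀ i, τ i ∈ coordSpace J) {u : B → ℝ} (huJ : u ∈ coordSpace J) (hu0 : u ≠ 0)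
    (hu : ∀ i, M.form (τ i) u = 0) :
    (∀ i, τ i s = 0) ↔ IsOnRay M J s u ∨ IsOnRay M J s (-u) := by
  have key : (∀ i, τ i s = 0) ↔ ∀ j ∈ J, j ≠ s → M.form (simpleRoot j) u = 0 := by
    constructor
    · intro h j hj hjs
      have hspan := span_eq_coordSpace (J := J.erase s)
        (by rw [Finset.card_erase_of_mem hs, hJ]; rfl)
        (fun i j hj => by
          by_cases hjs : j = s
          · exact hjs ▸ h i
          · exact hτJ i j fun hjJ => hj (Finset.mem_erase.2 ⟨hjs, hjJ⟩)) hτ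
      have hle : coordSpace (J.erase s) ≤ LinearMap.ker (M.form.flip u) := by
        rw [← hspan, Submodule.span_le]
        rintro _ ⟨i, rfl⟩
        exact hu i
      exact hle (simpleRoot_mem_coordSpace (Finset.mem_erase.2 ⟨hjs, hj⟩))
    · intro h i
      have h1 := hu i
      rw [form_eq_sum_of_mem M (hτJ i), Finset.sum_eq_single_of_mem s hs fun j hj hjs => by
        rw [h j hj hjs, mul_zero]] at h1
      refine (mul_eq_zero.1 h1).resolve_right fun h2 => hu0 (cs.eq_zero_of_form_self ?_)
      rw [form_eq_sum_of_mem M huJ]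
      refine Finset.sum_eq_zero fun j hj => ?_
      by_cases hjs : j = s
      · rw [hjs, h2, mul_zero]
      · rw [h j hj hjs, mul_zero]
  rw [key]
  constructor
  · intro h
    have hne : M.form (simpleRoot s) u ≠ 0 := fun h2 => hu0 (cs.eq_zero_of_form_self (by
      rw [form_eq_sum_of_mem M huJ]
      refine Finset.sum_eq_zero fun j hj => ?_
      by_cases hjs : j = s
      · rw [hjs, h2, mul_zero]
      · rw [h j hj hjs, mul_zero]))
    rcases hne.lt_or_gt with h2 | h2
    · exact Or.inr ⟨fun j hj hjs => by rw [map_neg, h j hj hjs, neg_zero],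
        by rw [map_neg]; linarith⟩
    · exact Or.inl ⟨h, h2⟩
  · rintro (h | h) j hj hjs
    · exact h.1 j hj hjs
    · simpa using h.1 j hj hjs

variable [Fintype W]

open Classical in
/-- The elements of a standard parabolic subgroup. -/
noncomputable def parabolicFinset (J : Finset B) : Finset W :=
  Finset.univ.filter (· ∈ cs.parabolicSubgroup J)

omit [Fintype B] [DecidableEq B] in
lemma mem_parabolicFinset {J : Finset B} {w : W} :
    w ∈ cs.parabolicFinset J ↔ w ∈ cs.parabolicSubgroup J := by
  simp [parabolicFinset]

omit [Fintype B] [DecidableEq B] in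
lemma card_parabolicFinset_ne_zero (J : Finset B) : ((cs.parabolicFinset J).card : ℝ) ≠ 0 := by
  exact_mod_cast (Finset.card_pos.2 ⟨1, cs.mem_parabolicFinset.2 (one_mem _)⟩).ne'

open Classical in
lemma card_isOnRay {J : Finset B} {s t : B} (ht : t ∈ J) {g : W}
    (hg : g ∈ cs.parabolicSubgroup J) {u : B → ℝ} (h : IsOnRay M J s (cs.geomRep g u)) :
    ((cs.parabolicFinset J).filter fun w => IsOnRay M J t (cs.geomRep w⁻¹ u)).card =
      if t = s then (cs.parabolicFinset (J.erase s)).card else 0 := by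
  have hu (w : W) : cs.geomRep w⁻¹ u = cs.geomRep (w⁻¹ * g⁻¹) (cs.geomRep g u) := by
    rw [geomRep_mul, geomRep_inv_self]
  have hdom (w : W) (hw : w ∈ cs.parabolicSubgroup J)
      (h' : IsOnRay M J t (cs.geomRep w⁻¹ u)) :=
    cs.eq_and_mem_of_dominant (fun j hj => h.nonneg hj) (mul_mem (inv_mem hw) (inv_mem hg))
      (fun j hj => by rw [← hu]; exact h'.nonneg hj) (Z := J.erase s)
      (fun j hj hj0 => Finset.mem_erase.2 ⟨fun hjs => h.2.ne' (hjs ▸ hj0), hj⟩)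
  split_ifs with hts
  · subst hts
    refine Finset.card_bij' (fun w _ => w⁻¹ * g⁻¹) (fun x _ => g⁻¹ * x⁻¹) ?_ ?_ ?_ ?_
    · intro w hw
      rw [Finset.mem_filter, mem_parabolicFinset] at hw
      exact cs.mem_parabolicFinset.2 (hdom w hw.1 hw.2).2
    · intro x hx
      rw [mem_parabolicFinset] at hx
      rw [Finset.mem_filter, mem_parabolicFinset, hu]
      refine ⟨mul_mem (inv_mem hg)
        (inv_mem (cs.parabolicSubgroup_mono (Finset.erase_subset _ _) hx)), ?_⟩
      have : (g⁻¹ * x⁻¹)⁻¹ * g⁻¹ = x := by group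
      rw [this, cs.geomRep_eq_self hx fun j hj =>
        h.1 j (Finset.mem_erase.1 hj).2 (Finset.mem_erase.1 hj).1]
      exact h
    · intro w _; group
    · intro x _; group
  · rw [Finset.card_eq_zero, Finset.filter_eq_empty_iff]
    intro w hw h'
    rw [mem_parabolicFinset] at hw
    have h1 := (hdom w hw h').1
    rw [← hu] at h1
    rw [h1] at h'
    exact h'.2.ne' (h.1 t ht hts)

/-- A vector orthogonal to many independent roots is conjugate to a multiple of a
fundamental weight. -/
lemma exists_isOnRay {J : Finset B} (hJ : J.card = n + 1) {τ : Fin n → B → ℝ}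
    (hτ : LinearIndependent ℝ τ) (hτJ : ∀ i, τ i ∈ cs.rootsIn J) {u : B → ℝ}
    (huJ : u ∈ coordSpace J) (hu0 : u ≠ 0) (hu : ∀ i, M.form (τ i) u = 0) :
    ∃ s ∈ J, ∃ g ∈ cs.parabolicSubgroup J, IsOnRay M J s (cs.geomRep g u) := by
  obtain ⟨g, hg, hdom⟩ := cs.exists_dominant J u
  set Z := J.filter fun j => M.form (simpleRoot j) (cs.geomRep g u) = 0 with hZ
  have hmem (i : Fin n) : cs.geomRep g (τ i) ∈ coordSpace Z :=
    cs.mem_coordSpace_of_form_dominant_eq_zero hdom (fun j hj h => Finset.mem_filter.2 ⟨hj, h⟩)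
      (cs.geomRep_mem_rootsIn (hτJ i) hg) (by rw [form_geomRep, hu])
  have hind : LinearIndependent ℝ fun i => cs.geomRep g (τ i) :=
    hτ.map' (cs.geomRep g) (LinearMap.ker_eq_bot.2 fun x y h => by
      rw [← cs.geomRep_inv_self g x, h, geomRep_inv_self])
  have hcard := card_le_of_linearIndependent hmem hind
  obtain ⟨s, hs, hs0⟩ : ∃ s ∈ J, M.form (simpleRoot s) (cs.geomRep g u) ≠ 0 := by
    by_contra! hcon
    refine cs.geomRep_ne_zero g hu0 (cs.eq_zero_of_form_self ?_)
    rw [form_eq_sum_of_mem M (cs.geomRep_mem hg huJ)]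
    exact Finset.sum_eq_zero fun j hj => by rw [hcon j hj, mul_zero]
  have hZe : Z = J.erase s := by
    refine Finset.eq_of_subset_of_card_le (fun j hj => ?_) ?_
    · rw [hZ, Finset.mem_filter] at hj
      exact Finset.mem_erase.2 ⟨fun h => hs0 (h ▸ hj.2), hj.1⟩
    · rw [Finset.card_erase_of_mem hs, hJ]
      exact hcard
  refine ⟨s, hs, g, hg, fun j hj hjs => ?_, (hdom s hs).lt_of_ne' hs0⟩
  have : j ∈ Z := hZe ▸ Finset.mem_erase.2 ⟨hjs, hj⟩
  exact (Finset.mem_filter.1 this).2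

variable {h : B → ℝ} {J : Finset B}
  (hh : ∀ s ∈ J, ∀ v ∈ coordSpace J, ∑ γ ∈ cs.rootsIn J, M.form γ v * γ s = h s * v s)
include hh

lemma sum_gram_cons (hJ : J.card = n + 1) {τ : Fin n → B → ℝ} (hτ : M.gram τ ≠ 0)
    (hτJ : ∀ i, τ i ∈ cs.rootsIn J) {u : B → ℝ} (huJ : u ∈ coordSpace J)
    (hu : ∀ i, M.form (τ i) u = 0) {s : B} (hs : s ∈ J) {g : W}
    (hg : g ∈ cs.parabolicSubgroup J) (hray : IsOnRay M J s (cs.geomRep g u)) :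
    ∑ γ ∈ cs.rootsIn J, M.gram (Fin.cons γ τ) = h s * M.gram τ := by
  set v := cs.geomRep g u with hv
  have hvJ : v ∈ coordSpace J := cs.geomRep_mem hg huJ
  have hform {γ : B → ℝ} (hγ : γ ∈ coordSpace J) :
      M.form γ v = γ s * M.form (simpleRoot s) v := by
    rw [form_eq_sum_of_mem M hγ]
    exact Finset.sum_eq_single_of_mem s hs fun j hj hjs => by rw [hray.1 j hj hjs, mul_zero]
  have huv : M.form u u = v s * M.form (simpleRoot s) v := by
    rw [← hform hvJ, hv, form_geomRep]
  have hu0 : M.form u u ≠ 0 := fun h0 => by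
    have := cs.eq_zero_of_form_self h0
    rw [hv, this, map_zero, IsOnRay, map_zero] at hray
    exact lt_irrefl _ hray.2
  have hsum : ∑ γ ∈ cs.rootsIn J, M.form γ u ^ 2 = h s * M.form u u := by
    rw [huv, ← mul_assoc, ← hh s hs v hvJ, Finset.sum_mul, ← cs.sum_rootsIn_geomRep hg fun γ =>
      M.form γ v * γ s * M.form (simpleRoot s) v]
    refine Finset.sum_congr rfl fun γ hγ => ?_
    have := hform (cs.mem_rootsIn.1 (cs.geomRep_mem_rootsIn hγ hg)).2
    rw [mul_assoc, ← this, hv, form_geomRep, sq]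
  refine mul_right_cancel₀ hu0 ?_
  rw [Finset.sum_mul, mul_right_comm, ← hsum, Finset.sum_mul]
  exact Finset.sum_congr rfl fun γ hγ => gram_cons_mul hJ
    (fun i => (cs.mem_rootsIn.1 (hτJ i)).2) huJ (cs.mem_rootsIn.1 hγ).2 hu hτ

open Classical in
private lemma sum_card_isOnRay (hJ : J.card = n + 1) {τ : Fin n → B → ℝ} (hτ : M.gram τ ≠ 0)
    (hτJ : ∀ i, τ i ∈ cs.rootsIn J) {u : B → ℝ} (huJ : u ∈ coordSpace J) (hu0 : u ≠ 0)
    (hu : ∀ i, M.form (τ i) u = 0) :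
    ∑ s ∈ J, h s / (cs.parabolicFinset (J.erase s)).card *
      (((cs.parabolicFinset J).filter fun w => IsOnRay M J s (cs.geomRep w⁻¹ u)).card *
        M.gram τ) = ∑ γ ∈ cs.rootsIn J, M.gram (Fin.cons γ τ) := by
  obtain ⟨s, hs, g, hg, hray⟩ :=
    cs.exists_isOnRay hJ (linearIndependent_of_gram_ne_zero hτ) hτJ huJ hu0 hu
  rw [cs.sum_gram_cons hh hJ hτ hτJ huJ hu hs hg hray, Finset.sum_eq_single_of_mem s hs]
  · rw [cs.card_isOnRay hs hg hray, if_pos rfl]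
    have := cs.card_parabolicFinset_ne_zero (J.erase s)
    field_simp
  · intro t ht hts
    rw [cs.card_isOnRay ht hg hray, if_neg hts]
    simp

open Classical in
private lemma sum_card_apply_eq_zero (hJ : J.card = n + 1) {τ : Fin n → B → ℝ}
    (hτJ : ∀ i, τ i ∈ cs.rootsIn J) :
    ∑ s ∈ J, h s / (cs.parabolicFinset (J.erase s)).card *
      (((cs.parabolicFinset J).filter fun w => ∀ i, cs.geomRep w⁻¹ (τ i) s = 0).card *
        M.gram τ) = 2 * ∑ γ ∈ cs.rootsIn J, M.gram (Fin.cons γ τ) := by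
  by_cases hτ : M.gram τ = 0
  · rw [hτ, Finset.sum_eq_zero fun s _ => by simp, Finset.sum_eq_zero fun γ _ => ?_, mul_zero]
    exact cs.gram_cons_eq_zero hτ γ
  have hind := linearIndependent_of_gram_ne_zero hτ
  obtain ⟨u, huJ, hu0, hu⟩ := exists_form_eq_zero M (J := J) (by omega) τ
  have h1 := cs.sum_card_isOnRay hh hJ hτ hτJ huJ hu0 hu
  have h2 := cs.sum_card_isOnRay hh hJ hτ hτJ (Submodule.neg_mem _ huJ) (neg_ne_zero.2 hu0)
    fun i => by rw [map_neg, hu, neg_zero]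
  rw [two_mul]
  nth_rw 1 [← h1]
  rw [← h2, ← Finset.sum_add_distrib]
  refine Finset.sum_congr rfl fun s hs => ?_
  rw [← mul_add, ← add_mul, ← Nat.cast_add, ← Finset.card_union_of_disjoint,
    ← Finset.filter_or]
  · congr 4
    refine Finset.filter_congr fun w hw => ?_
    rw [mem_parabolicFinset] at hw
    rw [map_neg]
    refine cs.forall_apply_eq_zero_iff hs hJ ?_ (fun i => cs.geomRep_mem (inv_mem hw)
      (cs.mem_rootsIn.1 (hτJ i)).2) (cs.geomRep_mem (inv_mem hw) huJ) (cs.geomRep_ne_zero _ hu0)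
      fun i => by rw [form_geomRep, hu]
    refine linearIndependent_of_gram_ne_zero (M := M) ?_
    rwa [gram_geomRep]
  · rw [Finset.disjoint_filter]
    intro w _ h3 h4
    have := h3.2
    have := h4.2
    rw [map_neg, map_neg] at this
    linarith

omit hh

/-- The sum of the Gram determinants of all `n`-tuples of roots. -/
noncomputable def gramSum (n : ℕ) (J : Finset B) : ℝ :=
  ∑ τ ∈ Fintype.piFinset fun _ : Fin n => cs.rootsIn J, M.gram τ

lemma gramSum_succ : cs.gramSum (n + 1) J =
    ∑ τ ∈ Fintype.piFinset fun _ : Fin n => cs.rootsIn J,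
      ∑ γ ∈ cs.rootsIn J, M.gram (Fin.cons γ τ) := by
  rw [gramSum, Finset.sum_sigma']
  refine Finset.sum_bij' (fun τ _ => ⟨Fin.tail τ, τ 0⟩) (fun p _ => Fin.cons p.2 p.1) ?_ ?_ ?_ ?_ ?_
  · intro τ hτ
    rw [Fintype.mem_piFinset] at hτ
    exact Finset.mem_sigma.2 ⟨Fintype.mem_piFinset.2 fun i => hτ i.succ, hτ 0⟩
  · intro p hp
    rw [Finset.mem_sigma, Fintype.mem_piFinset] at hp
    exact Fintype.mem_piFinset.2 (Fin.cases hp.2 hp.1)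
  · intro τ _
    simp
  · intro p _
    simp
  · intro τ _
    simp

open Classical in
private lemma card_mul_gramSum_erase (s : B) :
    (cs.parabolicFinset J).card * cs.gramSum n (J.erase s) =
      ∑ τ ∈ Fintype.piFinset fun _ : Fin n => cs.rootsIn J,
        ((cs.parabolicFinset J).filter fun w => ∀ i, cs.geomRep w⁻¹ (τ i) s = 0).card *
          M.gram τ := by
  have h1 : cs.gramSum n (J.erase s) = ∑ τ ∈ Fintype.piFinset fun _ : Fin n => cs.rootsIn J,
      if ∀ i, τ i s = 0 then M.gram τ else 0 := by
    rw [gramSum, ← Finset.sum_filter]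
    refine Finset.sum_congr ?_ fun _ _ => rfl
    ext τ
    simp only [Finset.mem_filter, Fintype.mem_piFinset, mem_rootsIn, mem_coordSpace, ← forall_and]
    refine forall_congr' fun i => ?_
    rw [and_assoc]
    refine and_congr_right fun _ => ⟨fun h => ⟨fun j hj => h j fun h' => hj
      (Finset.mem_erase.1 h').2, h s (Finset.notMem_erase s J)⟩, fun h j hj => ?_⟩
    by_cases hjs : j = s
    · exact hjs ▸ h.2
    · exact h.1 j fun hjJ => hj (Finset.mem_erase.2 ⟨hjs, hjJ⟩)
  have h2 : ∀ w ∈ cs.parabolicFinset J, cs.gramSum n (J.erase s) =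
      ∑ τ ∈ Fintype.piFinset fun _ : Fin n => cs.rootsIn J,
        if ∀ i, cs.geomRep w⁻¹ (τ i) s = 0 then M.gram τ else 0 := by
    intro w hw
    rw [mem_parabolicFinset] at hw
    rw [h1]
    refine Finset.sum_bij' (fun τ _ i => cs.geomRep w (τ i)) (fun τ _ i => cs.geomRep w⁻¹ (τ i))
      ?_ ?_ ?_ ?_ ?_
    · exact fun τ hτ => Fintype.mem_piFinset.2 fun i =>
        cs.geomRep_mem_rootsIn (Fintype.mem_piFinset.1 hτ i) hw
    · exact fun τ hτ => Fintype.mem_piFinset.2 fun i =>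
        cs.geomRep_mem_rootsIn (Fintype.mem_piFinset.1 hτ i) (inv_mem hw)
    · intro τ _; simp
    · intro τ _; simp
    · intro τ _
      simp only [geomRep_inv_self, gram_geomRep]
  rw [← nsmul_eq_mul, ← Finset.sum_const, Finset.sum_congr rfl h2, Finset.sum_comm]
  refine Finset.sum_congr rfl fun τ _ => ?_
  rw [← Finset.sum_filter, Finset.sum_const, nsmul_eq_mul]

include hh in
theorem two_mul_gramSum_div (hJ : J.card = n + 1) :
    2 * (cs.gramSum (n + 1) J / (cs.parabolicFinset J).card) =
      ∑ s ∈ J, h s * (cs.gramSum n (J.erase s) / (cs.parabolicFinset (J.erase s)).card) := by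
  classical
  have hJ0 := cs.card_parabolicFinset_ne_zero J
  rw [← mul_div_assoc, div_eq_iff hJ0, gramSum_succ, Finset.mul_sum, Finset.sum_mul]
  rw [Finset.sum_congr rfl fun τ hτ =>
    (cs.sum_card_apply_eq_zero hh hJ (Fintype.mem_piFinset.1 hτ)).symm, Finset.sum_comm]
  refine Finset.sum_congr rfl fun s _ => ?_
  rw [← Finset.mul_sum, ← card_mul_gramSum_erase]
  ring

end CoxeterSystem

/-- The discrete Andréief identity. -/
lemma Matrix.sum_piFinset_det_mul_det {ι α R : Type*} [Fintype ι] [DecidableEq ι]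
    [CommRing R] (s : Finset α) (f g : α → ι → R) :
    ∑ τ ∈ Fintype.piFinset fun _ : ι => s,
      (Matrix.of fun i => f (τ i)).det * (Matrix.of fun i => g (τ i)).det =
      (Fintype.card ι).factorial * (Matrix.of fun i j => ∑ x ∈ s, f x i * g x j).det := by
  set A : Matrix ι ι R := Matrix.of fun i j => ∑ x ∈ s, f x i * g x j with hA
  have h (σ : Equiv.Perm ι) : ∑ τ ∈ Fintype.piFinset fun _ : ι => s,
      (σ.sign : R) * (∏ i, f (τ i) (σ i)) * (Matrix.of fun i => g (τ i)).det = A.det := by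
    have h1 := Matrix.det_permute σ A
    rw [← Matrix.det_transpose, Matrix.det_apply'] at h1
    have h2 : A.det = σ.sign * (σ.sign * A.det) := by
      rw [← mul_assoc, ← Int.cast_mul, ← Units.val_mul, Int.units_mul_self]
      simp
    rw [h2, ← h1, Finset.mul_sum]
    simp_rw [← Matrix.det_transpose (Matrix.of fun i => g _), Matrix.det_apply', Finset.mul_sum]
    rw [Finset.sum_comm]
    refine Finset.sum_congr rfl fun ρ _ => ?_
    simp only [Matrix.transpose_apply, Matrix.submatrix_apply, id, hA, Matrix.of_apply]
    rw [Finset.prod_univ_sum, Finset.mul_sum, Finset.mul_sum]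
    refine Finset.sum_congr rfl fun τ _ => ?_
    rw [Finset.prod_mul_distrib]
    ring
  simp_rw [← Matrix.det_transpose (Matrix.of fun i => f _), Matrix.det_apply' (Matrix.transpose _),
    Finset.sum_mul]
  rw [Finset.sum_comm]
  simp only [Matrix.transpose_apply, Matrix.of_apply]
  rw [Finset.sum_congr rfl fun σ _ => h σ, Finset.sum_const, Finset.card_univ, Fintype.card_perm,
    nsmul_eq_mul]

namespace CoxeterSystem

open CoxeterMatrix

variable {B W : Type*} [Group W] {M : CoxeterMatrix B} (cs : CoxeterSystem M W)
  [Fintype B] [DecidableEq B] [Fintype W]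

theorem gramSum_univ {ε : B → Bool} (hε : M.IsColoring ε) (hB : M.IsConn Finset.univ) :
    cs.gramSum (Fintype.card B) Finset.univ =
      (Fintype.card B).factorial *
        orderOf (cs.bipartiteCoxeter ε Finset.univ) ^ Fintype.card B := by
  let e : Fin (Fintype.card B) ≃ B := (Fintype.equivFin B).symm
  have he (k : Fin (Fintype.card B)) :
      ((e.trans (Equiv.subtypeUnivEquiv Finset.mem_univ).symm k : (Finset.univ : Finset B)) : B) =
        e k := rfl
  have h := Matrix.sum_piFinset_det_mul_det cs.roots (fun γ k => γ (e k))
    fun γ k => M.form γ (simpleRoot (e k))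
  rw [gramSum, rootsIn_univ]
  simp_rw [gram]
  rw [Finset.sum_congr rfl fun τ _ => crossGram_eq_mul
    (e.trans (Equiv.subtypeUnivEquiv Finset.mem_univ).symm)
    (fun i => mem_coordSpace.2 fun j hj => absurd (Finset.mem_univ j) hj) τ]
  simp_rw [he]
  rw [h, Fintype.card_fin]
  congr 1
  have hA : (Matrix.of fun i j => ∑ γ ∈ cs.roots, γ (e i) * M.form γ (simpleRoot (e j))) =
      Matrix.diagonal fun _ : Fin (Fintype.card B) =>
        (orderOf (cs.bipartiteCoxeter ε Finset.univ) : ℝ) := by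
    ext i j
    simp_rw [Matrix.of_apply, mul_comm (_ : ℝ) (M.form _ _)]
    rw [cs.sum_roots_form_mul hε hB, Matrix.diagonal_apply, simpleRoot, Pi.single_apply]
    simp [e.injective.eq_iff]
  rw [hA, Matrix.det_diagonal]
  simp

end CoxeterSystem

namespace CoxeterSystem

open CoxeterMatrix

variable {B W : Type*} [Group W] {M : CoxeterMatrix B} (cs : CoxeterSystem M W)
  [Fintype B] [DecidableEq B] [Fintype W]

section Rank

lemma geomRep_prod_sub_mem_span {L : List (B → ℝ)} (hL : ∀ γ ∈ L, γ ∈ cs.roots) (v : B → ℝ) :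
    cs.geomRep (L.map cs.reflOf).prod v - v ∈ Submodule.span ℝ {γ | γ ∈ L} := by
  induction L with
  | nil => simp
  | cons γ L ih =>
    rw [List.forall_mem_cons] at hL
    rw [List.map_cons, List.prod_cons, geomRep_mul, geomRep_reflOf cs hL.1, sub_right_comm]
    refine Submodule.sub_mem _ (Submodule.span_mono (fun δ hδ => ?_) (ih hL.2))
      (Submodule.smul_mem _ _ (Submodule.subset_span List.mem_cons_self))
    exact List.mem_cons_of_mem γ hδ

omit [DecidableEq B] in
lemma finrank_span_mem_list_le (L : List (B → ℝ)) :
    Module.finrank ℝ (Submodule.span ℝ {γ | γ ∈ L}) ≤ L.length := by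
  classical
  have h : {γ | γ ∈ L} = (L.toFinset : Set (B → ℝ)) := by ext; simp
  rw [h]
  exact (finrank_span_finset_le_card _).trans L.toFinset_card_le

variable {ε : B → Bool} (hε : M.IsColoring ε) {J : Finset B}
include hε

omit [Fintype W] in
lemma eq_zero_of_geomRep_bipartiteCoxeter_eq [Finite W] {v : B → ℝ} (hv : v ∈ coordSpace J)
    (h : cs.geomRep (cs.bipartiteCoxeter ε J) v = v) : v = 0 := by
  have h' : cs.geomRep (cs.layer ε J 1) v = cs.geomRep (cs.layer ε J 0) v := by
    conv_rhs => rw [← h]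
    rw [bipartiteCoxeter, ← geomRep_mul, ← mul_assoc, cs.layer_mul_self hε, one_mul]
  refine cs.eq_zero_of_form_self ?_
  rw [form_eq_sum_of_mem M hv]
  refine Finset.sum_eq_zero fun i hi => ?_
  have hi' := congrFun h' i
  cases hc : ε i with
  | false =>
    have h0 : i ∈ colorClass ε J 0 := mem_colorClass.2 ⟨hi, by rw [hc]; rfl⟩
    have h1 : i ∉ colorClass ε J 1 := fun h1 => by
      have := (mem_colorClass.1 h1).2
      rw [hc] at this
      exact Bool.false_ne_true this
    rw [cs.geomRep_layer_apply_of_notMem hε h1, cs.geomRep_layer_apply_of_mem hε h0] at hi'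
    rw [show M.form (simpleRoot i) v = 0 by linarith, mul_zero]
  | true =>
    have h1 : i ∈ colorClass ε J 1 := mem_colorClass.2 ⟨hi, by rw [hc]; rfl⟩
    have h0 : i ∉ colorClass ε J 0 := fun h0 => by
      have := (mem_colorClass.1 h0).2
      rw [hc] at this
      exact Bool.false_ne_true this.symm
    rw [cs.geomRep_layer_apply_of_notMem hε h0, cs.geomRep_layer_apply_of_mem hε h1] at hi'
    rw [show M.form (simpleRoot i) v = 0 by linarith, mul_zero]

lemma coordSpace_le_span {L : List (B → ℝ)} (hL : ∀ γ ∈ L, γ ∈ cs.roots)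
    (h : (L.map cs.reflOf).prod = cs.bipartiteCoxeter ε J) :
    coordSpace J ≤ Submodule.span ℝ {γ | γ ∈ L} := by
  have hmem (m : ℕ) {v : B → ℝ} (hv : v ∈ coordSpace J) :
      cs.geomRep (cs.layer ε J m) v ∈ coordSpace J := by
    refine cs.geomRep_layer_mem hε subset_rfl ?_ m hv
    rw [Finset.sdiff_self]
    exact fun _ _ _ h => absurd h (Finset.notMem_empty _)
  let f : coordSpace J →ₗ[ℝ] coordSpace J :=
    (cs.geomRep (cs.bipartiteCoxeter ε J)).restrict (fun v hv => by
      rw [bipartiteCoxeter, geomRep_mul]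
      exact hmem 0 (hmem 1 hv)) - LinearMap.id
  have hf : Function.Injective f := by
    rw [← LinearMap.ker_eq_bot, LinearMap.ker_eq_bot']
    intro v hv
    refine Subtype.ext (cs.eq_zero_of_geomRep_bipartiteCoxeter_eq hε v.2 ?_)
    exact sub_eq_zero.1 (congrArg Subtype.val hv)
  intro v hv
  obtain ⟨u, hu⟩ := LinearMap.injective_iff_surjective.1 hf ⟨v, hv⟩
  have hu' : cs.geomRep (cs.bipartiteCoxeter ε J) u - u = v := congrArg Subtype.val hu
  rw [← hu', ← h]
  exact cs.geomRep_prod_sub_mem_span hL _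

lemma card_le_length {L : List (B → ℝ)} (hL : ∀ γ ∈ L, γ ∈ cs.roots)
    (h : (L.map cs.reflOf).prod = cs.bipartiteCoxeter ε J) : J.card ≤ L.length := by
  rw [← finrank_coordSpace J]
  exact (Submodule.finrank_mono (cs.coordSpace_le_span hε hL h)).trans (finrank_span_mem_list_le L)

lemma mem_coordSpace_of_mem {L : List (B → ℝ)} (hL : ∀ γ ∈ L, γ ∈ cs.roots)
    (h : (L.map cs.reflOf).prod = cs.bipartiteCoxeter ε J) (hlen : L.length = J.card)
    {γ : B → ℝ} (hγ : γ ∈ L) : γ ∈ coordSpace J := by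
  rw [Submodule.eq_of_le_of_finrank_le (cs.coordSpace_le_span hε hL h)
    (by rw [finrank_coordSpace, ← hlen]; exact finrank_span_mem_list_le L)]
  exact Submodule.subset_span hγ

end Rank

open Classical in
/-- The number of `n`-tuples of roots such that the product of the corresponding reflections
is `w`. -/
noncomputable def rootFactorizations : ℕ → W → ℝ
  | 0, w => if w = 1 then 1 else 0
  | n + 1, w => ∑ γ ∈ cs.roots, rootFactorizations n (cs.reflOf γ * w)

lemma reflOf_mul_self {γ : B → ℝ} (h : γ ∈ cs.roots) : cs.reflOf γ * cs.reflOf γ = 1 := by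
  obtain ⟨w, i, rfl⟩ := cs.mem_roots.1 h
  rw [reflOf_geomRep_simpleRoot]
  simp [mul_assoc]

lemma exists_list_of_rootFactorizations_ne_zero {n : ℕ} {w : W}
    (h : cs.rootFactorizations n w ≠ 0) :
    ∃ L : List (B → ℝ), L.length = n ∧ (∀ γ ∈ L, γ ∈ cs.roots) ∧ (L.map cs.reflOf).prod = w := by
  induction n generalizing w with
  | zero =>
    classical
    rw [rootFactorizations, ite_ne_right_iff] at h
    exact ⟨[], rfl, by simp, h.1.symm⟩
  | succ n ih =>
    obtain ⟨γ, hγ, hne⟩ := Finset.exists_ne_zero_of_sum_ne_zero h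
    obtain ⟨L, hlen, hL, hprod⟩ := ih hne
    refine ⟨γ :: L, by simp [hlen], List.forall_mem_cons.2 ⟨hγ, hL⟩, ?_⟩
    rw [List.map_cons, List.prod_cons, hprod, ← mul_assoc, cs.reflOf_mul_self hγ, one_mul]

lemma rootFactorizations_conj (n : ℕ) (g w : W) :
    cs.rootFactorizations n (g * w * g⁻¹) = cs.rootFactorizations n w := by
  induction n generalizing w with
  | zero =>
    classical
    rw [rootFactorizations, rootFactorizations]
    exact if_congr conj_eq_one_iff rfl rfl
  | succ n ih =>
    have hg : g ∈ cs.parabolicSubgroup Finset.univ := by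
      rw [parabolicSubgroup_univ]
      exact Subgroup.mem_top g
    rw [rootFactorizations, rootFactorizations, ← rootsIn_univ, ← cs.sum_rootsIn_geomRep hg]
    refine Finset.sum_congr rfl fun γ hγ => ?_
    rw [rootsIn_univ] at hγ
    rw [cs.reflOf_geomRep hγ, ← ih (cs.reflOf γ * w)]
    congr 1
    group

theorem rootFactorizations_bipartiteCoxeter {ε : B → Bool} (hε : M.IsColoring ε) (n : ℕ)
    {J : Finset B} (hJ : J.card = n) : cs.rootFactorizations n (cs.bipartiteCoxeter ε J) =
      2 ^ n * (cs.gramSum n J / (cs.parabolicFinset J).card) := by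
  classical
  induction n generalizing J with
  | zero =>
    obtain rfl := Finset.card_eq_zero.1 hJ
    have h1 : cs.bipartiteCoxeter ε ∅ = 1 := by
      simp only [bipartiteCoxeter, layer, colorClass, Finset.filter_empty, Finset.toList_empty,
        wordProd_nil, one_mul]
    have h2 : cs.parabolicFinset ∅ = {1} := by
      ext w
      rw [mem_parabolicFinset, parabolicSubgroup_empty, Subgroup.mem_bot, Finset.mem_singleton]
    simp [rootFactorizations, h1, h2, gramSum, gram, crossGram]
  | succ n ih =>
    obtain ⟨h, h1, h2⟩ := cs.exists_coxeter_numbers hε J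
    rw [rootFactorizations, pow_succ, mul_assoc, cs.two_mul_gramSum_div h2 hJ, Finset.mul_sum,
      ← Finset.sum_subset (s₁ := cs.rootsIn J) fun γ hγ => (cs.mem_rootsIn.1 hγ).1,
      h1 _ (cs.rootFactorizations_conj n)]
    · refine Finset.sum_congr rfl fun s hs => ?_
      rw [ih (by rw [Finset.card_erase_of_mem hs, hJ]; rfl)]
      ring
    · intro γ hγ hγJ
      by_contra hne
      obtain ⟨L, hlen, hL, hprod⟩ := cs.exists_list_of_rootFactorizations_ne_zero hne
      refine hγJ (cs.mem_rootsIn.2 ⟨hγ, cs.mem_coordSpace_of_mem hε (L := γ :: L)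
        (List.forall_mem_cons.2 ⟨hγ, hL⟩) ?_ (by simp [hlen, hJ]) List.mem_cons_self⟩)
      rw [List.map_cons, List.prod_cons, hprod, ← mul_assoc, cs.reflOf_mul_self hγ, one_mul]

end CoxeterSystem

section AbsLength

variable {G : Type*} [Group G] {S : Set G}

lemma absLength_prod_le {l : List G} (hl : ∀ t ∈ l, IsReflectionOf S t) :
    absLength S l.prod ≤ l.length :=
  Nat.sInf_le ⟨l, hl, rfl, rfl⟩

lemma absLength_one : absLength S 1 = 0 :=
  Nat.le_zero.1 (absLength_prod_le (l := []) (by simp))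

lemma isReflectionOf_of_absLength_eq_one {t : G} (h : absLength S t = 1) :
    IsReflectionOf S t := by
  have hne : {k | ∃ l : List G, (∀ t ∈ l, IsReflectionOf S t) ∧ l.length = k ∧
      l.prod = t}.Nonempty := by
    by_contra hne
    rw [absLength, Set.not_nonempty_iff_eq_empty.1 hne, Nat.sInf_empty] at h
    exact zero_ne_one h
  obtain ⟨l, hl, hlen, rfl⟩ := Nat.sInf_mem hne
  obtain ⟨s, rfl⟩ := List.length_eq_one_iff.1 (hlen.trans h)
  simpa using hl

/-- A product of reflections is a product of as many reflections as its absolute length. -/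
lemma exists_list_length_eq_absLength {w : G}
    (h : ∃ l : List G, (∀ t ∈ l, IsReflectionOf S t) ∧ l.prod = w) :
    ∃ l : List G, (∀ t ∈ l, IsReflectionOf S t) ∧ l.length = absLength S w ∧ l.prod = w := by
  obtain ⟨l, hl, hprod⟩ := h
  exact Nat.sInf_mem (s := {k | ∃ l : List G, (∀ t ∈ l, IsReflectionOf S t) ∧ l.length = k ∧
    l.prod = w}) ⟨l.length, l, hl, rfl, hprod⟩

variable (hS : ∀ w : G, ∃ l : List G, (∀ t ∈ l, IsReflectionOf S t) ∧ l.prod = w)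
include hS

lemma absLength_mul_le_add_one (w : G) {t : G} (ht : IsReflectionOf S t) :
    absLength S (w * t) ≤ absLength S w + 1 := by
  obtain ⟨l, hl, hlen, rfl⟩ := exists_list_length_eq_absLength (hS w)
  have := absLength_prod_le (S := S) (l := l ++ [t]) fun x hx => by
    rcases List.mem_append.1 hx with hx | hx
    · exact hl x hx
    · exact List.mem_singleton.1 hx ▸ ht
  rw [← hlen]
  simpa using this

/-- A path of reflections ending at an element of maximal possible length is a maximal chain. -/
lemma isMaximalChain_iff {n : ℕ} {c : G} (hc : absLength S c = n) {y : Fin (n + 1) → G}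
    (h0 : y 0 = 1) (h1 : y (Fin.last n) = c) :
    ((∀ i : Fin n, absLe S (y i.castSucc) (y i.succ)) ∧
        ∀ i : Fin (n + 1), absLength S (y i) = (i : ℕ)) ↔
      ∀ i : Fin n, IsReflectionOf S ((y i.castSucc)⁻¹ * y i.succ) := by
  constructor
  · rintro ⟨hle, hlen⟩ i
    have h := hle i
    rw [absLe, hlen, hlen, Fin.val_castSucc, Fin.val_succ] at h
    exact isReflectionOf_of_absLength_eq_one (Nat.add_left_cancel h)
  · intro h
    have hanti : Antitone fun i : Fin (n + 1) => (absLength S (y i) : ℤ) - (i : ℕ) := by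
      refine Fin.antitone_iff_succ_le.2 fun i => ?_
      have := absLength_mul_le_add_one hS (y i.castSucc) (h i)
      rw [mul_inv_cancel_left] at this
      rw [Fin.val_castSucc, Fin.val_succ]
      omega
    have hlen (i : Fin (n + 1)) : absLength S (y i) = (i : ℕ) := by
      have h2 := hanti (Fin.zero_le i)
      have h3 := hanti (Fin.le_last i)
      simp only [h0, absLength_one, h1, hc, Fin.val_zero, Fin.val_last] at h2 h3
      omega
    refine ⟨fun i => ?_, hlen⟩
    have h2 := absLength_prod_le (S := S) (l := [(y i.castSucc)⁻¹ * y i.succ]) (by simpa using h i)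
    have h3 : absLength S ((y i.castSucc)⁻¹ * y i.succ) ≠ 0 := fun h4 => by
      obtain ⟨l, _, hl0, hprod⟩ :=
        exists_list_length_eq_absLength (hS ((y i.castSucc)⁻¹ * y i.succ))
      rw [h4] at hl0
      rw [List.eq_nil_of_length_eq_zero hl0, List.prod_nil, eq_comm, inv_mul_eq_one] at hprod
      have := hlen i.succ
      rw [← hprod, hlen, Fin.val_castSucc, Fin.val_succ] at this
      omega
    rw [List.prod_singleton, List.length_singleton] at h2
    rw [absLe, hlen, hlen, Fin.val_castSucc, Fin.val_succ]
    omega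

end AbsLength

section ReflectionPaths

variable {G : Type*} [Group G] [Fintype G] {S : Set G}

variable (S) in
open Classical in
/-- The paths of length `n` from `1` to `w` in the Cayley graph of the reflections. -/
noncomputable def reflectionPaths (n : ℕ) (w : G) : Finset (Fin (n + 1) → G) :=
  Finset.univ.filter fun y => y 0 = 1 ∧ y (Fin.last n) = w ∧
    ∀ i : Fin n, IsReflectionOf S ((y i.castSucc)⁻¹ * y i.succ)

lemma mem_reflectionPaths {n : ℕ} {w : G} {y : Fin (n + 1) → G} :
    y ∈ reflectionPaths S n w ↔ y 0 = 1 ∧ y (Fin.last n) = w ∧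
      ∀ i : Fin n, IsReflectionOf S ((y i.castSucc)⁻¹ * y i.succ) := by
  simp [reflectionPaths]

lemma maxChainCount_eq_card
    (hS : ∀ w : G, ∃ l : List G, (∀ t ∈ l, IsReflectionOf S t) ∧ l.prod = w) {n : ℕ} {c : G}
    (hc : absLength S c = n) : maxChainCount S c n = (reflectionPaths S n c).card :=
  Nat.subtype_card _ fun _ => mem_reflectionPaths.trans <|
    and_congr_right fun h0 => and_congr_right fun h1 => (isMaximalChain_iff hS hc h0 h1).symm

open Classical in
lemma card_reflectionPaths_zero (w : G) :
    (reflectionPaths S 0 w).card = if w = 1 then 1 else 0 := by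
  split_ifs with h
  · subst h
    rw [Finset.card_eq_one]
    refine ⟨fun _ => 1, Finset.eq_singleton_iff_unique_mem.2 ⟨?_, fun y hy => ?_⟩⟩
    · simp [mem_reflectionPaths]
    · funext i
      rw [Fin.fin_one_eq_zero i, (mem_reflectionPaths.1 hy).1]
  · rw [Finset.card_eq_zero, Finset.eq_empty_iff_forall_notMem]
    intro y hy
    rw [mem_reflectionPaths] at hy
    exact h (hy.2.1.symm.trans hy.1)

lemma card_reflectionPaths_succ {T : Finset G} (hT : ∀ t, t ∈ T ↔ IsReflectionOf S t)
    (hT1 : ∀ t ∈ T, t * t = 1) (n : ℕ) (w : G) :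
    (reflectionPaths S (n + 1) w).card = ∑ t ∈ T, (reflectionPaths S n (w * t)).card := by
  classical
  have hf : ∀ y ∈ reflectionPaths S (n + 1) w, (y (Fin.last n).castSucc)⁻¹ * w ∈ T := by
    intro y hy
    rw [mem_reflectionPaths] at hy
    rw [hT, ← hy.2.1]
    exact hy.2.2 (Fin.last n)
  rw [Finset.card_eq_sum_card_fiberwise hf]
  refine Finset.sum_congr rfl fun t ht => ?_
  have htt : t⁻¹ = t := inv_eq_of_mul_eq_one_left (hT1 t ht)
  refine Finset.card_bij' (fun y _ i => y i.castSucc)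
    (fun z _ => Fin.snoc (α := fun _ => G) z w) ?_ ?_ ?_ ?_
  · intro y hy
    obtain ⟨hy, hyt⟩ := Finset.mem_filter.1 hy
    rw [mem_reflectionPaths] at hy
    refine mem_reflectionPaths.2 ⟨hy.1, ?_, fun i => hy.2.2 i.castSucc⟩
    rw [← htt, ← hyt]
    group
  · intro z hz
    obtain ⟨h0, h1, h2⟩ := mem_reflectionPaths.1 hz
    refine Finset.mem_filter.2 ⟨mem_reflectionPaths.2 ⟨?_, Fin.snoc_last .., ?_⟩, ?_⟩
    · rw [← Fin.castSucc_zero, Fin.snoc_castSucc, h0]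
    · refine Fin.lastCases ?_ fun i => ?_
      · rw [Fin.snoc_castSucc, Fin.succ_last, Fin.snoc_last, h1, mul_inv_rev, inv_mul_cancel_right,
          htt]
        exact (hT t).1 ht
      · rw [Fin.snoc_castSucc, Fin.succ_castSucc, Fin.snoc_castSucc]
        exact h2 i
    · rw [Fin.snoc_castSucc, h1, mul_inv_rev, inv_mul_cancel_right, htt]
  · intro y hy
    have hy := mem_reflectionPaths.1 (Finset.mem_filter.1 hy).1
    conv_lhs => rw [← hy.2.1]
    exact Fin.snoc_init_self y
  · intro z _
    funext i
    rw [Fin.snoc_castSucc]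

end ReflectionPaths

namespace CoxeterSystem

open CoxeterMatrix

variable {B W : Type*} [Group W] {M : CoxeterMatrix B} (cs : CoxeterSystem M W)
  [Fintype B] [DecidableEq B]

omit [Fintype B] [DecidableEq B] in
lemma isReflectionOf_simple (i : B) : IsReflectionOf (simpleSet cs) (cs.simple i) :=
  ⟨1, _, ⟨i, rfl⟩, by simp⟩

omit [Fintype B] [DecidableEq B] in
lemma exists_reflection_list (w : W) :
    ∃ l : List W, (∀ t ∈ l, IsReflectionOf (simpleSet cs) t) ∧ l.prod = w := by
  obtain ⟨l, rfl⟩ := cs.wordProd_surjective w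
  refine ⟨l.map cs.simple, ?_, rfl⟩
  simpa using fun i _ => cs.isReflectionOf_simple i

lemma isConn_univ (hirr : IsIrreducibleCS cs) : M.IsConn Finset.univ := by
  obtain ⟨hB, h⟩ := hirr
  refine ⟨Finset.univ_nonempty, fun L _ hL hLo => ?_⟩
  rcases h L fun a ha b hb => cs.commute_simple (hLo a ha b (by simpa using hb)) with h | h
  · exact absurd (Finset.coe_eq_empty.1 h) hL.ne_empty
  · exact Finset.coe_eq_univ.1 h

variable [Fintype W]

lemma simple_injective : Function.Injective cs.simple := by
  intro i j h
  rw [← reflOf_simpleRoot, ← reflOf_simpleRoot] at h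
  have h1 := cs.eq_or_eq_neg_of_reflOf_eq (cs.simpleRoot_mem_roots i) (cs.simpleRoot_mem_roots j) h
  by_contra hij
  rcases h1 with h1 | h1 <;> simpa [simpleRoot, Ne.symm hij] using congrFun h1 j

open Classical in
lemma sum_roots_reflOf (g : W → ℝ) :
    ∑ γ ∈ cs.roots, g (cs.reflOf γ) = 2 * ∑ t ∈ cs.roots.image cs.reflOf, g t := by
  rw [Finset.sum_comp, Finset.mul_sum]
  refine Finset.sum_congr rfl fun t ht => ?_
  obtain ⟨γ, hγ, rfl⟩ := Finset.mem_image.1 ht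
  have h : cs.roots.filter (fun δ => cs.reflOf δ = cs.reflOf γ) = {γ, -γ} := by
    ext δ
    rw [Finset.mem_filter, Finset.mem_insert, Finset.mem_singleton]
    constructor
    · exact fun ⟨hδ, h⟩ => cs.eq_or_eq_neg_of_reflOf_eq hγ hδ h.symm
    · rintro (rfl | rfl)
      · exact ⟨hγ, rfl⟩
      · exact ⟨cs.neg_mem_roots hγ, cs.reflOf_neg hγ⟩
  rw [h, Finset.card_pair, nsmul_eq_mul, Nat.cast_ofNat]
  exact fun h => cs.root_ne_zero hγ (self_eq_neg.1 h)

theorem rootFactorizations_eq (n : ℕ) (w : W) :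
    cs.rootFactorizations n w = 2 ^ n * (reflectionPaths (simpleSet cs) n w).card := by
  classical
  induction n generalizing w with
  | zero =>
    rw [rootFactorizations, card_reflectionPaths_zero]
    split_ifs <;> simp
  | succ n ih =>
    have hT (t : W) : t ∈ cs.roots.image cs.reflOf ↔ IsReflectionOf (simpleSet cs) t := by
      rw [isReflectionOf_iff, Finset.mem_image]
    rw [card_reflectionPaths_succ hT, pow_succ, mul_assoc, Nat.cast_sum, ← sum_roots_reflOf cs
      fun t => ((reflectionPaths (simpleSet cs) n (w * t)).card : ℝ), Finset.mul_sum,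
      rootFactorizations]
    · refine Finset.sum_congr rfl fun γ _ => ?_
      rw [← ih, ← cs.rootFactorizations_conj n (cs.reflOf γ) (w * cs.reflOf γ)]
      congr 1
      group
    · intro t ht
      obtain ⟨γ, hγ, rfl⟩ := Finset.mem_image.1 ht
      exact cs.reflOf_mul_self hγ

/-- Every Coxeter element of a finite Coxeter group is conjugate to a bipartite one. -/
lemma exists_conj_eq_bipartiteCoxeter (ε : B → Bool) {c : W}
    (hc : IsCoxeterElementOf (simpleSet cs) c) :
    ∃ g : W, g * c * g⁻¹ = cs.bipartiteCoxeter ε Finset.univ := by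
  obtain ⟨l, hl, hmem, rfl⟩ := hc
  obtain ⟨l, rfl⟩ : l ∈ Set.range (List.map cs.simple) := by
    rw [Set.range_list_map]
    exact fun x hx => (hmem x).1 hx
  have hperm : l.Perm ((colorClass ε Finset.univ 0).toList ++
      (colorClass ε Finset.univ 1).toList) := by
    refine (List.perm_ext_iff_of_nodup (hl.of_map _) ?_).2 fun i => ?_
    · refine List.Nodup.append (Finset.nodup_toList _) (Finset.nodup_toList _) ?_
      intro i h0 h1
      rw [Finset.mem_toList] at h0 h1
      exact Finset.disjoint_left.1 (disjoint_colorClass 0) h0 h1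
    · have h1 : i ∈ l :=
        (List.mem_map_of_injective cs.simple_injective).1 ((hmem _).2 ⟨i, rfl⟩)
      simp only [h1, List.mem_append, Finset.mem_toList, ← Finset.mem_union, true_iff]
      rw [colorClass_union 0]
      exact Finset.mem_univ i
  have h := cs.isConj_wordProd_of_perm (hl.of_map _) hperm
  rw [wordProd_append] at h
  exact isConj_iff.1 h

lemma exists_map_reflOf_eq {l : List W} (hl : ∀ t ∈ l, IsReflectionOf (simpleSet cs) t) :
    ∃ L : List (B → ℝ), (∀ γ ∈ L, γ ∈ cs.roots) ∧ L.map cs.reflOf = l := by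
  induction l with
  | nil => exact ⟨[], by simp, rfl⟩
  | cons t l ih =>
    rw [List.forall_mem_cons] at hl
    obtain ⟨γ, hγ, rfl⟩ := cs.isReflectionOf_iff.1 hl.1
    obtain ⟨L, hL, rfl⟩ := ih hl.2
    exact ⟨γ :: L, List.forall_mem_cons.2 ⟨hγ, hL⟩, rfl⟩

lemma absLength_coxeterElement {c : W} (hc : IsCoxeterElementOf (simpleSet cs) c) :
    absLength (simpleSet cs) c = Fintype.card B := by
  refine le_antisymm ?_ ?_
  · obtain ⟨l, hl, hmem, rfl⟩ := hc
    refine (absLength_prod_le fun t ht => ?_).trans ?_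
    · obtain ⟨i, rfl⟩ := (hmem t).1 ht
      exact cs.isReflectionOf_simple i
    · classical
      rw [← List.toFinset_card_of_nodup hl, ← Finset.card_univ,
        ← Finset.card_image_of_injective _ cs.simple_injective]
      refine Finset.card_le_card fun t ht => ?_
      obtain ⟨i, rfl⟩ := (hmem t).1 (List.mem_toFinset.1 ht)
      exact Finset.mem_image_of_mem _ (Finset.mem_univ i)
  · obtain ⟨ε, hε⟩ := cs.exists_coloring
    obtain ⟨g, hg⟩ := cs.exists_conj_eq_bipartiteCoxeter ε hc
    obtain ⟨l, hl, hlen, hprod⟩ := exists_list_length_eq_absLength (cs.exists_reflection_list c)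
    obtain ⟨L, hL, rfl⟩ := cs.exists_map_reflOf_eq hl
    have h := cs.card_le_length hε (J := Finset.univ) (L := L.map (cs.geomRep g))
      (by simpa using fun γ hγ => cs.geomRep_mem_roots (hL γ hγ) g) (by
        rw [← hg, ← hprod, ← MulAut.conj_apply, map_list_prod, List.map_map, List.map_map]
        exact congrArg List.prod (List.map_congr_left fun γ hγ => cs.reflOf_geomRep (hL γ hγ) g))
    rw [← hlen]
    simpa using h

end CoxeterSystem

/-- **Theorem (uniform formula for maximal chains).**
If `W` is a finite irreducible Coxeter group of rank `n` with Coxeter number `h`, then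
`MC(W) = n!·hⁿ/|W|`, i.e. `|W| · MC(W) = n! · hⁿ`. -/
theorem max_chain_formula
    {B : Type} [Fintype B] {W : Type} [Group W] [Fintype W]
    {M : CoxeterMatrix B} (cs : CoxeterSystem M W)
    (hirr : IsIrreducibleCS cs)
    (c : W) (hc : IsCoxeterElementOf (simpleSet cs) c)
    (h : ℕ) (hh : h = orderOf c) :
    Fintype.card W * maxChainCount (simpleSet cs) c (Fintype.card B) =
      Nat.factorial (Fintype.card B) * h ^ (Fintype.card B) := by
  classical
  obtain ⟨ε, hε⟩ := cs.exists_coloring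
  obtain ⟨g, hg⟩ := cs.exists_conj_eq_bipartiteCoxeter ε hc
  have horder : orderOf (cs.bipartiteCoxeter ε Finset.univ) = h := by
    rw [hh, ← hg]
    exact (MulAut.conj g).orderOf_eq c
  have hcard : cs.parabolicFinset Finset.univ = Finset.univ := by
    ext w
    simp [CoxeterSystem.mem_parabolicFinset, CoxeterSystem.parabolicSubgroup_univ]
  have hfact := cs.rootFactorizations_bipartiteCoxeter hε _ (Finset.card_univ (α := B))
  rw [← hg, cs.rootFactorizations_conj, cs.rootFactorizations_eq,
    cs.gramSum_univ hε (cs.isConn_univ hirr), horder, hcard, Finset.card_univ] at hfact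
  have hpos : (Fintype.card W : ℝ) ≠ 0 := Nat.cast_ne_zero.2 Fintype.card_ne_zero
  have hcancel := mul_left_cancel₀ (pow_ne_zero _ two_ne_zero) hfact
  rw [eq_div_iff hpos] at hcancel
  rw [maxChainCount_eq_card cs.exists_reflection_list (cs.absLength_coxeterElement hc), mul_comm]
  exact_mod_cast hcancel
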